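/- Let 𝓑 be the complex Brjuno function and B the real Brjuno function. (1) For every Brjuno number α and every H > 0, setting W_H := {w ∈ ℂ : Im w > 0 and Im w ≥ |Re w|^H}, one has Im 𝓑(α + w) → B(α) as w → 0 with w ∈ W_H. (2) Let 0 < h < 1/2 and let α be an irrational number such that liminf_{q→∞} dist(qα, ℤ)·q^{1/h − 1} = +∞ (in particular α is a Brjuno number). Then, setting W̃_h := {w ∈ ℂ : Im w > 0 and Im w ≥ exp(−|Re w|^{−h})}, one has Im 𝓑(α + w) → B(α) as w → 0 with w ∈ W̃_h. -/

import Mathlib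

open Complex Filter Set Topology
open scoped ENNReal NNReal

noncomputable section

/-- The complement in `ℂ` of the real segment `[a, b]`. -/
def cutPlane (a b : ℝ) : Set ℂ := (Complex.ofReal '' Set.Icc a b)ᶜ

/-- `𝒪¹(ℂ̄ ∖ [a,b])`: holomorphic on `ℂ ∖ [a,b]`, vanishing at infinity. -/
def O1 (a b : ℝ) : Set (ℂ → ℂ) :=
  {φ | DifferentiableOn ℂ φ (cutPlane a b) ∧
       Tendsto φ (Bornology.cobounded ℂ) (nhds 0)}

/-- `𝒪³(ℂ̄ ∖ [a,b])`: holomorphic on `ℂ ∖ [a,b]`, with `z²ψ(z) → 0` at infinity. -/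
def O3 (a b : ℝ) : Set (ℂ → ℂ) :=
  {ψ | DifferentiableOn ℂ ψ (cutPlane a b) ∧
       Tendsto (fun z => z ^ 2 * ψ z) (Bornology.cobounded ℂ) (nhds 0)}

/-- The `m`-th term (for the integer `m+1 ≥ 1`) of the series defining `T`. -/
def Tterm (φ : ℂ → ℂ) (m : ℕ) (z : ℂ) : ℂ :=
  -z * (φ (z⁻¹ - ((m : ℂ) + 1)) - φ (-((m : ℂ) + 1))) + deriv φ (-((m : ℂ) + 1))

/-- The operator `T`. -/
def Tbrj (φ : ℂ → ℂ) : ℂ → ℂ := fun z => ∑' m : ℕ, Tterm φ m z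

/-- The operator `T⁽³⁾`. -/
def T3brj (ψ : ℂ → ℂ) : ℂ → ℂ := fun z => -∑' m : ℕ, (z⁻¹) ^ 3 * ψ (z⁻¹ - ((m : ℂ) + 1))

/-- `g(m) = (0 1; 1 m)`. -/
def gmat (m : ℤ) : Matrix (Fin 2) (Fin 2) ℤ := !![0, 1; 1, m]

/-- The monoid `ℳ`. -/
def Mmon : Set (Matrix (Fin 2) (Fin 2) ℤ) :=
  {g | g = 1 ∨
    ((g 0 0 * g 1 1 - g 0 1 * g 1 0 = 1 ∨ g 0 0 * g 1 1 - g 0 1 * g 1 0 = -1) ∧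
      g 0 1 ≤ g 1 1 ∧ g 0 0 ≤ g 0 1 ∧ 0 ≤ g 0 0 ∧ g 1 0 ≤ g 1 1 ∧ g 0 0 ≤ g 1 0)}

/-- The operator `L_g` on `𝒪¹(ℂ̄ ∖ [0,1])`, for `g = (a b; c d) ∈ ℳ`. -/
def Lop (g : Matrix (Fin 2) (Fin 2) ℤ) (φ : ℂ → ℂ) : ℂ → ℂ := fun z =>
  if g = 1 then φ z
  else
    ((g 0 0 : ℂ) - (g 1 0 : ℂ) * z) *
        (φ (((g 1 1 : ℂ) * z - (g 0 1 : ℂ)) / ((g 0 0 : ℂ) - (g 1 0 : ℂ) * z)) -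
          φ (-(g 1 1 : ℂ) / (g 1 0 : ℂ))) -
      ((g 0 0 * g 1 1 - g 0 1 * g 1 0 : ℤ) : ℂ) * ((g 1 0 : ℂ))⁻¹ *
        deriv φ (-(g 1 1 : ℂ) / (g 1 0 : ℂ))

/-- `Σ_ℳ φ`, the sum of the family `(L_g φ)_{g ∈ ℳ}`. -/
def sumM (φ : ℂ → ℂ) : ℂ → ℂ := fun z => ∑' g : Mmon, Lop g.1 φ z

/-- The domain `D`. -/
def Dset : Set ℂ :=
  {z | ‖z‖ ≤ 1 ∧ 1 ≤ ‖z - Complex.I‖ ∧ 1 ≤ ‖z + Complex.I‖ ∧ 0 < z.re}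

/-- The domain `D₀`. -/
def D0set : Set ℂ := {z | ‖z + 1‖ ≤ 1 ∧ Real.sqrt 3 / 2 - 1 ≤ z.re}

/-- The domain `D₁`. -/
def D1set : Set ℂ :=
  {z | 1 ≤ ‖z‖ ∧ ‖z - (1 / Real.sqrt 3 : ℝ)‖ ≤ 1 / Real.sqrt 3}

/-- The domain `H₀`. -/
def H0set : Set ℂ := {z | ‖z - Complex.I‖ ≤ 1 ∧ 1 ≤ ‖z + 1‖ ∧ z.im ≤ 1 / 2}

/-- The domain `H₀′`. -/
def H0set' : Set ℂ := {z | (starRingEnd ℂ) z ∈ H0set}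

/-- The domain `Δ`. -/
def Δset : Set ℂ := {z | ‖z‖ ≤ 1 ∧ 1 ≤ ‖z + 1‖ ∧ |z.im| ≤ 1 / 2}

/-- The domain `D∞`. -/
def Dinf : Set ℂ :=
  {z | 1 / 2 < |z.im|} ∪ {z | z.re < Real.sqrt 3 / 2 - 1} ∪
    {z | Real.sqrt 3 / 2 < z.re ∧ 1 / Real.sqrt 3 < ‖z - (1 / Real.sqrt 3 : ℝ)‖}

end

noncomputable section

/-- The principal dilogarithm, `Li₂(z) = −∫₀¹ log(1 − tz)/t dt`. -/
def dilog (z : ℂ) : ℂ := -∫ t in (0 : ℝ)..1, Complex.log (1 - (t : ℂ) * z) / (t : ℂ)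

/-- `φ₀(z) = −(1/π)·Li₂(1/z)`, an element of `𝒪¹(ℂ̄∖[0,1])`. -/
def phi0 (z : ℂ) : ℂ := -(Real.pi : ℂ)⁻¹ * dilog z⁻¹

/-- The complex Brjuno function built from a constant `a₀`:
`𝓑(z) = −iπa₀ + Σ_{n∈ℤ} ( Φ(z−n) − a₀·log((z−n)/(z−n−1)) )` where `Φ = Σ_ℳ φ₀`. -/
def BrjWith (a₀ : ℂ) (z : ℂ) : ℂ :=
  -Complex.I * (Real.pi : ℂ) * a₀ +
    ∑' n : ℤ, (sumM phi0 (z - (n : ℂ)) -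
      a₀ * Complex.log ((z - (n : ℂ)) / (z - (n : ℂ) - 1)))


/-- The constant `a₀ = lim_{y→+∞} iy·Φ(iy)`, `Φ = Σ_ℳ φ₀`. -/
def a0 : ℂ :=
  limUnder atTop (fun y : ℝ => Complex.I * (y : ℂ) * sumM phi0 (Complex.I * (y : ℂ)))

/-- The complex Brjuno function `𝓑` on the upper half-plane. -/
def BrjunoC (z : ℂ) : ℂ := BrjWith a0 z

/-- The Gauss continued-fraction iterates of `α`: `x₀ = {α}`, `x_{n+1} = {1/x_n}`. -/
def xseq (α : ℝ) : ℕ → ℝ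
  | 0 => Int.fract α
  | n + 1 => Int.fract (xseq α n)⁻¹

/-- The `n`-th term `β_{n−1}·log(1/x_n)` of the Brjuno series of `α`. -/
def brjTerm (α : ℝ) (n : ℕ) : ℝ :=
  (∏ i ∈ Finset.range n, xseq α i) * Real.log (xseq α n)⁻¹

theorem one_sub_ofReal_div_mem_slitPlane {z : ℂ} (hz : z ∈ cutPlane 0 1) {t : ℝ}
    (ht : t ∈ Icc (0 : ℝ) 1) : 1 - (t : ℂ) * z⁻¹ ∈ slitPlane := by
  have hz0 : z ≠ 0 := by
    rintro rfl
    exact hz ⟨0, ⟨le_rfl, zero_le_one⟩, by simp⟩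
  by_contra hcon
  rw [Complex.mem_slitPlane_iff, not_or, not_lt, not_not] at hcon
  obtain ⟨h1, h2⟩ := hcon
  set w := (t : ℂ) * z⁻¹ with hw
  simp only [sub_re, one_re, sub_im, one_im, zero_sub, neg_eq_zero] at h1 h2
  have hwr : w = (w.re : ℂ) := by
    apply Complex.ext <;> simp [← h2]
  have hw0 : w.re ≠ 0 := by linarith
  apply hz
  refine ⟨t / w.re, ⟨div_nonneg ht.1 (by linarith), ?_⟩, ?_⟩
  · rw [div_le_one (by linarith)]
    linarith [ht.2]
  · push_cast
    rw [← hwr, hw]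
    have ht0 : (t : ℂ) ≠ 0 := by
      rintro h
      rw [h, zero_mul] at hw
      rw [hw] at hw0
      simp at hw0
    field_simp

theorem ofReal_sub_ne_zero_of_mem_cutPlane {z : ℂ} (hz : z ∈ cutPlane 0 1) {t : ℝ}
    (ht : t ∈ Icc (0 : ℝ) 1) : (t : ℂ) - z ≠ 0 := by
  intro h
  exact hz ⟨t, ht, sub_eq_zero.mp h⟩

theorem intervalIntegrable_log_mul {f : ℝ → ℂ} (hf : ContinuousOn f (Icc 0 1)) :
    IntervalIntegrable (fun t : ℝ => (Real.log t : ℂ) * f t) MeasureTheory.volume 0 1 := by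
  have h1 : IntervalIntegrable (fun t : ℝ => (Real.log t : ℂ)) MeasureTheory.volume 0 1 :=
    (intervalIntegrable_iff_integrableOn_Ioc_of_le zero_le_one).mpr
      ((intervalIntegrable_iff_integrableOn_Ioc_of_le zero_le_one).mp
        intervalIntegral.intervalIntegrable_log').ofReal
  exact h1.mul_continuousOn (by rwa [uIcc_of_le zero_le_one])

theorem continuousOn_inv_ofReal_sub {z : ℂ} (hz : z ∈ cutPlane 0 1) :
    ContinuousOn (fun t : ℝ => ((t : ℂ) - z)⁻¹) (Icc 0 1) :=
  ContinuousOn.inv₀ (by fun_prop) fun _ ht => ofReal_sub_ne_zero_of_mem_cutPlane hz ht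

/-- The dilogarithm kernel as a Cauchy transform of `log` on the unit interval. -/
theorem dilog_inv_eq {z : ℂ} (hz : z ∈ cutPlane 0 1) :
    dilog z⁻¹ = ∫ t in (0 : ℝ)..1, (Real.log t : ℂ) * ((t : ℂ) - z)⁻¹ := by
  have hz0 : z ≠ 0 := by
    rintro rfl
    exact hz ⟨0, ⟨le_rfl, zero_le_one⟩, by simp⟩
  have hcontlog : ContinuousOn (fun t : ℝ => Complex.log (1 - (t : ℂ) * z⁻¹)) (Icc 0 1) :=
    ContinuousOn.clog (by fun_prop) fun t ht => one_sub_ofReal_div_mem_slitPlane hz ht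
  have hder : ∀ t ∈ Icc (0 : ℝ) 1,
      HasDerivAt (fun t : ℝ => Complex.log (1 - (t : ℂ) * z⁻¹)) (((t : ℂ) - z)⁻¹) t := by
    intro t ht
    have h1 : HasDerivAt (fun t : ℝ => 1 - (t : ℂ) * z⁻¹) (-z⁻¹) t := by
      have := ((Complex.ofRealCLM.hasDerivAt (x := t)).mul_const z⁻¹).const_sub 1
      simpa using this
    have h2 := h1.clog_real (one_sub_ofReal_div_mem_slitPlane hz ht)
    convert h2 using 1
    have h3 := ofReal_sub_ne_zero_of_mem_cutPlane hz ht
    have h4 := slitPlane_ne_zero (one_sub_ofReal_div_mem_slitPlane hz ht)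
    rw [eq_div_iff h4]
    field_simp
    ring
  set G : ℝ → ℂ := fun t => Complex.log (1 - (t : ℂ) * z⁻¹) with hG
  have hG0 : G 0 = 0 := by simp [hG]
  have hslope : ∀ t : ℝ, t ≠ 0 → dslope G 0 t = G t / t := by
    intro t ht
    rw [dslope_of_ne _ ht, slope_def_module, hG0, sub_zero, sub_zero, Complex.real_smul,
      Complex.ofReal_inv, div_eq_inv_mul]
  have hdcont : ContinuousOn (dslope G 0) (Icc 0 1) := by
    intro t ht
    rcases eq_or_ne t 0 with rfl | h
    · exact (continuousAt_dslope_same.mpr (hder 0 ht).differentiableAt).continuousWithinAt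
    · exact (continuousWithinAt_dslope_of_ne h).mpr (hcontlog t ht)
  have hprod : ∀ t : ℝ, (Real.log t : ℂ) * G t = ((t * Real.log t : ℝ) : ℂ) * dslope G 0 t := by
    intro t
    rcases eq_or_ne t 0 with rfl | h
    · simp
    · rw [hslope t h]
      have : (t : ℂ) ≠ 0 := by exact_mod_cast h
      push_cast
      field_simp
  have hcont : ContinuousOn (fun t : ℝ => (Real.log t : ℂ) * G t) (Icc 0 1) := by
    simp_rw [hprod]
    exact ((Complex.continuous_ofReal.comp Real.continuous_mul_log).continuousOn).mul hdcont
  have hint1 : IntervalIntegrable (fun t : ℝ => dslope G 0 t) MeasureTheory.volume 0 1 :=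
    ContinuousOn.intervalIntegrable (by rwa [uIcc_of_le zero_le_one])
  have hint2 := intervalIntegrable_log_mul (continuousOn_inv_ofReal_sub hz)
  have hftc := intervalIntegral.integral_eq_sub_of_hasDerivAt_of_le zero_le_one hcont
    (f' := fun t => dslope G 0 t + (Real.log t : ℂ) * ((t : ℂ) - z)⁻¹) (by
      intro t ht
      have h1 : HasDerivAt (fun t : ℝ => (Real.log t : ℂ)) ((t⁻¹ : ℝ) : ℂ) t :=
        (Real.hasDerivAt_log ht.1.ne').ofReal_comp
      have h2 := h1.mul (hder t ⟨ht.1.le, ht.2.le⟩)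
      refine h2.congr_deriv ?_
      rw [hslope t ht.1.ne', Complex.ofReal_inv, div_eq_inv_mul]) (hint1.add hint2)
  rw [intervalIntegral.integral_add hint1 hint2] at hftc
  have hcongr : ∫ t in (0 : ℝ)..1, Complex.log (1 - (t : ℂ) * z⁻¹) / (t : ℂ) =
      ∫ t in (0 : ℝ)..1, dslope G 0 t := by
    apply intervalIntegral.integral_congr_ae
    refine Filter.Eventually.of_forall fun t ht => ?_
    rw [uIoc_of_le zero_le_one] at ht
    exact (hslope t ht.1.ne').symm
  simp only [hG0, Real.log_one, ofReal_zero, zero_mul, mul_zero, sub_zero] at hftc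
  rw [dilog, hcongr]
  linear_combination -hftc

theorem phi0_eq {z : ℂ} (hz : z ∈ cutPlane 0 1) :
    phi0 z = (Real.pi : ℂ)⁻¹ * ∫ t in (0 : ℝ)..1, (-Real.log t : ℂ) * ((t : ℂ) - z)⁻¹ := by
  rw [phi0, dilog_inv_eq hz]
  simp only [neg_mul, intervalIntegral.integral_neg, mul_neg]

theorem hasDerivAt_phi0_of_neg {p : ℝ} (hp : p < 0) :
    HasDerivAt phi0
      ((Real.pi : ℂ)⁻¹ * ∫ t in (0 : ℝ)..1, (-Real.log t : ℂ) * (((t : ℂ) - p) ^ 2)⁻¹) p := by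
  have hball : ∀ z ∈ Metric.ball (p : ℂ) (-p / 2), ∀ t ∈ Icc (0 : ℝ) 1, -p / 2 ≤ ‖(t : ℂ) - z‖ := by
    intro z hz t ht
    rw [Metric.mem_ball, Complex.dist_eq] at hz
    have h1 : |(z - p).re| ≤ ‖z - p‖ := Complex.abs_re_le_norm _
    have h2 : |((t : ℂ) - z).re| ≤ ‖(t : ℂ) - z‖ := Complex.abs_re_le_norm _
    simp only [sub_re, ofReal_re] at h1 h2
    have h3 := le_abs_self (z.re - p)
    have h4 := le_abs_self (t - z.re)
    linarith [ht.1]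
  have hmem : ∀ z ∈ Metric.ball (p : ℂ) (-p / 2), z ∈ cutPlane 0 1 := by
    rintro z hz ⟨t, ht, rfl⟩
    have := hball _ hz t ht
    rw [sub_self, norm_zero] at this
    linarith
  have hpos : 0 < -p / 2 := by linarith
  have hpmem : (p : ℂ) ∈ Metric.ball (p : ℂ) (-p / 2) := Metric.mem_ball_self hpos
  have hmeas : ∀ z ∈ Metric.ball (p : ℂ) (-p / 2), IntervalIntegrable
      (fun t : ℝ => (-Real.log t : ℂ) * ((t : ℂ) - z)⁻¹) MeasureTheory.volume 0 1 := by
    intro z hz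
    have := (intervalIntegrable_log_mul (continuousOn_inv_ofReal_sub (hmem z hz))).neg
    refine this.congr (fun t _ => ?_)
    simp
  have hmeas' : IntervalIntegrable
      (fun t : ℝ => (-Real.log t : ℂ) * (((t : ℂ) - p) ^ 2)⁻¹) MeasureTheory.volume 0 1 := by
    have hc : ContinuousOn (fun t : ℝ => (((t : ℂ) - p) ^ 2)⁻¹) (Icc 0 1) :=
      ContinuousOn.inv₀ (by fun_prop) fun _ ht =>
        pow_ne_zero 2 (ofReal_sub_ne_zero_of_mem_cutPlane (hmem _ hpmem) ht)
    refine (intervalIntegrable_log_mul hc).neg.congr (fun t _ => ?_)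
    simp
  have key := intervalIntegral.hasDerivAt_integral_of_dominated_loc_of_deriv_le
    (μ := MeasureTheory.volume) (a := 0) (b := 1) (𝕜 := ℂ)
    (F := fun z t => (-Real.log t : ℂ) * ((t : ℂ) - z)⁻¹)
    (F' := fun z t => (-Real.log t : ℂ) * (((t : ℂ) - z) ^ 2)⁻¹)
    (x₀ := (p : ℂ)) (s := Metric.ball (p : ℂ) (-p / 2))
    (bound := fun t => |Real.log t| * ((-p / 2) ^ 2)⁻¹)
    (Metric.ball_mem_nhds _ hpos)
    (Filter.eventually_of_mem (Metric.ball_mem_nhds _ hpos) fun z hz =>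
      (hmeas z hz).aestronglyMeasurable_restrict_uIoc)
    (hmeas _ hpmem) hmeas'.aestronglyMeasurable_restrict_uIoc
    (Filter.Eventually.of_forall fun t ht z hz => by
      rw [uIoc_of_le zero_le_one] at ht
      have h1 := hball z hz t ⟨ht.1.le, ht.2⟩
      rw [norm_mul, norm_neg, Complex.norm_real, Real.norm_eq_abs, norm_inv, norm_pow]
      gcongr)
    ((intervalIntegral.intervalIntegrable_log'.abs).mul_const _)
    (Filter.Eventually.of_forall fun t ht z hz => by
      rw [uIoc_of_le zero_le_one] at ht
      have h1 := ofReal_sub_ne_zero_of_mem_cutPlane (hmem z hz) ⟨ht.1.le, ht.2⟩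
      have h2 := ((hasDerivAt_id z).const_sub (t : ℂ)).inv h1
      have h3 := h2.const_mul (-Real.log t : ℂ)
      refine h3.congr_deriv ?_
      simp [div_eq_mul_inv])
  have h2 := key.2.const_mul (Real.pi : ℂ)⁻¹
  refine h2.congr_of_eventuallyEq ?_
  filter_upwards [Metric.ball_mem_nhds (p : ℂ) hpos] with z hz
  exact phi0_eq (hmem z hz)

/-- The determinant of a `2 × 2` integer matrix, written out. -/
def det2 (g : Matrix (Fin 2) (Fin 2) ℤ) : ℤ := g 0 0 * g 1 1 - g 0 1 * g 1 0

/-- The Möbius action of an integer matrix on the real line. -/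
def mob (g : Matrix (Fin 2) (Fin 2) ℤ) (s : ℝ) : ℝ :=
  ((g 0 0 : ℝ) * s + g 0 1) / ((g 1 0 : ℝ) * s + g 1 1)

/-- The weight with which `g` transports `log (1/s) ds` to the boundary density of `L_g φ₀`. -/
def mobWeight (g : Matrix (Fin 2) (Fin 2) ℤ) (s : ℝ) : ℝ :=
  -Real.log s * (((g 1 0 : ℝ) * s + g 1 1) ^ 3)⁻¹

theorem Mmon_entries {g : Matrix (Fin 2) (Fin 2) ℤ} (hg : g ∈ Mmon) :
    (det2 g = 1 ∨ det2 g = -1) ∧ 0 ≤ g 0 0 ∧ 0 ≤ g 0 1 ∧ 0 ≤ g 1 0 ∧ 1 ≤ g 1 1 ∧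
      g 0 1 ≤ g 1 1 ∧ g 1 0 ≤ g 1 1 ∧ g 0 0 + g 0 1 ≤ g 1 0 + g 1 1 := by
  rcases hg with rfl | ⟨hdet, h1, h2, h3, h4, h5⟩
  · simp [det2]
  · refine ⟨hdet, h3, by omega, by omega, ?_, h1, h4, by omega⟩
    by_contra hcon
    have h11 : g 1 1 = 0 := by omega
    have h10 : g 1 0 = 0 := by omega
    rw [h11, h10] at hdet
    omega

theorem Mmon_entries_of_ne_one {g : Matrix (Fin 2) (Fin 2) ℤ} (hg : g ∈ Mmon) (hne : g ≠ 1) :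
    (det2 g = 1 ∨ det2 g = -1) ∧ 0 ≤ g 0 0 ∧ 1 ≤ g 0 1 ∧ 1 ≤ g 1 0 ∧ 1 ≤ g 1 1 ∧
      g 0 1 ≤ g 1 1 ∧ g 1 0 ≤ g 1 1 ∧ g 0 0 ≤ g 0 1 ∧ g 0 0 ≤ g 1 0 := by
  rcases hg with rfl | ⟨hdet, h1, h2, h3, h4, h5⟩
  · exact absurd rfl hne
  · have hb : 1 ≤ g 0 1 := by
      by_contra hcon
      have h01 : g 0 1 = 0 := by omega
      have h00 : g 0 0 = 0 := by omega
      rw [h01, h00] at hdet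
      omega
    have hc : 1 ≤ g 1 0 := by
      by_contra hcon
      have h10 : g 1 0 = 0 := by omega
      have h00 : g 0 0 = 0 := by omega
      rw [h10, h00] at hdet
      omega
    exact ⟨hdet, h3, hb, hc, by omega, h1, h4, h2, h5⟩

theorem mob_denom_pos {g : Matrix (Fin 2) (Fin 2) ℤ} (hg : g ∈ Mmon) {s : ℝ} (hs : 0 ≤ s) :
    (g 1 1 : ℝ) ≤ (g 1 0 : ℝ) * s + g 1 1 ∧ (1 : ℝ) ≤ g 1 1 := by
  obtain ⟨-, -, -, hc, hd, -⟩ := Mmon_entries hg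
  have hc' : (0 : ℝ) ≤ g 1 0 := by exact_mod_cast hc
  have hd' : (1 : ℝ) ≤ g 1 1 := by exact_mod_cast hd
  exact ⟨by nlinarith, hd'⟩

theorem det2_sq {g : Matrix (Fin 2) (Fin 2) ℤ} (hg : g ∈ Mmon) : (det2 g) ^ 2 = 1 := by
  rcases (Mmon_entries hg).1 with h | h <;> simp [h]

theorem intervalIntegrable_neg_log_mul {f : ℝ → ℂ} (hf : ContinuousOn f (Icc 0 1)) :
    IntervalIntegrable (fun t : ℝ => (-Real.log t : ℂ) * f t) MeasureTheory.volume 0 1 := by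
  refine (intervalIntegrable_log_mul hf).neg.congr (fun t _ => ?_)
  simp

/-- Pointwise identity behind the Cauchy-transform formula for `L_g`. -/
theorem Lop_kernel_identity {u N D c e : ℂ} (hN : N ≠ 0) (hD : D ≠ 0)
    (he : e ^ 2 = 1) (hrel : c * N = u * D - e) :
    u * ((N / u)⁻¹ - (D / c)⁻¹) - e * c⁻¹ * ((D / c) ^ 2)⁻¹ = (D ^ 3)⁻¹ * (N / D)⁻¹ := by
  have h1 : u ^ 2 * D ^ 2 - u * c * N * D - e * c * N = 1 := by
    linear_combination he - (u * D + e) * hrel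
  field_simp
  linear_combination h1

/-- `L_g φ₀` is a Cauchy transform of a positive density. -/
theorem Lop_phi0_eq {g : Matrix (Fin 2) (Fin 2) ℤ} (hg : g ∈ Mmon) {z : ℂ} (hz : z.im ≠ 0) :
    Lop g phi0 z = (Real.pi : ℂ)⁻¹ *
      ∫ s in (0 : ℝ)..1, (mobWeight g s : ℂ) * ((mob g s : ℂ) - z)⁻¹ := by
  have him : ∀ w : ℂ, w.im ≠ 0 → w ∈ cutPlane 0 1 := by
    rintro w hw ⟨t, -, rfl⟩
    exact hw (Complex.ofReal_im t)
  by_cases hne : g = 1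
  · subst hne
    rw [Lop, if_pos rfl, phi0_eq (him z hz)]
    simp [mob, mobWeight]
  obtain ⟨hdet, ha, hb, hc, hd, -⟩ := Mmon_entries_of_ne_one hg hne
  have hcR : (1 : ℝ) ≤ g 1 0 := by exact_mod_cast hc
  have hdR : (1 : ℝ) ≤ g 1 1 := by exact_mod_cast hd
  have hcC : (g 1 0 : ℂ) ≠ 0 := by
    have : g 1 0 ≠ 0 := by omega
    exact_mod_cast this
  set u : ℂ := (g 0 0 : ℂ) - (g 1 0 : ℂ) * z with hu
  have hu0 : u ≠ 0 := by
    intro h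
    have := congrArg Complex.im h
    simp [hu] at this
    rcases this with h | h
    · omega
    · exact hz h
  set ζ : ℂ := ((g 1 1 : ℂ) * z - (g 0 1 : ℂ)) / u with hζ
  have hζcut : ζ ∈ cutPlane 0 1 := by
    rintro ⟨t, ht, h⟩
    rw [hζ, eq_div_iff hu0] at h
    have := congrArg Complex.im h
    simp [hu] at this
    have h2 : ((g 1 1 : ℝ) + t * g 1 0) * z.im = 0 := by linarith
    rcases mul_eq_zero.mp h2 with h3 | h3
    · nlinarith [ht.1]
    · exact hz h3
  set p : ℝ := -(g 1 1 : ℝ) / (g 1 0 : ℝ) with hp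
  have hpneg : p < 0 := by
    rw [hp]
    exact div_neg_of_neg_of_pos (by linarith) (by linarith)
  have hpcut : (p : ℂ) ∈ cutPlane 0 1 := by
    rintro ⟨t, ht, h⟩
    have : t = p := by exact_mod_cast h
    linarith [ht.1]
  have hpC : -(g 1 1 : ℂ) / (g 1 0 : ℂ) = (p : ℂ) := by
    rw [hp]
    push_cast
    ring
  have hI1 := intervalIntegrable_neg_log_mul (continuousOn_inv_ofReal_sub hζcut)
  have hI2 := intervalIntegrable_neg_log_mul (continuousOn_inv_ofReal_sub hpcut)
  have hI3 := intervalIntegrable_neg_log_mul (f := fun t : ℝ => (((t : ℂ) - p) ^ 2)⁻¹)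
    (ContinuousOn.inv₀ (by fun_prop) fun _ ht =>
        pow_ne_zero 2 (ofReal_sub_ne_zero_of_mem_cutPlane hpcut ht))
  have hI4 := (hI1.sub hI2).const_mul u
  have hI5 := hI3.const_mul (((det2 g : ℤ) : ℂ) * ((g 1 0 : ℂ))⁻¹)
  have hL : Lop g phi0 z = (Real.pi : ℂ)⁻¹ *
      (∫ s in (0 : ℝ)..1, (u * ((-Real.log s : ℂ) * ((s : ℂ) - ζ)⁻¹
          - (-Real.log s : ℂ) * ((s : ℂ) - p)⁻¹)
        - ((det2 g : ℤ) : ℂ) * ((g 1 0 : ℂ))⁻¹ *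
          ((-Real.log s : ℂ) * (((s : ℂ) - p) ^ 2)⁻¹))) := by
    rw [intervalIntegral.integral_sub hI4 hI5, intervalIntegral.integral_const_mul,
      intervalIntegral.integral_const_mul, intervalIntegral.integral_sub hI1 hI2]
    rw [Lop, if_neg hne, hpC, (hasDerivAt_phi0_of_neg hpneg).deriv, phi0_eq hζcut, phi0_eq hpcut]
    simp only [det2]
    ring
  rw [hL]
  congr 1
  apply intervalIntegral.integral_congr
  intro s hs
  rw [uIcc_of_le zero_le_one] at hs
  have hD0 := (mob_denom_pos hg hs.1)
  have hD : ((g 1 0 : ℂ) * s + g 1 1) ≠ 0 := by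
    have : (g 1 0 : ℝ) * s + g 1 1 ≠ 0 := by linarith
    exact_mod_cast this
  set D : ℂ := (g 1 0 : ℂ) * s + g 1 1 with hDdef
  set N : ℂ := ((g 0 0 : ℂ) * s + g 0 1) - z * D with hNdef
  have e1 : (s : ℂ) - ζ = N / u := by
    rw [hζ, eq_div_iff hu0, sub_mul, div_mul_cancel₀ _ hu0, hNdef, hDdef, hu]
    ring
  have e2 : (s : ℂ) - p = D / (g 1 0 : ℂ) := by
    rw [← hpC, hDdef]
    field_simp
    ring
  have e3 : ((mob g s : ℝ) : ℂ) - z = N / D := by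
    rw [mob]
    push_cast
    rw [← hDdef, hNdef]
    field_simp
  have hN : N ≠ 0 := by
    intro h
    rw [h, zero_div] at e1
    exact ofReal_sub_ne_zero_of_mem_cutPlane hζcut hs e1
  have key := Lop_kernel_identity (u := u) (N := N) (D := D) (c := (g 1 0 : ℂ))
    (e := ((det2 g : ℤ) : ℂ)) hN hD
    (by exact_mod_cast det2_sq hg) (by
      rw [hNdef, hDdef, hu, det2]
      push_cast
      ring)
  have hw : ((mobWeight g s : ℝ) : ℂ) = (-Real.log s : ℂ) * (D ^ 3)⁻¹ := by
    rw [mobWeight, hDdef]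
    push_cast
    ring
  simp only
  rw [e1, e2, e3, hw]
  linear_combination (-(Real.log s : ℂ)) * key

/-- An element of the monoid is determined by its second column and its determinant. -/
theorem Mmon_ext {g g' : Matrix (Fin 2) (Fin 2) ℤ} (hg : g ∈ Mmon) (hg' : g' ∈ Mmon)
    (hb : g 0 1 = g' 0 1) (hd : g 1 1 = g' 1 1) (he : det2 g = det2 g') : g = g' := by
  by_cases h1 : g = 1
  · by_cases h1' : g' = 1
    · rw [h1, h1']
    · have := (Mmon_entries_of_ne_one hg' h1').2.2.1
      rw [← hb, h1] at this
      norm_num at this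
  by_cases h1' : g' = 1
  · have := (Mmon_entries_of_ne_one hg h1).2.2.1
    rw [hb, h1'] at this
    norm_num at this
  obtain ⟨hdet, ha, hb1, hc, hd1, hbd, hcd, -⟩ := Mmon_entries_of_ne_one hg h1
  obtain ⟨-, ha', -, hc', -, -, hcd', -⟩ := Mmon_entries_of_ne_one hg' h1'
  have hcop : IsCoprime (g 1 1) (g 0 1) := by
    rcases hdet with h | h
    · exact ⟨g 0 0, -g 1 0, by rw [← h, det2]; ring⟩
    · exact ⟨-g 0 0, g 1 0, by rw [det2] at h; linarith⟩
  have hrel : (g 0 0 - g' 0 0) * g 1 1 = g 0 1 * (g 1 0 - g' 1 0) := by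
    rw [det2, det2, ← hb, ← hd] at he
    linarith
  have hdvd : g 1 1 ∣ g 1 0 - g' 1 0 :=
    hcop.dvd_of_dvd_mul_left ⟨g 0 0 - g' 0 0, by rw [← hrel]; ring⟩
  have hc0 : g 1 0 - g' 1 0 = 0 :=
    Int.eq_zero_of_abs_lt_dvd hdvd (by rw [abs_lt]; constructor <;> omega)
  rw [hc0, mul_zero] at hrel
  have ha0 : g 0 0 - g' 0 0 = 0 := by
    rcases mul_eq_zero.mp hrel with h | h
    · exact h
    · omega
  ext i j
  fin_cases i <;> fin_cases j <;> simp <;> omega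

theorem mob_mem_Icc {g : Matrix (Fin 2) (Fin 2) ℤ} (hg : g ∈ Mmon) {s : ℝ} (hs : s ∈ Icc (0:ℝ) 1) :
    mob g s ∈ Icc (0 : ℝ) 1 := by
  obtain ⟨-, ha, hb, hc, hd, hbd, hcd, hs1⟩ := Mmon_entries hg
  have hD := mob_denom_pos hg hs.1
  have ha' : (0 : ℝ) ≤ g 0 0 := by exact_mod_cast ha
  have hb' : (0 : ℝ) ≤ g 0 1 := by exact_mod_cast hb
  have hbd' : (g 0 1 : ℝ) ≤ g 1 1 := by exact_mod_cast hbd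
  have hs1' : (g 0 0 : ℝ) + g 0 1 ≤ g 1 0 + g 1 1 := by exact_mod_cast hs1
  rw [mob]
  constructor
  · exact div_nonneg (by nlinarith [hs.1]) (by linarith)
  · rw [div_le_one (by linarith)]
    nlinarith [hs.1, hs.2, mul_nonneg hs.1 (sub_nonneg.mpr hs1'),
      mul_nonneg (sub_nonneg.mpr hs.2) (sub_nonneg.mpr hbd')]

theorem mobWeight_nonneg {g : Matrix (Fin 2) (Fin 2) ℤ} (hg : g ∈ Mmon) {s : ℝ}
    (hs : s ∈ Icc (0:ℝ) 1) : 0 ≤ mobWeight g s := by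
  have hD := mob_denom_pos hg hs.1
  exact mul_nonneg (neg_nonneg.mpr (Real.log_nonpos hs.1 hs.2))
    (inv_nonneg.mpr (pow_nonneg (by linarith) 3))

theorem mobWeight_le {g : Matrix (Fin 2) (Fin 2) ℤ} (hg : g ∈ Mmon) {s : ℝ}
    (hs : s ∈ Icc (0:ℝ) 1) : mobWeight g s ≤ -Real.log s * ((g 1 1 : ℝ) ^ 3)⁻¹ := by
  have hD := mob_denom_pos hg hs.1
  exact mul_le_mul_of_nonneg_left (inv_anti₀ (pow_pos (by linarith) 3)
    (pow_le_pow_left₀ (by linarith) hD.1 3)) (neg_nonneg.mpr (Real.log_nonpos hs.1 hs.2))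

theorem measurable_mob (g : Matrix (Fin 2) (Fin 2) ℤ) : Measurable (mob g) := by
  unfold mob
  fun_prop

theorem measurable_mobWeight (g : Matrix (Fin 2) (Fin 2) ℤ) : Measurable (mobWeight g) := by
  unfold mobWeight
  fun_prop

theorem lintegral_neg_log : ∫⁻ s in Ioc (0:ℝ) 1, ENNReal.ofReal (-Real.log s) = 1 := by
  rw [← MeasureTheory.ofReal_integral_eq_lintegral_ofReal]
  · rw [← intervalIntegral.integral_of_le zero_le_one, intervalIntegral.integral_neg, integral_log]
    simp
  · exact ((intervalIntegral.intervalIntegrable_log' (a := 0) (b := 1)).neg.1)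
  · filter_upwards [MeasureTheory.ae_restrict_mem measurableSet_Ioc] with s hs
    exact neg_nonneg.mpr (Real.log_nonpos hs.1.le hs.2)

/-- The boundary density of `L_g φ₀`, in the coordinate `s`. -/
def coreMeasure (g : Matrix (Fin 2) (Fin 2) ℤ) : MeasureTheory.Measure ℝ :=
  (MeasureTheory.volume.restrict (Ioc (0:ℝ) 1)).withDensity fun s => ENNReal.ofReal (mobWeight g s)

theorem coreMeasure_univ_le {g : Matrix (Fin 2) (Fin 2) ℤ} (hg : g ∈ Mmon) :
    coreMeasure g univ ≤ ENNReal.ofReal (((g 1 1 : ℝ) ^ 3)⁻¹) := by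
  rw [coreMeasure, MeasureTheory.withDensity_apply _ MeasurableSet.univ,
    MeasureTheory.Measure.restrict_univ]
  calc ∫⁻ s in Ioc (0:ℝ) 1, ENNReal.ofReal (mobWeight g s)
      ≤ ∫⁻ s in Ioc (0:ℝ) 1, ENNReal.ofReal (-Real.log s) * ENNReal.ofReal (((g 1 1 : ℝ) ^ 3)⁻¹) := by
        refine MeasureTheory.setLIntegral_mono' measurableSet_Ioc fun s hs => ?_
        rw [← ENNReal.ofReal_mul (neg_nonneg.mpr (Real.log_nonpos hs.1.le hs.2))]
        exact ENNReal.ofReal_le_ofReal (mobWeight_le hg ⟨hs.1.le, hs.2⟩)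
    _ = ENNReal.ofReal (((g 1 1 : ℝ) ^ 3)⁻¹) := by
        rw [MeasureTheory.lintegral_mul_const' _ _ ENNReal.ofReal_ne_top, lintegral_neg_log, one_mul]

theorem tsum_Mmon_inv_cube_lt_top :
    ∑' g : Mmon, ENNReal.ofReal (((g.1 1 1 : ℝ) ^ 3)⁻¹) < ∞ := by
  set f : ℕ → ℝ≥0∞ := fun k => ENNReal.ofReal (1 / ((k : ℝ) + 1) ^ (3 / 2 : ℝ)) with hf
  have hfsum : ∑' k, f k ≠ ∞ := by
    have h : Summable fun k : ℕ => 1 / ((k : ℝ) + 1) ^ (3 / 2 : ℝ) := by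
      have := (summable_nat_add_iff 1).mpr
        (Real.summable_one_div_nat_rpow.mpr (by norm_num : (1:ℝ) < 3 / 2))
      simpa using this
    rw [hf, ← ENNReal.ofReal_tsum_of_nonneg (fun k => by positivity) h]
    exact ENNReal.ofReal_ne_top
  let F : Mmon → (ℕ × ℕ) × Bool := fun g =>
    (((g.1 0 1).toNat, (g.1 1 1).toNat), decide (det2 g.1 = 1))
  have hF : Function.Injective F := by
    rintro ⟨g, hg⟩ ⟨g', hg'⟩ h
    simp only [F, Prod.mk.injEq, decide_eq_decide] at h
    obtain ⟨⟨hb, hd⟩, he⟩ := h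
    change (g 0 1).toNat = (g' 0 1).toNat at hb
    change (g 1 1).toNat = (g' 1 1).toNat at hd
    change det2 g = 1 ↔ det2 g' = 1 at he
    obtain ⟨h1, -, h2, -, h3, -⟩ := Mmon_entries hg
    obtain ⟨h1', -, h2', -, h3', -⟩ := Mmon_entries hg'
    refine Subtype.ext (Mmon_ext hg hg' (show g 0 1 = g' 0 1 by omega)
      (show g 1 1 = g' 1 1 by omega) (show det2 g = det2 g' from ?_))
    rcases h1 with h1 | h1 <;> rcases h1' with h1' | h1' <;> simp_all
  calc ∑' g : Mmon, ENNReal.ofReal (((g.1 1 1 : ℝ) ^ 3)⁻¹)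
      ≤ ∑' g : Mmon, (fun p : (ℕ × ℕ) × Bool => 8 * (f p.1.1 * f p.1.2)) (F g) := by
        refine ENNReal.tsum_le_tsum fun g => ?_
        obtain ⟨-, -, hb, -, hd, hbd, -⟩ := Mmon_entries g.2
        have h8 : (8 : ℝ≥0∞) = ENNReal.ofReal 8 := by simp
        simp only [F, hf]
        rw [h8, ← ENNReal.ofReal_mul (by positivity), ← ENNReal.ofReal_mul (by positivity)]
        apply ENNReal.ofReal_le_ofReal
        have hb' : (((g.1 0 1).toNat : ℕ) : ℝ) = g.1 0 1 := by
          exact_mod_cast Int.toNat_of_nonneg hb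
        have hd' : (((g.1 1 1).toNat : ℕ) : ℝ) = g.1 1 1 := by
          exact_mod_cast Int.toNat_of_nonneg (by omega : 0 ≤ g.1 1 1)
        rw [hb', hd']
        have hbR : (0 : ℝ) ≤ g.1 0 1 := by exact_mod_cast hb
        have hdR : (1 : ℝ) ≤ g.1 1 1 := by exact_mod_cast hd
        have hbdR : (g.1 0 1 : ℝ) ≤ g.1 1 1 := by exact_mod_cast hbd
        rw [div_mul_div_comm, one_mul, ← Real.mul_rpow (by linarith) (by linarith), mul_one_div,
          inv_eq_one_div, div_le_div_iff₀ (by positivity) (by apply Real.rpow_pos_of_pos; positivity),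
          one_mul]
        calc (((g.1 0 1 : ℝ) + 1) * (g.1 1 1 + 1)) ^ (3 / 2 : ℝ)
            ≤ ((2 * (g.1 1 1 : ℝ)) ^ 2) ^ (3 / 2 : ℝ) := by
              apply Real.rpow_le_rpow (by positivity) _ (by norm_num)
              nlinarith
          _ = 8 * (g.1 1 1 : ℝ) ^ 3 := by
              rw [← Real.rpow_natCast, ← Real.rpow_mul (by positivity)]
              norm_num
              rw [← Real.rpow_natCast]
              norm_num
              ring_nf
    _ ≤ ∑' p : (ℕ × ℕ) × Bool, 8 * (f p.1.1 * f p.1.2) :=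
        ENNReal.tsum_comp_le_tsum_of_injective hF _
    _ = 8 * ((∑' k, f k) * (∑' k, f k)) * 2 := by
        rw [ENNReal.tsum_prod']
        simp only [tsum_fintype, Fintype.sum_bool, ← two_mul]
        rw [ENNReal.tsum_mul_left, ENNReal.tsum_mul_left, ENNReal.tsum_prod']
        simp only [ENNReal.tsum_mul_left, ENNReal.tsum_mul_right]
        ring
    _ < ∞ := by
        refine ENNReal.mul_lt_top (ENNReal.mul_lt_top (by simp) ?_) (by simp)
        exact ENNReal.mul_lt_top hfsum.lt_top hfsum.lt_top

/-- The boundary measure on `[0, 1]` whose Cauchy transform is `Φ = Σ_ℳ φ₀`. -/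
def brjMeasure : MeasureTheory.Measure ℝ :=
  MeasureTheory.Measure.sum fun g : Mmon => (coreMeasure g.1).map (mob g.1)

theorem lintegral_brjMeasure {f : ℝ → ℝ≥0∞} (hf : Measurable f) :
    ∫⁻ x, f x ∂brjMeasure =
      ∑' g : Mmon, ∫⁻ s in Ioc (0:ℝ) 1, ENNReal.ofReal (mobWeight g.1 s) * f (mob g.1 s) := by
  rw [brjMeasure, MeasureTheory.lintegral_sum_measure]
  congr 1
  ext g
  rw [MeasureTheory.lintegral_map hf (measurable_mob _), coreMeasure,
    MeasureTheory.lintegral_withDensity_eq_lintegral_mul _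
      (g := fun s => f (mob g.1 s)) (measurable_mobWeight _).ennreal_ofReal
      (hf.comp (measurable_mob _))]
  rfl

instance isFiniteMeasure_brjMeasure : MeasureTheory.IsFiniteMeasure brjMeasure := by
  constructor
  rw [brjMeasure, MeasureTheory.Measure.sum_apply _ MeasurableSet.univ]
  refine lt_of_le_of_lt (ENNReal.tsum_le_tsum fun g => ?_) tsum_Mmon_inv_cube_lt_top
  rw [MeasureTheory.Measure.map_apply (measurable_mob _) MeasurableSet.univ, preimage_univ]
  exact coreMeasure_univ_le g.2

theorem ae_brjMeasure_mem : ∀ᵐ x ∂brjMeasure, x ∈ Icc (0:ℝ) 1 := by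
  rw [MeasureTheory.ae_iff]
  have hm : MeasurableSet {x : ℝ | x ∉ Icc (0:ℝ) 1} := (measurableSet_Icc).compl
  rw [brjMeasure, MeasureTheory.Measure.sum_apply _ hm, ENNReal.tsum_eq_zero]
  intro g
  rw [MeasureTheory.Measure.map_apply (measurable_mob _) hm, coreMeasure]
  refine MeasureTheory.withDensity_absolutelyContinuous _ _ ?_
  rw [MeasureTheory.Measure.restrict_apply (measurable_mob _ hm)]
  convert MeasureTheory.measure_empty (μ := MeasureTheory.volume)
  ext s
  simp only [mem_inter_iff, mem_preimage, mem_ofPred_eq, mem_empty_iff_false, iff_false, not_and]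
  exact fun h hs => h (mob_mem_Icc g.2 ⟨hs.1.le, hs.2⟩)

theorem integral_coreMeasure_map {g : Matrix (Fin 2) (Fin 2) ℤ} (hg : g ∈ Mmon) {f : ℝ → ℂ}
    (hf : Measurable f) : ∫ x, f x ∂((coreMeasure g).map (mob g)) =
      ∫ s in (0:ℝ)..1, (mobWeight g s : ℂ) * f (mob g s) := by
  rw [MeasureTheory.integral_map (measurable_mob g).aemeasurable hf.aestronglyMeasurable,
    coreMeasure, integral_withDensity_eq_integral_toReal_smul
      (measurable_mobWeight g).ennreal_ofReal (by simp),
    intervalIntegral.integral_of_le zero_le_one]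
  refine MeasureTheory.setIntegral_congr_fun measurableSet_Ioc fun s hs => ?_
  rw [ENNReal.toReal_ofReal (mobWeight_nonneg hg ⟨hs.1.le, hs.2⟩)]
  simp

theorem norm_inv_ofReal_sub_le (x : ℝ) {z : ℂ} (hz : z.im ≠ 0) :
    ‖((x : ℂ) - z)⁻¹‖ ≤ |z.im|⁻¹ := by
  rw [norm_inv]
  refine inv_anti₀ (abs_pos.mpr hz) ?_
  have := Complex.abs_im_le_norm ((x : ℂ) - z)
  simpa using this

theorem measurable_inv_ofReal_sub (z : ℂ) : Measurable fun x : ℝ => ((x : ℂ) - z)⁻¹ := by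
  fun_prop

theorem integrable_cauchy_brjMeasure {z : ℂ} (hz : z.im ≠ 0) :
    MeasureTheory.Integrable (fun x : ℝ => ((x : ℂ) - z)⁻¹) brjMeasure :=
  MeasureTheory.Integrable.of_bound (measurable_inv_ofReal_sub z).aestronglyMeasurable _
    (Eventually.of_forall fun x => norm_inv_ofReal_sub_le x hz)

/-- `Φ` is the Cauchy transform of a finite positive measure on `[0, 1]`. -/
theorem sumM_phi0_eq {z : ℂ} (hz : z.im ≠ 0) :
    sumM phi0 z = (Real.pi : ℂ)⁻¹ * ∫ x, ((x : ℂ) - z)⁻¹ ∂brjMeasure := by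
  rw [sumM, brjMeasure, ← (MeasureTheory.hasSum_integral_measure
    (integrable_cauchy_brjMeasure hz)).tsum_eq, ← tsum_mul_left]
  congr 1
  ext g
  rw [Lop_phi0_eq g.2 hz, integral_coreMeasure_map g.2 (measurable_inv_ofReal_sub z)]

/-- The total mass of the boundary measure. -/
def brjMass : ℝ := brjMeasure.real univ

theorem a0_eq : a0 = -(Real.pi : ℂ)⁻¹ * (brjMass : ℂ) := by
  apply Tendsto.limUnder_eq
  have hlim : Tendsto (fun y : ℝ => ∫ x, I * (y:ℂ) * ((x : ℂ) - I * y)⁻¹ ∂brjMeasure) atTop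
      (𝓝 (∫ _, (-1 : ℂ) ∂brjMeasure)) := by
    refine MeasureTheory.tendsto_integral_filter_of_dominated_convergence (fun _ => 1) ?_ ?_
      (MeasureTheory.integrable_const _) ?_
    · refine Eventually.of_forall fun y => Measurable.aestronglyMeasurable ?_
      fun_prop
    · filter_upwards [eventually_gt_atTop 0] with y hy
      refine Eventually.of_forall fun x => ?_
      rw [norm_mul]
      have h1 : ‖I * (y:ℂ)‖ = y := by simp [abs_of_pos hy]
      have h2 := norm_inv_ofReal_sub_le x (z := I * y) (by simpa using hy.ne')
      have h3 : |(I * (y:ℂ)).im|⁻¹ = y⁻¹ := by simp [abs_of_pos hy]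
      rw [h3] at h2
      rw [h1]
      calc y * _ ≤ y * y⁻¹ := mul_le_mul_of_nonneg_left h2 hy.le
        _ = 1 := mul_inv_cancel₀ hy.ne'
    · refine Eventually.of_forall fun x => ?_
      have h1 : Tendsto (fun y : ℝ => ((x:ℂ) * (-I) * ((y⁻¹ : ℝ) : ℂ) - 1)⁻¹) atTop (𝓝 (-1)) := by
        have h2 : Tendsto (fun y : ℝ => (x:ℂ) * (-I) * ((y⁻¹ : ℝ) : ℂ) - 1) atTop
            (𝓝 ((x:ℂ) * (-I) * ((0 : ℝ) : ℂ) - 1)) :=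
          ((Complex.continuous_ofReal.tendsto 0).comp tendsto_inv_atTop_zero).const_mul _ |>.sub_const 1
        have h3 := h2.inv₀ (by norm_num)
        convert h3 using 2
        norm_num
      refine h1.congr' ?_
      filter_upwards [eventually_gt_atTop 0] with y hy
      have hy' : (y : ℂ) ≠ 0 := by exact_mod_cast hy.ne'
      have : (x:ℂ) * (-I) * ((y⁻¹ : ℝ) : ℂ) - 1 = ((x:ℂ) - I * y) * (I * y)⁻¹ := by
        push_cast
        field_simp
        linear_combination (-(x : ℂ)) * Complex.I_sq
      rw [this, mul_inv, inv_inv, mul_comm]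
  have hlim2 := hlim.const_mul (Real.pi : ℂ)⁻¹
  have hval : (Real.pi : ℂ)⁻¹ * ∫ _, (-1 : ℂ) ∂brjMeasure = -(Real.pi : ℂ)⁻¹ * (brjMass : ℂ) := by
    rw [MeasureTheory.integral_const, brjMass]
    simp
  rw [hval] at hlim2
  refine hlim2.congr' ?_
  filter_upwards [eventually_gt_atTop 0] with y hy
  rw [sumM_phi0_eq (by simpa using hy.ne'), MeasureTheory.integral_const_mul]
  ring

/-- The Poisson kernel of the upper half-plane. -/
def halfPlanePoisson (z : ℂ) (t : ℝ) : ℝ :=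
  Real.pi⁻¹ * (z.im / ((t - z.re) ^ 2 + z.im ^ 2))

theorem im_inv_ofReal_sub (z : ℂ) (t : ℝ) :
    (((t : ℂ) - z)⁻¹).im = z.im / ((t - z.re) ^ 2 + z.im ^ 2) := by
  rw [Complex.inv_im, Complex.normSq_apply]
  simp only [sub_re, ofReal_re, sub_im, ofReal_im, zero_sub, neg_neg]
  ring_nf

theorem log_div_sub_one_eq {z : ℂ} (hz : 0 < z.im) :
    Complex.log (z / (z - 1)) = -∫ u in (0:ℝ)..1, ((u : ℂ) - z)⁻¹ := by
  have him : 0 < (z - 1).im := by simpa using hz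
  have h0 : z ≠ 0 := by
    rintro rfl
    simp at hz
  have h1 : z - 1 ≠ 0 := by
    intro h
    rw [h] at him
    simp at him
  have hcut : z ∈ cutPlane 0 1 := by
    rintro ⟨t, -, rfl⟩
    simp at hz
  have hint : ∫ u in (0:ℝ)..1, ((u : ℂ) - z)⁻¹ = Complex.log (z - 1) - Complex.log z := by
    have hd : ∀ u ∈ uIcc (0:ℝ) 1,
        HasDerivAt (fun u : ℝ => Complex.log (z - u)) (((u : ℂ) - z)⁻¹) u := by
      intro u _
      have h2 : HasDerivAt (fun u : ℝ => z - (u:ℂ)) (-1) u := by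
        simpa using (Complex.ofRealCLM.hasDerivAt (x := u)).const_sub z
      have h3 := h2.clog_real (Or.inr (by simpa using hz.ne'))
      convert h3 using 1
      rw [← neg_sub z, neg_div, one_div, inv_neg]
    rw [intervalIntegral.integral_eq_sub_of_hasDerivAt hd
      (ContinuousOn.intervalIntegrable (by
        rw [uIcc_of_le zero_le_one]
        exact continuousOn_inv_ofReal_sub hcut))]
    simp
  have ha : 0 < z.arg ∧ z.arg < Real.pi :=
    ⟨lt_of_le_of_ne (Complex.arg_nonneg_iff.mpr hz.le)
      (fun h => hz.ne' (Complex.arg_eq_zero_iff.mp h.symm).2),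
      Complex.arg_lt_pi_iff.mpr (Or.inr hz.ne')⟩
  have hb : 0 < (z - 1).arg ∧ (z - 1).arg < Real.pi :=
    ⟨lt_of_le_of_ne (Complex.arg_nonneg_iff.mpr him.le)
      (fun h => him.ne' (Complex.arg_eq_zero_iff.mp h.symm).2),
      Complex.arg_lt_pi_iff.mpr (Or.inr him.ne')⟩
  rw [hint, div_eq_mul_inv, (Complex.log_mul_eq_add_log_iff h0 (inv_ne_zero h1)).mpr,
    Complex.log_inv _ hb.2.ne]
  · ring
  · rw [Complex.arg_inv, if_neg hb.2.ne]
    constructor <;> linarith [ha.1, ha.2, hb.1, hb.2]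

theorem norm_ofReal_sub_ge {z : ℂ} (hz : 0 < z.im) (n : ℤ) {t : ℝ} (ht : t ∈ Icc (0:ℝ) 1) :
    (1 + |(n : ℝ)|) ≤ (1 + (|z.re| + 2) / z.im) * ‖(t : ℂ) - (z - n)‖ := by
  have h1 : z.im ≤ ‖(t : ℂ) - (z - n)‖ := by
    have := Complex.abs_im_le_norm ((t : ℂ) - (z - n))
    simpa [abs_of_pos hz] using this
  have h2 : |(n : ℝ)| - |z.re| - 1 ≤ ‖(t : ℂ) - (z - n)‖ := by
    refine le_trans ?_ (Complex.abs_re_le_norm _)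
    simp only [sub_re, ofReal_re, intCast_re]
    have h3 : |(n:ℝ)| ≤ |t - (z.re - n)| + |z.re| + |t| := by
      have h4 := abs_add_le (t - (z.re - n)) (z.re - t)
      have h5 := abs_sub z.re t
      have h6 : t - (z.re - n) + (z.re - t) = (n:ℝ) := by ring
      rw [h6] at h4
      linarith
    have h7 : |t| ≤ 1 := abs_le.mpr ⟨by linarith [ht.1], ht.2⟩
    linarith
  have h8 : (|z.re| + 2) ≤ (|z.re| + 2) / z.im * ‖(t : ℂ) - (z - n)‖ := by
    rw [div_mul_eq_mul_div, le_div_iff₀ hz]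
    exact mul_le_mul_of_nonneg_left h1 (by positivity)
  linarith

theorem norm_inv_sub_inv_le {z : ℂ} (hz : 0 < z.im) (n : ℤ) {x u : ℝ} (hx : x ∈ Icc (0:ℝ) 1)
    (hu : u ∈ Icc (0:ℝ) 1) :
    ‖((x : ℂ) - (z - n))⁻¹ - ((u : ℂ) - (z - n))⁻¹‖ ≤
      (1 + (|z.re| + 2) / z.im) ^ 2 / (1 + |(n : ℝ)|) ^ 2 := by
  have h1 := norm_ofReal_sub_ge hz n hx
  have h2 := norm_ofReal_sub_ge hz n hu
  set K := 1 + (|z.re| + 2) / z.im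
  have hK : 0 < K := by positivity
  set A := (x : ℂ) - (z - n) with hA
  set B := (u : ℂ) - (z - n) with hB
  have hn : 0 < 1 + |(n : ℝ)| := by positivity
  have hA0 : 0 < ‖A‖ := by
    by_contra h
    have : K * ‖A‖ ≤ 0 := mul_nonpos_of_nonneg_of_nonpos hK.le (not_lt.mp h)
    linarith
  have hB0 : 0 < ‖B‖ := by
    by_contra h
    have : K * ‖B‖ ≤ 0 := mul_nonpos_of_nonneg_of_nonpos hK.le (not_lt.mp h)
    linarith
  rw [inv_sub_inv (norm_pos_iff.mp hA0) (norm_pos_iff.mp hB0), norm_div, norm_mul,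
    div_le_div_iff₀ (by positivity) (by positivity)]
  have h3 : ‖B - A‖ ≤ 1 := by
    have : B - A = ((u - x : ℝ) : ℂ) := by
      rw [hA, hB]
      push_cast
      ring
    rw [this, Complex.norm_real, Real.norm_eq_abs, abs_le]
    constructor <;> linarith [hx.1, hx.2, hu.1, hu.2]
  calc ‖B - A‖ * (1 + |(n : ℝ)|) ^ 2 ≤ 1 * (1 + |(n : ℝ)|) ^ 2 := by gcongr
    _ = (1 + |(n : ℝ)|) * (1 + |(n : ℝ)|) := by ring
    _ ≤ (K * ‖A‖) * (K * ‖B‖) := mul_le_mul h1 h2 hn.le (by positivity)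
    _ = K ^ 2 * (‖A‖ * ‖B‖) := by ring

theorem summable_inv_one_add_abs_sq : Summable fun n : ℤ => 1 / (1 + |(n : ℝ)|) ^ 2 := by
  have h := (Real.summable_one_div_int_pow (p := 2)).mpr (by norm_num)
  refine Summable.of_norm_bounded_eventually h ?_
  rw [Filter.eventually_cofinite]
  refine (finite_singleton (0:ℤ)).subset fun n hn => ?_
  by_contra h0
  refine hn ?_
  have h1 : 0 < |(n : ℝ)| := abs_pos.mpr (by exact_mod_cast h0)
  rw [Real.norm_of_nonneg (by positivity)]
  have h2 : (n : ℝ) ^ 2 = |(n : ℝ)| ^ 2 := (sq_abs _).symm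
  rw [h2]
  exact one_div_le_one_div_of_le (by positivity) (by nlinarith)

theorem integrable_halfPlanePoisson {z : ℂ} (hz : 0 < z.im) :
    MeasureTheory.Integrable (halfPlanePoisson z) ∧ ∫ t, halfPlanePoisson z t = 1 := by
  have hk : halfPlanePoisson z = fun t => Real.pi⁻¹ * z.im⁻¹ * (1 + ((t - z.re) / z.im) ^ 2)⁻¹ := by
    ext t
    rw [halfPlanePoisson]
    have : (1 + ((t - z.re) / z.im) ^ 2) ≠ 0 := by positivity
    have : (t - z.re) ^ 2 + z.im ^ 2 ≠ 0 := by positivity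
    field_simp
    ring
  constructor
  · rw [hk]
    exact ((integrable_inv_one_add_sq.comp_div hz.ne').comp_sub_right z.re).const_mul _
  · rw [hk, MeasureTheory.integral_const_mul,
      MeasureTheory.integral_sub_right_eq_self (fun t : ℝ => (1 + (t / z.im) ^ 2)⁻¹) z.re,
      MeasureTheory.Measure.integral_comp_div (fun t : ℝ => (1 + t ^ 2)⁻¹),
      integral_univ_inv_one_add_sq, abs_of_pos hz]
    have := Real.pi_ne_zero
    have := hz.ne'
    simp only [smul_eq_mul]
    field_simp

theorem hasSum_integral_halfPlanePoisson {z : ℂ} (hz : 0 < z.im) :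
    HasSum (fun n : ℤ => ∫ u in (0:ℝ)..1, halfPlanePoisson z (u + n)) 1 := by
  have h := (integrable_halfPlanePoisson hz).1.hasSum_intervalIntegral_comp_add_int
  rwa [(integrable_halfPlanePoisson hz).2] at h

/-- The `n`-th term of the series defining `𝓑`. -/
def brjSeriesTerm (z : ℂ) (n : ℤ) : ℂ :=
  sumM phi0 (z - (n : ℂ)) - a0 * Complex.log ((z - (n : ℂ)) / (z - (n : ℂ) - 1))

theorem mem_cutPlane_of_im_pos {z : ℂ} (hz : 0 < z.im) : z ∈ cutPlane 0 1 := by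
  rintro ⟨t, -, rfl⟩
  simp at hz

theorem brjSeriesTerm_eq {z : ℂ} (hz : 0 < z.im) (n : ℤ) :
    brjSeriesTerm z n = (Real.pi : ℂ)⁻¹ * ∫ x, (((x : ℂ) - (z - n))⁻¹ -
      ∫ u in (0:ℝ)..1, ((u : ℂ) - (z - n))⁻¹) ∂brjMeasure := by
  have hz' : 0 < (z - (n : ℂ)).im := by simpa using hz
  rw [brjSeriesTerm, sumM_phi0_eq hz'.ne', a0_eq, log_div_sub_one_eq hz',
    MeasureTheory.integral_sub (integrable_cauchy_brjMeasure hz'.ne') (MeasureTheory.integrable_const _),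
    MeasureTheory.integral_const, brjMass]
  rw [Complex.real_smul]
  ring

theorem norm_brjSeriesTerm_le {z : ℂ} (hz : 0 < z.im) (n : ℤ) :
    ‖brjSeriesTerm z n‖ ≤ Real.pi⁻¹ * ((1 + (|z.re| + 2) / z.im) ^ 2 * brjMass) *
      (1 / (1 + |(n : ℝ)|) ^ 2) := by
  have hz' : 0 < (z - (n : ℂ)).im := by simpa using hz
  have hint : IntervalIntegrable (fun u : ℝ => ((u : ℂ) - (z - n))⁻¹) MeasureTheory.volume 0 1 :=
    ContinuousOn.intervalIntegrable (by
      rw [uIcc_of_le zero_le_one]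
      exact continuousOn_inv_ofReal_sub (mem_cutPlane_of_im_pos hz'))
  rw [brjSeriesTerm_eq hz, norm_mul, norm_inv, Complex.norm_real, Real.norm_of_nonneg Real.pi_pos.le,
    mul_assoc]
  refine mul_le_mul_of_nonneg_left ?_ (inv_nonneg.mpr Real.pi_pos.le)
  have hb : ∀ᵐ x : ℝ ∂brjMeasure, ‖((x : ℂ) - (z - n))⁻¹ - ∫ u in (0:ℝ)..1, ((u : ℂ) - (z - n))⁻¹‖ ≤
      (1 + (|z.re| + 2) / z.im) ^ 2 / (1 + |(n : ℝ)|) ^ 2 := by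
    filter_upwards [ae_brjMeasure_mem] with x hx
    have h1 : ((x : ℂ) - (z - n))⁻¹ - ∫ u in (0:ℝ)..1, ((u : ℂ) - (z - n))⁻¹ =
        ∫ u in (0:ℝ)..1, (((x : ℂ) - (z - n))⁻¹ - ((u : ℂ) - (z - n))⁻¹) := by
      rw [intervalIntegral.integral_sub intervalIntegrable_const hint]
      simp
    rw [h1]
    refine (intervalIntegral.norm_integral_le_of_norm_le_const
      (C := (1 + (|z.re| + 2) / z.im) ^ 2 / (1 + |(n : ℝ)|) ^ 2) fun u hu => ?_).trans (by simp)
    rw [uIoc_of_le zero_le_one] at hu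
    exact norm_inv_sub_inv_le hz n hx ⟨hu.1.le, hu.2⟩
  refine (MeasureTheory.norm_integral_le_of_norm_le_const hb).trans (le_of_eq ?_)
  rw [brjMass]
  ring

theorem summable_brjSeriesTerm {z : ℂ} (hz : 0 < z.im) : Summable (brjSeriesTerm z) :=
  Summable.of_norm_bounded (summable_inv_one_add_abs_sq.mul_left _)
    (norm_brjSeriesTerm_le hz)

theorem im_inv_ofReal_sub_int (z : ℂ) (n : ℤ) (t : ℝ) :
    (((t : ℂ) - (z - n))⁻¹).im = Real.pi * halfPlanePoisson z (t + n) := by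
  rw [im_inv_ofReal_sub, halfPlanePoisson, mul_inv_cancel_left₀ Real.pi_ne_zero]
  simp only [sub_im, intCast_im, sub_zero, sub_re, intCast_re]
  ring_nf

theorem im_brjSeriesTerm {z : ℂ} (hz : 0 < z.im) (n : ℤ) :
    (brjSeriesTerm z n).im = (∫ x, halfPlanePoisson z (x + n) ∂brjMeasure) -
      Real.pi⁻¹ * brjMass * (Real.pi * ∫ u in (0:ℝ)..1, halfPlanePoisson z (u + n)) := by
  have hz' : 0 < (z - (n : ℂ)).im := by simpa using hz
  have hint : IntervalIntegrable (fun u : ℝ => ((u : ℂ) - (z - n))⁻¹) MeasureTheory.volume 0 1 :=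
    ContinuousOn.intervalIntegrable (by
      rw [uIcc_of_le zero_le_one]
      exact continuousOn_inv_ofReal_sub (mem_cutPlane_of_im_pos hz'))
  have h1 : (∫ x, ((x : ℂ) - (z - n))⁻¹ ∂brjMeasure).im =
      Real.pi * ∫ x, halfPlanePoisson z (x + n) ∂brjMeasure := by
    rw [← MeasureTheory.integral_const_mul]
    have := (integral_im (integrable_cauchy_brjMeasure hz'.ne')).symm
    simp only [RCLike.im_to_complex] at this
    rw [this]
    simp only [im_inv_ofReal_sub_int]
  have h2 : (∫ u in (0:ℝ)..1, ((u : ℂ) - (z - n))⁻¹).im =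
      Real.pi * ∫ u in (0:ℝ)..1, halfPlanePoisson z (u + n) := by
    rw [← intervalIntegral.integral_const_mul]
    have := (intervalIntegral.intervalIntegral_im hint).symm
    simp only [RCLike.im_to_complex] at this
    rw [this]
    simp only [im_inv_ofReal_sub_int]
  rw [brjSeriesTerm_eq hz, MeasureTheory.integral_sub (integrable_cauchy_brjMeasure hz'.ne')
    (MeasureTheory.integrable_const _), MeasureTheory.integral_const, ← Complex.ofReal_inv,
    Complex.im_ofReal_mul, Complex.sub_im, h1, Complex.smul_im, h2, brjMass]
  have := Real.pi_ne_zero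
  simp only [smul_eq_mul]
  field_simp

/-- `Im 𝓑` is the Poisson integral of the periodized boundary measure. -/
theorem hasSum_im_BrjunoC {z : ℂ} (hz : 0 < z.im) :
    HasSum (fun n : ℤ => ∫ x, halfPlanePoisson z (x + n) ∂brjMeasure) (BrjunoC z).im := by
  have h1 := Complex.hasSum_im (summable_brjSeriesTerm hz).hasSum
  simp only [im_brjSeriesTerm hz] at h1
  have h2 := ((hasSum_integral_halfPlanePoisson hz).mul_left Real.pi).mul_left (Real.pi⁻¹ * brjMass)
  have h3 := h1.add h2
  simp only [sub_add_cancel] at h3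
  convert h3 using 1
  have : BrjunoC z = -Complex.I * (Real.pi : ℂ) * a0 + ∑' n, brjSeriesTerm z n := rfl
  rw [this, a0_eq, Complex.add_im, add_comm]
  congr 1
  have hpi : (Real.pi : ℂ) ≠ 0 := by exact_mod_cast Real.pi_ne_zero
  have h4 : -Complex.I * (Real.pi : ℂ) * (-(Real.pi : ℂ)⁻¹ * (brjMass : ℂ)) = Complex.I * brjMass := by
    field_simp
  rw [h4]
  have := Real.pi_ne_zero
  simp
  field_simp

theorem halfPlanePoisson_nonneg {z : ℂ} (hz : 0 ≤ z.im) (t : ℝ) : 0 ≤ halfPlanePoisson z t := by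
  unfold halfPlanePoisson
  positivity

theorem measurable_halfPlanePoisson (z : ℂ) : Measurable (halfPlanePoisson z) := by
  unfold halfPlanePoisson
  fun_prop

theorem lintegral_halfPlanePoisson {z : ℂ} (hz : 0 < z.im) :
    ∫⁻ t, ENNReal.ofReal (halfPlanePoisson z t) = 1 := by
  rw [← MeasureTheory.ofReal_integral_eq_lintegral_ofReal (integrable_halfPlanePoisson hz).1
    (Eventually.of_forall fun t => halfPlanePoisson_nonneg hz.le t),
    (integrable_halfPlanePoisson hz).2, ENNReal.ofReal_one]

theorem halfPlanePoisson_le_inv {z : ℂ} (hz : 0 < z.im) (t : ℝ) :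
    halfPlanePoisson z t ≤ z.im⁻¹ := by
  rw [halfPlanePoisson]
  calc Real.pi⁻¹ * (z.im / ((t - z.re) ^ 2 + z.im ^ 2)) ≤ 1 * (z.im / (z.im ^ 2)) := by
        gcongr
        · exact inv_le_one_of_one_le₀ (by linarith [Real.pi_gt_three])
        · nlinarith [sq_nonneg (t - z.re)]
    _ = z.im⁻¹ := by
        field_simp

/-- The contribution of the translate by `n` of `L_g φ₀` to `Im 𝓑`. -/
def poissonTerm (z : ℂ) (i : ℤ × Mmon) : ℝ≥0∞ :=
  ∫⁻ s in Ioc (0:ℝ) 1, ENNReal.ofReal (mobWeight i.2.1 s) *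
    ENNReal.ofReal (halfPlanePoisson z (mob i.2.1 s + i.1))

theorem tsum_poissonTerm_fiber (z : ℂ) (n : ℤ) :
    ∑' g : Mmon, poissonTerm z (n, g) =
      ∫⁻ x, ENNReal.ofReal (halfPlanePoisson z (x + n)) ∂brjMeasure := by
  rw [lintegral_brjMeasure (f := fun x => ENNReal.ofReal (halfPlanePoisson z (x + n)))
    (((measurable_halfPlanePoisson z).comp (measurable_add_const _)).ennreal_ofReal)]
  rfl

theorem im_BrjunoC_nonneg {z : ℂ} (hz : 0 < z.im) : 0 ≤ (BrjunoC z).im :=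
  (hasSum_im_BrjunoC hz).nonneg fun _ =>
    MeasureTheory.integral_nonneg fun _ => halfPlanePoisson_nonneg hz.le _

theorem ofReal_im_BrjunoC {z : ℂ} (hz : 0 < z.im) :
    ENNReal.ofReal (BrjunoC z).im = ∑' i, poissonTerm z i := by
  rw [ENNReal.tsum_prod', ← (hasSum_im_BrjunoC hz).tsum_eq, ENNReal.ofReal_tsum_of_nonneg
    (fun _ => MeasureTheory.integral_nonneg fun _ => halfPlanePoisson_nonneg hz.le _)
    (hasSum_im_BrjunoC hz).summable]
  congr 1
  ext n
  rw [tsum_poissonTerm_fiber, MeasureTheory.ofReal_integral_eq_lintegral_ofReal]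
  · refine MeasureTheory.Integrable.of_bound (C := z.im⁻¹)
      ((measurable_halfPlanePoisson z).comp (measurable_add_const _)).aestronglyMeasurable
      (Eventually.of_forall fun x => ?_)
    rw [Real.norm_of_nonneg (halfPlanePoisson_nonneg hz.le _)]
    exact halfPlanePoisson_le_inv hz _
  · exact Eventually.of_forall fun x => halfPlanePoisson_nonneg hz.le _

theorem lintegral_log_div {ρ : ℝ} (hρ : 0 < ρ) :
    ∫⁻ s in Ioc (0:ℝ) ρ, ENNReal.ofReal (Real.log ρ - Real.log s) = ENNReal.ofReal ρ := by
  have hi : IntervalIntegrable (fun s => Real.log ρ - Real.log s) MeasureTheory.volume 0 ρ :=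
    intervalIntegrable_const.sub intervalIntegral.intervalIntegrable_log'
  rw [← MeasureTheory.ofReal_integral_eq_lintegral_ofReal hi.1]
  · rw [← intervalIntegral.integral_of_le hρ.le,
      intervalIntegral.integral_sub intervalIntegrable_const intervalIntegral.intervalIntegrable_log',
      integral_log]
    simp
  · filter_upwards [MeasureTheory.ae_restrict_mem measurableSet_Ioc] with s hs
    exact sub_nonneg.mpr (Real.log_le_log hs.1 hs.2)

theorem halfPlanePoisson_le_of_lt {z : ℂ} (hz : 0 < z.im) {s : ℝ} (hs0 : 0 < s)
    (hs : s ≤ ‖z‖ / 2) : halfPlanePoisson z s ≤ 2 / ‖z‖ := by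
  have hr : 0 < ‖z‖ := by linarith
  have h1 : (s - z.re) ^ 2 + z.im ^ 2 = ‖(s : ℂ) - z‖ ^ 2 := by
    rw [← Complex.normSq_eq_norm_sq, Complex.normSq_apply]
    simp
    ring
  have h2 : ‖z‖ / 2 ≤ ‖(s : ℂ) - z‖ := by
    have := norm_sub_norm_le z (s : ℂ)
    rw [norm_sub_rev] at this
    rw [Complex.norm_real, Real.norm_of_nonneg hs0.le] at this
    linarith
  have h3 : z.im ≤ ‖z‖ := (le_abs_self _).trans (Complex.abs_im_le_norm z)
  rw [halfPlanePoisson, h1]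
  have hpi : Real.pi⁻¹ ≤ 1 / 2 := by
    rw [inv_eq_one_div]
    exact one_div_le_one_div_of_le (by norm_num) (by linarith [Real.pi_gt_three])
  calc Real.pi⁻¹ * (z.im / ‖(s : ℂ) - z‖ ^ 2) ≤ 1 / 2 * (‖z‖ / (‖z‖ / 2) ^ 2) := by
        gcongr
    _ = 2 / ‖z‖ := by
        field_simp

/-- The Poisson integral of `log (1/s)` over the unit interval. -/
theorem lintegral_log_halfPlanePoisson_le {z : ℂ} (hz : 0 < z.im) :
    ∫⁻ s in Ioc (0:ℝ) 1, ENNReal.ofReal (-Real.log s) * ENNReal.ofReal (halfPlanePoisson z s) ≤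
      ENNReal.ofReal (1 + Real.log (1 + 2 / ‖z‖)) := by
  have hr : 0 < ‖z‖ := by
    rw [norm_pos_iff]
    rintro rfl
    simp at hz
  set r := ‖z‖ with hrdef
  set L := Real.log (1 + 2 / r) with hL
  have hL0 : 0 ≤ L := Real.log_nonneg (by
    have : 0 < 2 / r := by positivity
    linarith)
  have hLr : -Real.log (r / 2) ≤ L := by
    rw [← Real.log_inv, inv_div]
    exact Real.log_le_log (by positivity) (by linarith)
  have hpt : ∀ s ∈ Ioc (0:ℝ) 1,
      ENNReal.ofReal (-Real.log s) * ENNReal.ofReal (halfPlanePoisson z s) ≤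
        ENNReal.ofReal L * ENNReal.ofReal (halfPlanePoisson z s) +
        (Ioc 0 (r / 2)).indicator
          (fun s => ENNReal.ofReal (2 / r) * ENNReal.ofReal (Real.log (r / 2) - Real.log s)) s := by
    intro s hs
    by_cases hsr : s ≤ r / 2
    · rw [indicator_of_mem (show s ∈ Ioc 0 (r / 2) from ⟨hs.1, hsr⟩)]
      have h1 : 0 ≤ Real.log (r / 2) - Real.log s := sub_nonneg.mpr (Real.log_le_log hs.1 hsr)
      calc ENNReal.ofReal (-Real.log s) * ENNReal.ofReal (halfPlanePoisson z s)
          ≤ (ENNReal.ofReal L + ENNReal.ofReal (Real.log (r / 2) - Real.log s)) *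
            ENNReal.ofReal (halfPlanePoisson z s) := by
            gcongr
            rw [← ENNReal.ofReal_add hL0 h1]
            exact ENNReal.ofReal_le_ofReal (by linarith)
        _ = ENNReal.ofReal L * ENNReal.ofReal (halfPlanePoisson z s) +
            ENNReal.ofReal (halfPlanePoisson z s) *
              ENNReal.ofReal (Real.log (r / 2) - Real.log s) := by ring
        _ ≤ _ := by
            gcongr
            exact halfPlanePoisson_le_of_lt hz hs.1 hsr
    · rw [indicator_of_notMem (fun h => hsr h.2), add_zero]
      gcongr
      have := Real.log_le_log (by positivity) (not_le.mp hsr).le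
      linarith
  calc ∫⁻ s in Ioc (0:ℝ) 1, ENNReal.ofReal (-Real.log s) * ENNReal.ofReal (halfPlanePoisson z s)
      ≤ ∫⁻ s in Ioc (0:ℝ) 1, (ENNReal.ofReal L * ENNReal.ofReal (halfPlanePoisson z s) +
        (Ioc 0 (r / 2)).indicator
          (fun s => ENNReal.ofReal (2 / r) * ENNReal.ofReal (Real.log (r / 2) - Real.log s)) s) :=
        MeasureTheory.setLIntegral_mono' measurableSet_Ioc hpt
    _ ≤ ∫⁻ s, (ENNReal.ofReal L * ENNReal.ofReal (halfPlanePoisson z s) +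
        (Ioc 0 (r / 2)).indicator
          (fun s => ENNReal.ofReal (2 / r) * ENNReal.ofReal (Real.log (r / 2) - Real.log s)) s) :=
        MeasureTheory.setLIntegral_le_lintegral _ _
    _ = ENNReal.ofReal L + 1 := by
        rw [MeasureTheory.lintegral_add_left
          ((measurable_halfPlanePoisson z).ennreal_ofReal.const_mul _),
          MeasureTheory.lintegral_const_mul' _ _ ENNReal.ofReal_ne_top,
          lintegral_halfPlanePoisson hz, mul_one,
          MeasureTheory.lintegral_indicator measurableSet_Ioc,
          MeasureTheory.lintegral_const_mul' _ _ ENNReal.ofReal_ne_top,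
          lintegral_log_div (by positivity), ← ENNReal.ofReal_mul (by positivity)]
        congr 1
        rw [div_mul_div_comm, mul_comm 2 r, div_self (by positivity), ENNReal.ofReal_one]
    _ = ENNReal.ofReal (1 + L) := by
        rw [ENNReal.ofReal_add zero_le_one hL0, ENNReal.ofReal_one, add_comm]

/-- The denominator attached to an index. -/
def cuspDen (i : ℤ × Mmon) : ℝ := i.2.1 1 1

/-- The rational number attached to an index. -/
def cuspPt (i : ℤ × Mmon) : ℝ := i.1 + (i.2.1 0 1 : ℝ) / cuspDen i

/-- The rescaled displacement of `z` from the rational number attached to an index. -/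
def cuspVar (z : ℂ) (i : ℤ × Mmon) : ℂ := (cuspDen i : ℂ) ^ 2 * (z - cuspPt i)

/-- The denominator of the inverse Möbius map. -/
def pullDen (z : ℂ) (i : ℤ × Mmon) : ℂ := (i.2.1 0 0 : ℂ) - (i.2.1 1 0 : ℂ) * (z - i.1)

/-- The inverse Möbius map. -/
def pullMob (z : ℂ) (i : ℤ × Mmon) : ℂ :=
  ((i.2.1 1 1 : ℂ) * (z - i.1) - (i.2.1 0 1 : ℂ)) / pullDen z i

/-- The inverse Möbius map, reflected into the upper half-plane. -/
def pullPt (z : ℂ) (i : ℤ × Mmon) : ℂ := ⟨(pullMob z i).re, |(pullMob z i).im|⟩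

theorem one_le_cuspDen (i : ℤ × Mmon) : 1 ≤ cuspDen i := by
  have := (Mmon_entries i.2.2).2.2.2.2.1
  unfold cuspDen
  exact_mod_cast this

theorem cuspDen_pos (i : ℤ × Mmon) : 0 < cuspDen i := lt_of_lt_of_le one_pos (one_le_cuspDen i)

theorem pullDen_ne_zero {z : ℂ} (hz : 0 < z.im) (i : ℤ × Mmon) : pullDen z i ≠ 0 := by
  intro h
  have h1 := congrArg Complex.im h
  have h2 := congrArg Complex.re h
  simp only [pullDen, sub_im, intCast_im, mul_im, intCast_re, sub_re, sub_zero, zero_mul, add_zero,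
    mul_re, zero_im, zero_re, zero_sub, neg_eq_zero, mul_eq_zero] at h1 h2
  obtain ⟨hdet, -⟩ := Mmon_entries i.2.2
  have hc : i.2.1 1 0 = 0 := by
    rcases h1 with h1 | h1
    · exact_mod_cast h1
    · exact absurd h1 hz.ne'
  have ha : i.2.1 0 0 = 0 := by
    rw [hc] at h2
    simp at h2
    exact h2
  rw [det2, ha, hc] at hdet
  simp at hdet

theorem im_pullMob (z : ℂ) (i : ℤ × Mmon) :
    (pullMob z i).im = (det2 i.2.1 : ℝ) * z.im / ‖pullDen z i‖ ^ 2 := by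
  rw [pullMob, Complex.div_im, ← Complex.normSq_eq_norm_sq, ← sub_div]
  congr 1
  simp only [pullDen, det2, sub_im, intCast_im, mul_im, intCast_re, sub_re, sub_zero, zero_mul,
    add_zero, mul_re]
  push_cast
  ring

theorem abs_det2 (i : ℤ × Mmon) : |(det2 i.2.1 : ℝ)| = 1 := by
  rcases (Mmon_entries i.2.2).1 with h | h <;> simp [h]

theorem im_pullPt {z : ℂ} (hz : 0 < z.im) (i : ℤ × Mmon) :
    (pullPt z i).im = z.im / ‖pullDen z i‖ ^ 2 := by
  rw [pullPt]
  simp only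
  rw [im_pullMob, abs_div, abs_mul, abs_det2, one_mul, abs_of_pos hz, abs_of_nonneg (by positivity)]

theorem im_pullPt_pos {z : ℂ} (hz : 0 < z.im) (i : ℤ × Mmon) : 0 < (pullPt z i).im := by
  rw [im_pullPt hz]
  have := norm_pos_iff.mpr (pullDen_ne_zero hz i)
  positivity

theorem halfPlanePoisson_eq_norm (z : ℂ) (t : ℝ) :
    halfPlanePoisson z t = Real.pi⁻¹ * (z.im / ‖(t : ℂ) - z‖ ^ 2) := by
  rw [halfPlanePoisson, ← Complex.normSq_eq_norm_sq, Complex.normSq_apply]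
  simp only [sub_re, ofReal_re, sub_im, ofReal_im, zero_sub, neg_mul_neg]
  ring_nf

theorem norm_ofReal_sub_pullPt (z : ℂ) (i : ℤ × Mmon) (s : ℝ) :
    ‖(s : ℂ) - pullPt z i‖ = ‖(s : ℂ) - pullMob z i‖ := by
  rw [← sq_eq_sq₀ (norm_nonneg _) (norm_nonneg _), ← Complex.normSq_eq_norm_sq,
    ← Complex.normSq_eq_norm_sq, Complex.normSq_apply, Complex.normSq_apply]
  simp only [pullPt, sub_re, ofReal_re, sub_im, ofReal_im, zero_sub, neg_mul_neg, abs_mul_abs_self]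

theorem norm_pullPt (z : ℂ) (i : ℤ × Mmon) : ‖pullPt z i‖ = ‖pullMob z i‖ := by
  simpa using norm_ofReal_sub_pullPt z i 0

/-- Conformal invariance of the Poisson kernel. -/
theorem halfPlanePoisson_mob {z : ℂ} (hz : 0 < z.im) (i : ℤ × Mmon) {s : ℝ} (hs : 0 ≤ s) :
    halfPlanePoisson z (mob i.2.1 s + i.1) =
      ((i.2.1 1 0 : ℝ) * s + i.2.1 1 1) ^ 2 * halfPlanePoisson (pullPt z i) s := by
  have hD := mob_denom_pos i.2.2 hs
  set D : ℝ := (i.2.1 1 0 : ℝ) * s + i.2.1 1 1 with hDdef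
  have hDpos : 0 < D := by linarith
  have hu := pullDen_ne_zero hz i
  have hDC : (D : ℂ) ≠ 0 := by exact_mod_cast hDpos.ne'
  have h1 : (((mob i.2.1 s + i.1 : ℝ) : ℂ) - z) =
      pullDen z i * ((s : ℂ) - pullMob z i) / D := by
    have hm : ((mob i.2.1 s : ℝ) : ℂ) = ((i.2.1 0 0 : ℂ) * s + i.2.1 0 1) / D := by
      rw [mob, ← hDdef]
      push_cast
      rfl
    rw [Complex.ofReal_add, hm, pullMob, eq_div_iff hDC, mul_sub, mul_div_cancel₀ _ hu, sub_mul,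
      add_mul, div_mul_cancel₀ _ hDC, hDdef, pullDen]
    push_cast
    ring
  rw [halfPlanePoisson_eq_norm, halfPlanePoisson_eq_norm, h1, im_pullPt hz, norm_ofReal_sub_pullPt,
    norm_div, norm_mul, Complex.norm_real, Real.norm_of_nonneg hDpos.le]
  have hup := norm_pos_iff.mpr hu
  field_simp

theorem poissonTerm_eq {z : ℂ} (hz : 0 < z.im) (i : ℤ × Mmon) :
    poissonTerm z i = ∫⁻ s in Ioc (0:ℝ) 1,
      ENNReal.ofReal (-Real.log s * ((i.2.1 1 0 : ℝ) * s + i.2.1 1 1)⁻¹) *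
        ENNReal.ofReal (halfPlanePoisson (pullPt z i) s) := by
  refine MeasureTheory.setLIntegral_congr_fun measurableSet_Ioc fun s hs => ?_
  have hD := mob_denom_pos i.2.2 hs.1.le
  have hDpos : 0 < (i.2.1 1 0 : ℝ) * s + i.2.1 1 1 := by linarith
  have hl : 0 ≤ -Real.log s := neg_nonneg.mpr (Real.log_nonpos hs.1.le hs.2)
  rw [halfPlanePoisson_mob hz i hs.1.le, ← ENNReal.ofReal_mul (mobWeight_nonneg i.2.2 ⟨hs.1.le, hs.2⟩),
    ← ENNReal.ofReal_mul (by positivity), mobWeight]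
  congr 1
  field_simp

theorem norm_cuspVar_pos {z : ℂ} (hz : 0 < z.im) (i : ℤ × Mmon) : 0 < ‖cuspVar z i‖ := by
  rw [norm_pos_iff]
  intro h
  have h1 := congrArg Complex.im h
  rw [cuspVar, ← Complex.ofReal_pow, Complex.im_ofReal_mul] at h1
  simp at h1
  rcases h1 with h1 | h1
  · exact (cuspDen_pos i).ne' h1
  · exact hz.ne' h1

theorem pullMob_eq (z : ℂ) (i : ℤ × Mmon) :
    pullMob z i = cuspVar z i /
      ((det2 i.2.1 : ℂ) - ((i.2.1 1 0 : ℂ) / cuspDen i) * cuspVar z i) := by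
  have hd : (cuspDen i : ℂ) ≠ 0 := by exact_mod_cast (cuspDen_pos i).ne'
  have hd' : (i.2.1 1 1 : ℂ) = cuspDen i := by simp [cuspDen]
  have h1 : cuspVar z i = cuspDen i * (cuspDen i * (z - i.1) - i.2.1 0 1) := by
    rw [cuspVar, cuspPt]
    push_cast
    field_simp
    ring
  have h2 : (det2 i.2.1 : ℂ) - ((i.2.1 1 0 : ℂ) / cuspDen i) * cuspVar z i =
      cuspDen i * pullDen z i := by
    rw [h1, pullDen, det2]
    push_cast
    rw [hd']
    field_simp
    ring
  rw [h2, h1, pullMob, hd', mul_div_mul_left _ _ hd]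

theorem norm_cuspVar_le_norm_pullPt {z : ℂ} (hz : 0 < z.im) (i : ℤ × Mmon) :
    ‖cuspVar z i‖ / (1 + ‖cuspVar z i‖) ≤ ‖pullPt z i‖ := by
  have hd : (cuspDen i : ℂ) ≠ 0 := by exact_mod_cast (cuspDen_pos i).ne'
  rw [norm_pullPt, pullMob_eq, norm_div]
  have hv := norm_cuspVar_pos hz i
  have hne : (det2 i.2.1 : ℂ) - ((i.2.1 1 0 : ℂ) / cuspDen i) * cuspVar z i ≠ 0 := by
    intro h
    have h1 := im_pullPt_pos hz i
    rw [pullPt] at h1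
    simp only at h1
    rw [pullMob_eq, h] at h1
    simp at h1
  refine div_le_div_of_nonneg_left hv.le (norm_pos_iff.mpr hne) ?_
  refine (norm_sub_le _ _).trans ?_
  have h1 : ‖(det2 i.2.1 : ℂ)‖ = 1 := by
    rw [← abs_det2 i, ← Real.norm_eq_abs, ← Complex.norm_real]
    simp
  have h2 : ‖(i.2.1 1 0 : ℂ) / cuspDen i‖ ≤ 1 := by
    obtain ⟨-, -, -, hc, hd1, -, hcd, -⟩ := Mmon_entries i.2.2
    have hc' : (0 : ℝ) ≤ i.2.1 1 0 := by exact_mod_cast hc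
    have hcd' : (i.2.1 1 0 : ℝ) ≤ cuspDen i := by
      unfold cuspDen
      exact_mod_cast hcd
    have : (i.2.1 1 0 : ℂ) / cuspDen i = (((i.2.1 1 0 : ℝ) / cuspDen i : ℝ) : ℂ) := by push_cast; rfl
    rw [this, Complex.norm_real, Real.norm_of_nonneg (div_nonneg hc' (cuspDen_pos i).le),
      div_le_one (cuspDen_pos i)]
    exact hcd'
  rw [h1, norm_mul]
  have := mul_le_mul_of_nonneg_right h2 hv.le
  linarith

theorem poissonTerm_le_log {z : ℂ} (hz : 0 < z.im) (i : ℤ × Mmon) :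
    poissonTerm z i ≤ ENNReal.ofReal ((cuspDen i)⁻¹ * (3 + Real.log (1 + 1 / ‖cuspVar z i‖))) := by
  have hv := norm_cuspVar_pos hz i
  set r := ‖cuspVar z i‖ with hr
  have hp := norm_cuspVar_le_norm_pullPt hz i
  rw [← hr] at hp
  have hp0 : 0 < r / (1 + r) := by positivity
  have hlog : Real.log (1 + 2 / ‖pullPt z i‖) ≤ 2 + Real.log (1 + 1 / r) := by
    have h1 : 2 / ‖pullPt z i‖ ≤ 2 / (r / (1 + r)) := by gcongr
    have h2 : 2 / (r / (1 + r)) = 2 + 2 * (1 / r) := by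
      field_simp
      ring
    have h3 : 0 < 1 / r := by positivity
    have h4 : 0 < 2 / ‖pullPt z i‖ := div_pos two_pos (lt_of_lt_of_le hp0 hp)
    calc Real.log (1 + 2 / ‖pullPt z i‖) ≤ Real.log (3 * (1 + 1 / r)) :=
          Real.log_le_log (by linarith) (by linarith)
      _ = Real.log 3 + Real.log (1 + 1 / r) := Real.log_mul (by norm_num) (by positivity)
      _ ≤ 2 + Real.log (1 + 1 / r) := by
          have := Real.log_le_sub_one_of_pos (show (0:ℝ) < 3 by norm_num)
          linarith
  rw [poissonTerm_eq hz]
  calc ∫⁻ s in Ioc (0:ℝ) 1, ENNReal.ofReal (-Real.log s * ((i.2.1 1 0 : ℝ) * s + i.2.1 1 1)⁻¹) *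
        ENNReal.ofReal (halfPlanePoisson (pullPt z i) s)
      ≤ ∫⁻ s in Ioc (0:ℝ) 1, ENNReal.ofReal (cuspDen i)⁻¹ * (ENNReal.ofReal (-Real.log s) *
        ENNReal.ofReal (halfPlanePoisson (pullPt z i) s)) := by
        refine MeasureTheory.setLIntegral_mono' measurableSet_Ioc fun s hs => ?_
        have hD := mob_denom_pos i.2.2 hs.1.le
        have hl : 0 ≤ -Real.log s := neg_nonneg.mpr (Real.log_nonpos hs.1.le hs.2)
        rw [← mul_assoc, ← ENNReal.ofReal_mul (inv_nonneg.mpr (cuspDen_pos i).le),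
          mul_comm (cuspDen i)⁻¹]
        gcongr
        · exact cuspDen_pos i
        · exact hD.1
    _ = ENNReal.ofReal (cuspDen i)⁻¹ * ∫⁻ s in Ioc (0:ℝ) 1, ENNReal.ofReal (-Real.log s) *
        ENNReal.ofReal (halfPlanePoisson (pullPt z i) s) :=
        MeasureTheory.lintegral_const_mul' _ _ ENNReal.ofReal_ne_top
    _ ≤ ENNReal.ofReal (cuspDen i)⁻¹ * ENNReal.ofReal (1 + Real.log (1 + 2 / ‖pullPt z i‖)) := by
        gcongr
        exact lintegral_log_halfPlanePoisson_le (im_pullPt_pos hz i)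
    _ = ENNReal.ofReal ((cuspDen i)⁻¹ * (1 + Real.log (1 + 2 / ‖pullPt z i‖))) :=
        (ENNReal.ofReal_mul (inv_nonneg.mpr (cuspDen_pos i).le)).symm
    _ ≤ _ := by
        refine ENNReal.ofReal_le_ofReal
          (mul_le_mul_of_nonneg_left (by linarith) (inv_nonneg.mpr (cuspDen_pos i).le))

theorem abs_mob_add_sub_cuspPt_le (i : ℤ × Mmon) {s : ℝ} (hs : s ∈ Icc (0:ℝ) 1) :
    |mob i.2.1 s + i.1 - cuspPt i| ≤ 1 / cuspDen i ^ 2 := by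
  have hD := mob_denom_pos i.2.2 hs.1
  have hd := cuspDen_pos i
  have hdd : (i.2.1 1 1 : ℝ) = cuspDen i := rfl
  rw [hdd] at hD
  have hDpos : 0 < (i.2.1 1 0 : ℝ) * s + cuspDen i := by linarith
  have h1 : mob i.2.1 s + i.1 - cuspPt i =
      (det2 i.2.1 : ℝ) * s / (cuspDen i * ((i.2.1 1 0 : ℝ) * s + cuspDen i)) := by
    rw [mob, cuspPt, det2]
    push_cast
    rw [hdd]
    have hne := hDpos.ne'
    have hne' := hd.ne'
    rw [add_comm, add_sub_add_left_eq_sub, div_sub_div _ _ hne hne', mul_comm (cuspDen i)]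
    ring
  rw [h1, abs_div, abs_mul, abs_det2, one_mul, abs_of_nonneg hs.1, abs_of_pos (by positivity)]
  gcongr
  · exact hs.2
  · rw [sq]
    gcongr
    exact hD.1

theorem norm_cuspVar (z : ℂ) (i : ℤ × Mmon) :
    ‖cuspVar z i‖ = cuspDen i ^ 2 * ‖z - cuspPt i‖ := by
  rw [cuspVar, norm_mul, norm_pow, Complex.norm_real, Real.norm_of_nonneg (cuspDen_pos i).le]

theorem poissonTerm_le_far {z : ℂ} (hz : 0 < z.im) (i : ℤ × Mmon) (hv : 2 ≤ ‖cuspVar z i‖) :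
    poissonTerm z i ≤ ENNReal.ofReal
      ((cuspDen i)⁻¹ * (2 * (cuspDen i ^ 2 * z.im) / ‖cuspVar z i‖ ^ 2)) := by
  have hd := cuspDen_pos i
  have hpi : Real.pi⁻¹ ≤ 1 / 2 := by
    rw [inv_eq_one_div]
    exact one_div_le_one_div_of_le (by norm_num) (by linarith [Real.pi_gt_three])
  have hP : ∀ s ∈ Ioc (0:ℝ) 1, halfPlanePoisson z (mob i.2.1 s + i.1) ≤
      cuspDen i ^ 2 * (2 * (cuspDen i ^ 2 * z.im) / ‖cuspVar z i‖ ^ 2) := by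
    intro s hs
    have h1 := abs_mob_add_sub_cuspPt_le i ⟨hs.1.le, hs.2⟩
    have h2 : ‖z - cuspPt i‖ ≤ ‖((mob i.2.1 s + i.1 : ℝ) : ℂ) - z‖ +
        ‖((mob i.2.1 s + i.1 - cuspPt i : ℝ) : ℂ)‖ := by
      have h3 : z - cuspPt i = -(((mob i.2.1 s + i.1 : ℝ) : ℂ) - z) +
          ((mob i.2.1 s + i.1 - cuspPt i : ℝ) : ℂ) := by
        push_cast
        ring
      rw [h3]
      refine (norm_add_le _ _).trans ?_
      rw [norm_neg]
    rw [Complex.norm_real, Real.norm_eq_abs] at h2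
    have hv2 : 2 / cuspDen i ^ 2 ≤ ‖z - cuspPt i‖ := by
      rw [div_le_iff₀ (by positivity), mul_comm, ← norm_cuspVar]
      exact hv
    have h4 : ‖z - cuspPt i‖ / 2 ≤ ‖((mob i.2.1 s + i.1 : ℝ) : ℂ) - z‖ := by
      have : 2 / cuspDen i ^ 2 = 2 * (1 / cuspDen i ^ 2) := by ring
      rw [this] at hv2
      linarith
    have h5 : 0 < ‖z - cuspPt i‖ := lt_of_lt_of_le (by positivity) hv2
    rw [halfPlanePoisson_eq_norm, norm_cuspVar]
    calc Real.pi⁻¹ * (z.im / ‖((mob i.2.1 s + i.1 : ℝ) : ℂ) - z‖ ^ 2)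
        ≤ 1 / 2 * (z.im / (‖z - cuspPt i‖ / 2) ^ 2) := by gcongr
      _ = _ := by
        field_simp
  set K := 2 * (cuspDen i ^ 2 * z.im) / ‖cuspVar z i‖ ^ 2 with hK
  have hK0 : 0 ≤ K := by positivity
  calc poissonTerm z i ≤ ∫⁻ s in Ioc (0:ℝ) 1,
        ENNReal.ofReal ((cuspDen i)⁻¹ * K) * ENNReal.ofReal (-Real.log s) := by
        refine MeasureTheory.setLIntegral_mono' measurableSet_Ioc fun s hs => ?_
        have hl : 0 ≤ -Real.log s := neg_nonneg.mpr (Real.log_nonpos hs.1.le hs.2)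
        rw [← ENNReal.ofReal_mul (mobWeight_nonneg i.2.2 ⟨hs.1.le, hs.2⟩),
          ← ENNReal.ofReal_mul (by positivity)]
        apply ENNReal.ofReal_le_ofReal
        calc mobWeight i.2.1 s * halfPlanePoisson z (mob i.2.1 s + i.1)
            ≤ (-Real.log s * ((cuspDen i) ^ 3)⁻¹) * (cuspDen i ^ 2 * K) := by
              apply mul_le_mul (mobWeight_le i.2.2 ⟨hs.1.le, hs.2⟩) (hP s hs)
                (halfPlanePoisson_nonneg hz.le _) (by positivity)
          _ = (cuspDen i)⁻¹ * K * -Real.log s := by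
              field_simp
    _ = ENNReal.ofReal ((cuspDen i)⁻¹ * K) := by
        rw [MeasureTheory.lintegral_const_mul' _ _ ENNReal.ofReal_ne_top, lintegral_neg_log, mul_one]

theorem poissonTerm_le_of_norm_ge {z : ℂ} (hz : 0 < z.im) (i : ℤ × Mmon)
    (hv : 1 / 16 ≤ ‖cuspVar z i‖) :
    poissonTerm z i ≤ ENNReal.ofReal
      ((cuspDen i)⁻¹ * (95 * ((1 + cuspDen i ^ 2 * z.im) / (1 + ‖cuspVar z i‖ ^ 2)))) := by
  have hd := cuspDen_pos i
  set r := ‖cuspVar z i‖ with hr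
  have hy : 0 ≤ cuspDen i ^ 2 * z.im := by positivity
  rcases le_total 2 r with h2 | h2
  · refine (poissonTerm_le_far hz i h2).trans (ENNReal.ofReal_le_ofReal ?_)
    gcongr
    rw [← hr, mul_div_assoc', div_le_div_iff₀ (by positivity) (by positivity)]
    nlinarith [mul_nonneg hy (sq_nonneg r), mul_nonneg hy (by nlinarith : (0:ℝ) ≤ r ^ 2 - 1)]
  · refine (poissonTerm_le_log hz i).trans (ENNReal.ofReal_le_ofReal ?_)
    gcongr
    have h3 : Real.log (1 + 1 / r) ≤ 16 := by
      have h4 : 1 / r ≤ 16 := by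
        rw [div_le_iff₀ (by linarith)]
        linarith
      have h5 := Real.log_le_sub_one_of_pos (show 0 < 1 + 1 / r by positivity)
      linarith
    have h6 : 1 / 5 ≤ (1 + cuspDen i ^ 2 * z.im) / (1 + r ^ 2) := by
      rw [div_le_div_iff₀ (by norm_num) (by positivity)]
      nlinarith
    rw [← hr]
    linarith

theorem poissonTerm_le_of_norm_lt {z : ℂ} (hz : 0 < z.im) (i : ℤ × Mmon)
    (hv : ‖cuspVar z i‖ < 1 / 16) :
    poissonTerm z i ≤ ENNReal.ofReal
      (4 * ((cuspDen i)⁻¹ * Real.log (1 + 1 / ‖cuspVar z i‖))) := by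
  have hd := cuspDen_pos i
  refine (poissonTerm_le_log hz i).trans (ENNReal.ofReal_le_ofReal ?_)
  have hv0 := norm_cuspVar_pos hz i
  have h1 : 1 ≤ Real.log (1 + 1 / ‖cuspVar z i‖) := by
    rw [Real.le_log_iff_exp_le (by positivity)]
    have h2 : 16 ≤ 1 / ‖cuspVar z i‖ := by
      rw [le_div_iff₀ hv0]
      linarith
    linarith [Real.exp_one_lt_d9]
  rw [mul_left_comm]
  gcongr
  linarith

theorem halfPlanePoisson_le_off {σ δ : ℝ} (hδ : 0 < δ) :
    ∃ C : ℝ, 0 ≤ C ∧ ∀ z : ℂ, 0 < z.im → |z.re - σ| ≤ δ / 2 → ∀ s : ℝ, δ ≤ |s - σ| →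
      halfPlanePoisson z s ≤ C * z.im * (1 + (s - σ) ^ 2)⁻¹ := by
  refine ⟨4 * (1 + δ ^ 2) / δ ^ 2, by positivity, fun z hz hzσ s hs => ?_⟩
  have h1 : |s - σ| / 2 ≤ |s - z.re| := by
    have := abs_sub_abs_le_abs_sub (s - σ) (z.re - σ)
    rw [show s - σ - (z.re - σ) = s - z.re by ring] at this
    linarith
  have h2 : (s - σ) ^ 2 / 4 ≤ (s - z.re) ^ 2 := by
    rw [← sq_abs (s - σ), ← sq_abs (s - z.re)]
    nlinarith [abs_nonneg (s - σ)]
  have h3 : δ ^ 2 ≤ (s - σ) ^ 2 := by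
    rw [← sq_abs (s - σ)]; nlinarith
  have hpi : Real.pi⁻¹ ≤ 1 := inv_le_one_of_one_le₀ (by linarith [Real.pi_gt_three])
  have h5 : 0 < (s - σ) ^ 2 := lt_of_lt_of_le (by positivity) h3
  have h4 : z.im / ((s - z.re) ^ 2 + z.im ^ 2) ≤
      4 * (1 + δ ^ 2) / δ ^ 2 * z.im * (1 + (s - σ) ^ 2)⁻¹ := by
    rw [div_le_iff₀ (by positivity)]
    have : 1 ≤ 4 * (1 + δ ^ 2) / δ ^ 2 * (1 + (s - σ) ^ 2)⁻¹ * ((s - z.re) ^ 2 + z.im ^ 2) := by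
      rw [← div_eq_mul_inv, div_div, div_mul_eq_mul_div, le_div_iff₀ (by positivity)]
      nlinarith [mul_pos (pow_pos hδ 2) h5, sq_nonneg z.im,
        mul_nonneg (by positivity : 0 ≤ 1 + δ ^ 2) (sub_nonneg.2 h2),
        mul_nonneg (by positivity : 0 ≤ 1 + δ ^ 2) (sq_nonneg z.im)]
    nlinarith
  calc halfPlanePoisson z s ≤ 1 * (z.im / ((s - z.re) ^ 2 + z.im ^ 2)) := by
        unfold halfPlanePoisson; gcongr
    _ ≤ _ := by rw [one_mul]; exact h4

theorem eventually_im_lt_abs_re_sub_le (σ : ℝ) {δ ε : ℝ} (hδ : 0 < δ) (hε : 0 < ε) :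
    ∀ᶠ z in 𝓝[{z : ℂ | 0 < z.im}] (σ : ℂ), 0 < z.im ∧ z.im < ε ∧ |z.re - σ| ≤ δ := by
  have h0 : ∀ᶠ z in 𝓝[{z : ℂ | 0 < z.im}] (σ : ℂ), 0 < z.im := eventually_mem_nhdsWithin
  have h1 : ∀ᶠ z in 𝓝 (σ : ℂ), z.im < ε :=
    (Complex.continuous_im.tendsto _).eventually (gt_mem_nhds (by simpa using hε))
  have h2 : ∀ᶠ z in 𝓝 (σ : ℂ), |z.re - σ| < δ := by
    have : Continuous fun z : ℂ => |z.re - σ| := by fun_prop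
    exact (this.tendsto _).eventually (gt_mem_nhds (by simpa using hδ))
  filter_upwards [h0, nhdsWithin_le_nhds h1, nhdsWithin_le_nhds h2] with z a b c
    using ⟨a, b, c.le⟩

theorem integrable_inv_one_add_sub_sq (σ : ℝ) :
    MeasureTheory.Integrable fun s : ℝ => (1 + (s - σ) ^ 2)⁻¹ :=
  integrable_inv_one_add_sq.comp_sub_right σ

theorem tendsto_integral_halfPlanePoisson {f : ℝ → ℝ} (hf : MeasureTheory.Integrable f) {σ : ℝ}
    (hc : ContinuousAt f σ) :
    Tendsto (fun z : ℂ => ∫ s, halfPlanePoisson z s * f s) (𝓝[{z : ℂ | 0 < z.im}] (σ : ℂ))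
      (𝓝 (f σ)) := by
  have hmem : ∀ᶠ z in 𝓝[{z : ℂ | 0 < z.im}] (σ : ℂ), 0 < z.im := eventually_mem_nhdsWithin
  have him : Tendsto (fun z : ℂ => z.im) (𝓝[{z : ℂ | 0 < z.im}] (σ : ℂ)) (𝓝 0) := by
    have := (Complex.continuous_im.tendsto (σ : ℂ))
    simp only [ofReal_im] at this
    exact this.mono_left nhdsWithin_le_nhds
  have htail : ∀ δ > 0, Tendsto (fun z : ℂ => ∫ s in Metric.ball σ δ, halfPlanePoisson z s)
      (𝓝[{z : ℂ | 0 < z.im}] (σ : ℂ)) (𝓝 1) := by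
    intro δ hδ
    obtain ⟨C, hC, hb⟩ := halfPlanePoisson_le_off (σ := σ) hδ
    have key : Tendsto (fun z : ℂ => ∫ s in (Metric.ball σ δ)ᶜ, halfPlanePoisson z s)
        (𝓝[{z : ℂ | 0 < z.im}] (σ : ℂ)) (𝓝 0) := by
      have hup : Tendsto (fun z : ℂ => C * z.im * ∫ s : ℝ, (1 + (s - σ) ^ 2)⁻¹)
          (𝓝[{z : ℂ | 0 < z.im}] (σ : ℂ)) (𝓝 0) := by
        simpa using (him.const_mul C).mul_const (∫ s : ℝ, (1 + (s - σ) ^ 2)⁻¹)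
      refine squeeze_zero' ?_ ?_ hup
      · filter_upwards [hmem] with z hz
        exact MeasureTheory.integral_nonneg fun s => halfPlanePoisson_nonneg hz.le s
      · filter_upwards [eventually_im_lt_abs_re_sub_le σ (half_pos hδ) one_pos] with z hz
        rw [← MeasureTheory.integral_const_mul]
        have hI := (integrable_inv_one_add_sub_sq σ).const_mul (C * z.im)
        refine le_trans (MeasureTheory.setIntegral_mono_on
          (integrable_halfPlanePoisson hz.1).1.integrableOn hI.integrableOn
          Metric.isOpen_ball.measurableSet.compl fun s hs => ?_)
          (MeasureTheory.setIntegral_le_integral hI (Eventually.of_forall fun s => ?_))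
        · refine hb z hz.1 hz.2.2 s ?_
          simpa [Real.dist_eq] using hs
        · have := hz.1
          positivity
    refine Tendsto.congr' ?_ (by simpa using key.const_sub 1)
    filter_upwards [hmem] with z hz
    have := MeasureTheory.integral_add_compl (Metric.isOpen_ball (x := σ) (ε := δ)).measurableSet
      (integrable_halfPlanePoisson hz).1
    rw [(integrable_halfPlanePoisson hz).2] at this
    linarith
  have hmain := tendsto_integral_peak_smul_of_integrable_of_tendsto (μ := MeasureTheory.volume)
    (φ := fun z : ℂ => halfPlanePoisson z) (t := Metric.ball σ 1) (x₀ := σ) (g := f)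
    (a := f σ) (l := 𝓝[{z : ℂ | 0 < z.im}] (σ : ℂ))
    Metric.isOpen_ball.measurableSet (Metric.ball_mem_nhds σ one_pos) (by simp)
    (by filter_upwards [hmem] with z hz s using halfPlanePoisson_nonneg hz.le s)
    (by
      intro u hu hσu
      obtain ⟨δ, hδ, hsub⟩ := Metric.isOpen_iff.1 hu σ hσu
      obtain ⟨C, hC, hb⟩ := halfPlanePoisson_le_off (σ := σ) hδ
      rw [Metric.tendstoUniformlyOn_iff]
      intro ε hε
      filter_upwards [eventually_im_lt_abs_re_sub_le σ (half_pos hδ)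
        (show 0 < ε / (C + 1) by positivity)] with z hz s hs
      have hs' : δ ≤ |s - σ| := by
        by_contra hlt
        exact hs (hsub (by simpa [Real.dist_eq] using hlt))
      have h1 := hb z hz.1 hz.2.2 s hs'
      have h2 : (1 + (s - σ) ^ 2)⁻¹ ≤ 1 := inv_le_one_of_one_le₀ (by nlinarith [sq_nonneg (s - σ)])
      have h3 : C * z.im * (1 + (s - σ) ^ 2)⁻¹ ≤ C * z.im :=
        mul_le_of_le_one_right (mul_nonneg hC hz.1.le) h2
      have h4 : z.im * (C + 1) < ε := (lt_div_iff₀ (by positivity)).1 hz.2.1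
      simp only [Pi.zero_apply, dist_zero_left, Real.norm_eq_abs]
      rw [abs_of_nonneg (halfPlanePoisson_nonneg hz.1.le s)]
      nlinarith [hz.1])
    (htail 1 one_pos)
    (Eventually.of_forall fun z => (measurable_halfPlanePoisson z).aestronglyMeasurable) hf hc
  simpa only [smul_eq_mul] using hmain

/-- The image of `α - n` under `g⁻¹`, for the index `i = (n, g)`. -/
def boundaryPt (α : ℝ) (i : ℤ × Mmon) : ℝ :=
  ((i.2.1 1 1 : ℝ) * (α - i.1) - i.2.1 0 1) / ((i.2.1 0 0 : ℝ) - (i.2.1 1 0 : ℝ) * (α - i.1))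

/-- The density on `[0,1]` whose Poisson extension at `pullPt z i` is `poissonTerm z i`. -/
def boundaryDensity (i : ℤ × Mmon) : ℝ → ℝ :=
  (Ioc (0:ℝ) 1).indicator fun s => -Real.log s * ((i.2.1 1 0 : ℝ) * s + i.2.1 1 1)⁻¹

/-- The boundary value at `α` of `fun z => poissonTerm z i`. -/
def boundaryTerm (α : ℝ) (i : ℤ × Mmon) : ℝ := boundaryDensity i (boundaryPt α i)

theorem boundaryDensity_nonneg (i : ℤ × Mmon) (s : ℝ) : 0 ≤ boundaryDensity i s := by
  refine Set.indicator_nonneg (fun s hs => ?_) s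
  have hD := mob_denom_pos i.2.2 hs.1.le
  exact mul_nonneg (neg_nonneg.2 (Real.log_nonpos hs.1.le hs.2)) (inv_nonneg.2 (by linarith))

theorem boundaryTerm_nonneg (α : ℝ) (i : ℤ × Mmon) : 0 ≤ boundaryTerm α i :=
  boundaryDensity_nonneg i _

theorem integrable_boundaryDensity (i : ℤ × Mmon) :
    MeasureTheory.Integrable (boundaryDensity i) := by
  rw [boundaryDensity, MeasureTheory.integrable_indicator_iff measurableSet_Ioc]
  have h1 : MeasureTheory.IntegrableOn (fun s => -Real.log s) (Ioc (0:ℝ) 1) :=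
    ((intervalIntegrable_iff_integrableOn_Ioc_of_le zero_le_one).1
      (intervalIntegral.intervalIntegrable_log' (a := 0) (b := 1))).neg
  refine MeasureTheory.Integrable.mul_bdd (c := 1) h1 (by fun_prop) ?_
  refine (MeasureTheory.ae_restrict_iff' measurableSet_Ioc).2 (Eventually.of_forall fun s hs => ?_)
  have hD := mob_denom_pos i.2.2 hs.1.le
  rw [Real.norm_of_nonneg (inv_nonneg.2 (by linarith))]
  exact inv_le_one_of_one_le₀ (by linarith)

theorem poissonTerm_eq_ofReal_integral {z : ℂ} (hz : 0 < z.im) (i : ℤ × Mmon) :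
    poissonTerm z i =
      ENNReal.ofReal (∫ s, halfPlanePoisson (pullPt z i) s * boundaryDensity i s) := by
  have hp := im_pullPt_pos hz i
  rw [MeasureTheory.ofReal_integral_eq_lintegral_ofReal, poissonTerm_eq hz,
    ← MeasureTheory.lintegral_indicator measurableSet_Ioc]
  · congr 1
    ext s
    by_cases hs : s ∈ Ioc (0:ℝ) 1
    · rw [indicator_of_mem hs, boundaryDensity, indicator_of_mem hs,
        ENNReal.ofReal_mul (halfPlanePoisson_nonneg hp.le s), mul_comm]
    · rw [indicator_of_notMem hs, boundaryDensity, indicator_of_notMem hs]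
      simp
  · refine (integrable_boundaryDensity i).bdd_mul (c := (pullPt z i).im⁻¹)
      (measurable_halfPlanePoisson _).aestronglyMeasurable (Eventually.of_forall fun s => ?_)
    rw [Real.norm_of_nonneg (halfPlanePoisson_nonneg hp.le s)]
    exact halfPlanePoisson_le_inv hp s
  · exact Eventually.of_forall fun s =>
      mul_nonneg (halfPlanePoisson_nonneg hp.le s) (boundaryDensity_nonneg i s)

theorem Irrational.int_mul_sub_ne {α : ℝ} (hα : Irrational α) {p q : ℤ} (hq : q ≠ 0) (n : ℤ) :
    (q : ℝ) * (α - n) ≠ p := by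
  intro h
  have h1 : Irrational ((q : ℝ) * (α - n)) := (hα.sub_intCast n).intCast_mul hq
  exact h1 ⟨p, by simp [h]⟩

theorem boundaryDen_ne_zero {α : ℝ} (hα : Irrational α) (i : ℤ × Mmon) :
    (i.2.1 0 0 : ℝ) - (i.2.1 1 0 : ℝ) * (α - i.1) ≠ 0 := by
  by_cases h1 : i.2.1 = 1
  · simp [h1]
  · have hc := (Mmon_entries_of_ne_one i.2.2 h1).2.2.2.1
    intro h
    exact hα.int_mul_sub_ne (p := i.2.1 0 0) (q := i.2.1 1 0) (by omega) i.1 (by linarith)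

theorem boundaryPt_ne_zero {α : ℝ} (hα : Irrational α) (i : ℤ × Mmon) : boundaryPt α i ≠ 0 := by
  have hd := (Mmon_entries i.2.2).2.2.2.2.1
  refine div_ne_zero ?_ (boundaryDen_ne_zero hα i)
  intro h
  exact hα.int_mul_sub_ne (p := i.2.1 0 1) (q := i.2.1 1 1) (by omega) i.1 (by linarith)

theorem boundaryPt_ne_one {α : ℝ} (hα : Irrational α) (i : ℤ × Mmon) : boundaryPt α i ≠ 1 := by
  have he := Mmon_entries i.2.2
  rw [boundaryPt, Ne, div_eq_one_iff_eq (boundaryDen_ne_zero hα i)]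
  intro h
  refine hα.int_mul_sub_ne (p := i.2.1 0 0 + i.2.1 0 1) (q := i.2.1 1 0 + i.2.1 1 1)
    (by omega) i.1 ?_
  push_cast
  linarith

theorem continuousAt_boundaryDensity (i : ℤ × Mmon) {σ : ℝ} (h0 : σ ≠ 0) (h1 : σ ≠ 1) :
    ContinuousAt (boundaryDensity i) σ := by
  rw [boundaryDensity]
  by_cases hs : σ ∈ Ioc (0:ℝ) 1
  · have hlt : σ < 1 := lt_of_le_of_ne hs.2 h1
    have hD := mob_denom_pos i.2.2 hs.1.le
    have hev : ∀ᶠ s in 𝓝 σ, s ∈ Ioc (0:ℝ) 1 := by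
      filter_upwards [Ioo_mem_nhds hs.1 hlt] with s hs using ⟨hs.1, hs.2.le⟩
    refine ContinuousAt.congr (f := fun s => -Real.log s * ((i.2.1 1 0 : ℝ) * s + i.2.1 1 1)⁻¹) ?_ ?_
    · exact (Real.continuousAt_log h0).neg.mul
        (ContinuousAt.inv₀ (by fun_prop) (by linarith))
    · filter_upwards [hev] with s hs
      rw [indicator_of_mem hs]
  · refine ContinuousAt.congr (f := fun _ => (0:ℝ)) continuousAt_const ?_
    have hn : ∀ᶠ s in 𝓝 σ, s ∉ Icc (0:ℝ) 1 := by
      refine isClosed_Icc.isOpen_compl.mem_nhds fun h => hs ⟨lt_of_le_of_ne h.1 h0.symm, h.2⟩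
    filter_upwards [hn] with s hs
    rw [indicator_of_notMem fun h => hs ⟨h.1.le, h.2⟩]

theorem tendsto_pullPt {α : ℝ} (hα : Irrational α) (i : ℤ × Mmon) :
    Tendsto (fun w : ℂ => pullPt (α + w) i) (𝓝[{w : ℂ | 0 < w.im}] 0)
      (𝓝[{z : ℂ | 0 < z.im}] (boundaryPt α i : ℂ)) := by
  refine tendsto_nhdsWithin_iff.2 ⟨?_, ?_⟩
  · have hne := boundaryDen_ne_zero hα i
    have hval : pullMob ((α : ℂ) + 0) i = (boundaryPt α i : ℂ) := by
      rw [pullMob, pullDen, boundaryPt]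
      push_cast
      simp
    have hc : ContinuousAt (fun w : ℂ => pullMob ((α : ℂ) + w) i) 0 := by
      unfold pullMob pullDen
      refine ContinuousAt.div (by fun_prop) (by fun_prop) ?_
      rw [add_zero]
      exact_mod_cast hne
    have ht : Tendsto (fun w : ℂ => pullMob ((α : ℂ) + w) i) (𝓝 0) (𝓝 (boundaryPt α i : ℂ)) := by
      rw [← hval]; exact hc
    have hF : Continuous fun u : ℂ => ((u.re : ℂ) + (|u.im| : ℝ) * Complex.I) := by fun_prop
    have h2 := (hF.tendsto (boundaryPt α i : ℂ)).comp ht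
    simp only [ofReal_re, ofReal_im, abs_zero, ofReal_zero, zero_mul, add_zero] at h2
    refine (Tendsto.congr (fun w => ?_) h2).mono_left nhdsWithin_le_nhds
    apply Complex.ext <;> simp [pullPt]
  · filter_upwards [eventually_mem_nhdsWithin] with w hw
    exact im_pullPt_pos (by simpa using hw) i

theorem tendsto_poissonTerm {α : ℝ} (hα : Irrational α) (i : ℤ × Mmon) :
    Tendsto (fun w : ℂ => poissonTerm (α + w) i) (𝓝[{w : ℂ | 0 < w.im}] 0)
      (𝓝 (ENNReal.ofReal (boundaryTerm α i))) := by
  have h := ENNReal.tendsto_ofReal ((tendsto_integral_halfPlanePoisson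
    (integrable_boundaryDensity i) (continuousAt_boundaryDensity i (boundaryPt_ne_zero hα i)
      (boundaryPt_ne_one hα i))).comp (tendsto_pullPt hα i))
  refine h.congr' ?_
  filter_upwards [eventually_mem_nhdsWithin] with w hw
  rw [poissonTerm_eq_ofReal_integral (by simpa using hw)]
  rfl

theorem isCoprime_cuspNum (i : ℤ × Mmon) :
    IsCoprime (i.2.1 1 1) (i.1 * i.2.1 1 1 + i.2.1 0 1) := by
  have hdet := (Mmon_entries i.2.2).1
  rw [det2] at hdet
  have : IsCoprime (i.2.1 1 1) (i.2.1 0 1) := by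
    rcases hdet with h | h
    · exact ⟨i.2.1 0 0, -i.2.1 1 0, by linarith⟩
    · exact ⟨-i.2.1 0 0, i.2.1 1 0, by linarith⟩
  rw [add_comm]
  exact this.add_mul_right_right _

theorem cuspPt_eq_div (i : ℤ × Mmon) :
    cuspPt i = ((i.1 * i.2.1 1 1 + i.2.1 0 1 : ℤ) : ℝ) / cuspDen i := by
  have := (cuspDen_pos i).ne'
  rw [cuspPt, eq_div_iff this, add_mul, div_mul_cancel₀ _ this]
  push_cast [cuspDen]
  ring

theorem cusp_ext {i j : ℤ × Mmon} (h : cuspPt i = cuspPt j)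
    (hdet : det2 i.2.1 = det2 j.2.1) : i = j := by
  have hi := cuspDen_pos i
  have hj := cuspDen_pos j
  rw [cuspPt_eq_div, cuspPt_eq_div, div_eq_div_iff hi.ne' hj.ne', cuspDen, cuspDen] at h
  have hZ : (i.1 * i.2.1 1 1 + i.2.1 0 1) * j.2.1 1 1 =
    (j.1 * j.2.1 1 1 + j.2.1 0 1) * i.2.1 1 1 := by exact_mod_cast h
  have ei := Mmon_entries i.2.2
  have ej := Mmon_entries j.2.2
  have hd : i.2.1 1 1 = j.2.1 1 1 := by
    refine Int.dvd_antisymm (by omega) (by omega) ?_ ?_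
    · exact (isCoprime_cuspNum i).dvd_of_dvd_mul_left (Dvd.intro_left _ hZ.symm)
    · exact (isCoprime_cuspNum j).dvd_of_dvd_mul_left (Dvd.intro_left _ hZ)
  rw [← hd] at hZ
  have hN := mul_right_cancel₀ (show i.2.1 1 1 ≠ 0 by omega) hZ
  have hb : i.2.1 0 1 = j.2.1 0 1 := by
    have hdvd : i.2.1 1 1 ∣ i.2.1 0 1 - j.2.1 0 1 := ⟨j.1 - i.1, by linarith⟩
    have key : ∀ k l : Mmon, det2 k.1 = det2 l.1 → k.1 = 1 → l.1 ≠ 1 → l.1 1 1 = 1 → False := by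
      intro k l hkl hk hl hl1
      obtain ⟨hd1, h2, h3, h4, h5, h6, h7, h8, h9⟩ := Mmon_entries_of_ne_one l.2 hl
      have hb1 : l.1 0 1 = 1 := by omega
      have hc1 : l.1 1 0 = 1 := by omega
      rw [hk] at hkl
      simp only [det2, hl1, hb1, hc1] at hkl
      simp at hkl
      omega
    by_cases h1 : i.2.1 = 1
    · by_cases h2 : j.2.1 = 1
      · rw [h1, h2]
      · exact (key _ _ hdet h1 h2 (by rw [← hd, h1]; simp)).elim
    · by_cases h2 : j.2.1 = 1
      · exact (key _ _ hdet.symm h2 h1 (by rw [hd, h2]; simp)).elim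
      · obtain ⟨-, -, hb1, -, -, hb2, -⟩ := Mmon_entries_of_ne_one i.2.2 h1
        obtain ⟨-, -, hb3, -, -, hb4, -⟩ := Mmon_entries_of_ne_one j.2.2 h2
        have := Int.eq_zero_of_abs_lt_dvd hdvd (by rw [abs_lt]; omega)
        omega
  refine Prod.ext ?_ (Subtype.ext (Mmon_ext i.2.2 j.2.2 hb hd hdet))
  have : i.1 * i.2.1 1 1 = j.1 * i.2.1 1 1 := by linarith
  exact mul_right_cancel₀ (show i.2.1 1 1 ≠ 0 by omega) this

theorem one_le_abs_cuspPt_sub {i j : ℤ × Mmon} (h : cuspPt i ≠ cuspPt j) :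
    1 ≤ cuspDen i * cuspDen j * |cuspPt i - cuspPt j| := by
  have hi := cuspDen_pos i
  have hj := cuspDen_pos j
  set A : ℤ := i.1 * i.2.1 1 1 + i.2.1 0 1 with hA
  set B : ℤ := j.1 * j.2.1 1 1 + j.2.1 0 1 with hB
  have h1 : cuspDen i * cuspDen j * (cuspPt i - cuspPt j) =
      ((A * j.2.1 1 1 - B * i.2.1 1 1 : ℤ) : ℝ) := by
    rw [cuspPt_eq_div, cuspPt_eq_div, ← hA, ← hB]
    have e1 : cuspDen i = (i.2.1 1 1 : ℝ) := rfl
    have e2 : cuspDen j = (j.2.1 1 1 : ℝ) := rfl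
    push_cast
    rw [← e1, ← e2]
    field_simp
  rw [← abs_of_pos (mul_pos hi hj), ← abs_mul, h1, ← Int.cast_abs]
  have h2 : A * j.2.1 1 1 - B * i.2.1 1 1 ≠ 0 := by
    intro h0
    rw [h0, Int.cast_zero] at h1
    rcases mul_eq_zero.1 h1 with h3 | h3
    · exact (mul_pos hi hj).ne' h3
    · exact h (sub_eq_zero.1 h3)
  exact_mod_cast Int.one_le_abs h2

/-- The orientation of the index `i`. -/
def cuspSign (i : ℤ × Mmon) : Bool := decide (det2 i.2.1 = 1)

theorem det2_eq_of_cuspSign_eq {i j : ℤ × Mmon} (h : cuspSign i = cuspSign j) :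
    det2 i.2.1 = det2 j.2.1 := by
  have hi := (Mmon_entries i.2.2).1
  have hj := (Mmon_entries j.2.2).1
  rw [cuspSign, cuspSign, decide_eq_decide] at h
  omega

/-- Two cusps of the same orientation whose denominators are smaller than `2 * Q` coincide as
soon as they are at distance at most `1 / (4 * Q ^ 2)`. -/
theorem cusp_ext_of_close {i j : ℤ × Mmon} {Q : ℝ} (hi : cuspDen i < 2 * Q)
    (hj : cuspDen j < 2 * Q) (hs : cuspSign i = cuspSign j)
    (h : 4 * Q ^ 2 * |cuspPt i - cuspPt j| ≤ 1) : i = j := by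
  refine cusp_ext ?_ (det2_eq_of_cuspSign_eq hs)
  by_contra hne
  have h1 := one_le_abs_cuspPt_sub hne
  have hpos : 0 < |cuspPt i - cuspPt j| := abs_pos.2 (sub_ne_zero.2 hne)
  have h2 : cuspDen i * cuspDen j < 4 * Q ^ 2 := by
    nlinarith [cuspDen_pos i, cuspDen_pos j]
  nlinarith

theorem exists_dyadic {x Q : ℝ} (hQ : 0 < Q) (h : Q ≤ x) :
    ∃ j : ℕ, 2 ^ j * Q ≤ x ∧ x < 2 * (2 ^ j * Q) := by
  obtain ⟨j, h1, h2⟩ := exists_nat_pow_near ((one_le_div hQ).2 h) (one_lt_two)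
  refine ⟨j, (le_div_iff₀ hQ).1 h1, ?_⟩
  have := (div_lt_iff₀ hQ).1 h2
  rw [pow_succ] at this
  linarith

/-- The indices whose cusp is a good approximation of `z`. -/
def nearSet (z : ℂ) : Set (ℤ × Mmon) := {i | cuspDen i ^ 2 * ‖z - cuspPt i‖ < 1 / 8}

theorem near_ext {z : ℂ} {i j : ℤ × Mmon} (hi : i ∈ nearSet z) (hj : j ∈ nearSet z) {Q : ℝ}
    (hQ : 0 < Q) (hi1 : Q ≤ cuspDen i) (hi2 : cuspDen i < 2 * Q) (hj1 : Q ≤ cuspDen j)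
    (hj2 : cuspDen j < 2 * Q) (hs : cuspSign i = cuspSign j) : i = j := by
  refine cusp_ext_of_close hi2 hj2 hs ?_
  have h1 : |cuspPt i - cuspPt j| ≤ ‖z - cuspPt i‖ + ‖z - cuspPt j‖ := by
    rw [← Real.norm_eq_abs, ← Complex.norm_real, norm_sub_rev z (cuspPt i)]
    push_cast
    rw [show (cuspPt i : ℂ) - cuspPt j = (cuspPt i - z) + (z - cuspPt j) by ring]
    exact norm_add_le _ _
  have a1 : cuspDen i ^ 2 * ‖z - cuspPt i‖ < 1 / 8 := hi
  have a2 : cuspDen j ^ 2 * ‖z - cuspPt j‖ < 1 / 8 := hj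
  have h2 : Q ^ 2 * ‖z - cuspPt i‖ ≤ cuspDen i ^ 2 * ‖z - cuspPt i‖ := by gcongr
  have h3 : Q ^ 2 * ‖z - cuspPt j‖ ≤ cuspDen j ^ 2 * ‖z - cuspPt j‖ := by gcongr
  nlinarith [sq_nonneg Q]

theorem tsum_geometric_le {r : ℝ} (h0 : 0 ≤ r) (h1 : r ≤ 3 / 4) {c : ℝ} (hc : 0 ≤ c) :
    ∑' j : ℕ, ENNReal.ofReal (r ^ j * c) ≤ ENNReal.ofReal (4 * c) := by
  have hs : Summable fun j : ℕ => r ^ j * c :=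
    (summable_geometric_of_lt_one h0 (by linarith)).mul_right c
  rw [← ENNReal.ofReal_tsum_of_nonneg (fun j => by positivity) hs, tsum_mul_right,
    tsum_geometric_of_lt_one h0 (by linarith)]
  refine ENNReal.ofReal_le_ofReal (mul_le_mul_of_nonneg_right ?_ hc)
  exact inv_le_of_inv_le₀ (by norm_num) (by norm_num; linarith)

theorem tsum_near_le (z : ℂ) {Q : ℝ} (hQ : 0 < Q) :
    ∑' i : {i // Q ≤ cuspDen i ∧ i ∈ nearSet z}, ENNReal.ofReal (Real.sqrt (cuspDen i))⁻¹ ≤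
      ENNReal.ofReal (8 * (Real.sqrt Q)⁻¹) := by
  choose! J hJ1 hJ2 using fun x (hx : Q ≤ x) => exists_dyadic hQ hx
  have hinj : Function.Injective
      (fun i : {i // Q ≤ cuspDen i ∧ i ∈ nearSet z} => (cuspSign i.1, J (cuspDen i.1))) := by
    rintro ⟨i, hi⟩ ⟨j, hj⟩ hij
    simp only [Prod.mk.injEq] at hij
    have hj1 := hJ1 _ hj.1
    have hj2 := hJ2 _ hj.1
    rw [← hij.2] at hj1 hj2
    exact Subtype.ext (near_ext hi.2 hj.2 (by positivity) (hJ1 _ hi.1) (hJ2 _ hi.1) hj1 hj2 hij.1)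
  have hsq : (Real.sqrt 2)⁻¹ ≤ 3 / 4 := by
    refine inv_le_of_inv_le₀ (by norm_num) (Real.le_sqrt_of_sq_le (by norm_num))
  calc _ ≤ ∑' i : {i // Q ≤ cuspDen i ∧ i ∈ nearSet z},
        (fun p : Bool × ℕ => ENNReal.ofReal ((Real.sqrt 2)⁻¹ ^ p.2 * (Real.sqrt Q)⁻¹))
          (cuspSign i.1, J (cuspDen i.1)) := by
        refine ENNReal.tsum_le_tsum fun i => ENNReal.ofReal_le_ofReal ?_
        have h1 := hJ1 _ i.2.1
        simp only
        rw [inv_pow, ← mul_inv]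
        refine inv_anti₀ (by positivity) (Real.le_sqrt_of_sq_le ?_)
        rw [mul_pow, ← pow_mul, mul_comm (J _) 2, pow_mul, Real.sq_sqrt zero_le_two,
          Real.sq_sqrt hQ.le]
        exact h1
    _ ≤ ∑' p : Bool × ℕ, ENNReal.ofReal ((Real.sqrt 2)⁻¹ ^ p.2 * (Real.sqrt Q)⁻¹) :=
        ENNReal.tsum_comp_le_tsum_of_injective hinj _
    _ ≤ ENNReal.ofReal (8 * (Real.sqrt Q)⁻¹) := by
        rw [ENNReal.tsum_prod', tsum_bool]
        have := tsum_geometric_le (r := (Real.sqrt 2)⁻¹) (by positivity) hsq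
          (c := (Real.sqrt Q)⁻¹) (by positivity)
        refine (add_le_add this this).trans ?_
        rw [← ENNReal.ofReal_add (by positivity) (by positivity)]
        exact ENNReal.ofReal_le_ofReal (by linarith)

theorem tsum_lintegral_Ico_halfPlanePoisson {z : ℂ} (hz : 0 < z.im) :
    ∑' k : ℤ, ∫⁻ t in Ico (k:ℝ) (k + 1), ENNReal.ofReal (halfPlanePoisson z t) = 1 := by
  rw [← lintegral_halfPlanePoisson hz, ← MeasureTheory.lintegral_iUnion
    (fun _ => measurableSet_Ico) (pairwise_disjoint_Ico_intCast ℝ), iUnion_Ico_intCast,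
    MeasureTheory.Measure.restrict_univ]

theorem inv_add_sq_le_lintegral {u Y : ℝ} (hY : 1 ≤ Y) :
    ENNReal.ofReal (Y / (u ^ 2 + Y ^ 2)) ≤ ENNReal.ofReal (3 * Real.pi) *
      ∫⁻ t in Ico (⌊u⌋:ℝ) (⌊u⌋ + 1), ENNReal.ofReal (halfPlanePoisson ⟨0, Y⟩ t) := by
  rw [← MeasureTheory.lintegral_const_mul' _ _ ENNReal.ofReal_ne_top]
  calc ENNReal.ofReal (Y / (u ^ 2 + Y ^ 2))
      = ∫⁻ t in Ico (⌊u⌋:ℝ) (⌊u⌋ + 1), ENNReal.ofReal (Y / (u ^ 2 + Y ^ 2)) := by simp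
    _ ≤ _ := by
      refine MeasureTheory.setLIntegral_mono' measurableSet_Ico fun t ht => ?_
      rw [← ENNReal.ofReal_mul (by positivity)]
      refine ENNReal.ofReal_le_ofReal ?_
      rw [halfPlanePoisson]
      simp only [sub_zero]
      have h1 := Int.floor_le u
      have h2 := Int.lt_floor_add_one u
      have h3 : |t - u| ≤ 1 := abs_le.2 ⟨by linarith [ht.1], by linarith [ht.2]⟩
      have h4 : (t - u) ^ 2 ≤ 1 := by
        rw [← sq_abs]; nlinarith [abs_nonneg (t - u)]
      have hp := Real.pi_pos
      rw [show 3 * Real.pi * (Real.pi⁻¹ * (Y / (t ^ 2 + Y ^ 2))) = 3 * Y / (t ^ 2 + Y ^ 2) by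
        field_simp]
      rw [div_le_div_iff₀ (by positivity) (by positivity)]
      have h5 : t ^ 2 + Y ^ 2 ≤ 3 * (u ^ 2 + Y ^ 2) := by nlinarith [sq_nonneg (t - 2 * u)]
      nlinarith

theorem poissonTerm_le_lintegral {z : ℂ} (hz : 0 < z.im) (i : ℤ × Mmon)
    (hv : 1 / 16 ≤ ‖cuspVar z i‖) {Q : ℝ} (hQ : 0 < Q) (h1 : Q ≤ cuspDen i)
    (h2 : cuspDen i < 2 * Q) :
    poissonTerm z i ≤ ENNReal.ofReal (100000 / Q) *
      ∫⁻ t in Ico (⌊4 * Q ^ 2 * (cuspPt i - z.re)⌋:ℝ) (⌊4 * Q ^ 2 * (cuspPt i - z.re)⌋ + 1),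
        ENNReal.ofReal (halfPlanePoisson ⟨0, 1 + Q ^ 2 * z.im⟩ t) := by
  set u := 4 * Q ^ 2 * (cuspPt i - z.re) with hu
  set Y := 1 + Q ^ 2 * z.im with hY
  have hY1 : 1 ≤ Y := by rw [hY]; nlinarith [mul_pos (pow_pos hQ 2) hz]
  have hn : Q ^ 4 * ((cuspPt i - z.re) ^ 2 + z.im ^ 2) ≤ ‖cuspVar z i‖ ^ 2 := by
    rw [norm_cuspVar, mul_pow, Complex.sq_norm, Complex.normSq_apply]
    have : Q ^ 4 ≤ (cuspDen i ^ 2) ^ 2 := by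
      rw [← pow_mul]; gcongr
    calc Q ^ 4 * ((cuspPt i - z.re) ^ 2 + z.im ^ 2)
        ≤ (cuspDen i ^ 2) ^ 2 * ((cuspPt i - z.re) ^ 2 + z.im ^ 2) := by gcongr
      _ = _ := by simp; left; ring
  have hn2 : (u ^ 2 + Y ^ 2) / 16 ≤ 1 + ‖cuspVar z i‖ ^ 2 := by
    have e1 : u ^ 2 / 16 + (Y - 1) ^ 2 = Q ^ 4 * ((cuspPt i - z.re) ^ 2 + z.im ^ 2) := by
      rw [hu, hY]; ring
    nlinarith [sq_nonneg (Y - 2)]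
  have hd := cuspDen_pos i
  have hn3 : 1 + cuspDen i ^ 2 * z.im ≤ 4 * Y := by
    have : cuspDen i ^ 2 ≤ (2 * Q) ^ 2 := by gcongr
    rw [hY]
    nlinarith
  have hb : (cuspDen i)⁻¹ * (95 * ((1 + cuspDen i ^ 2 * z.im) / (1 + ‖cuspVar z i‖ ^ 2))) ≤
      (6080 / Q) * (Y / (u ^ 2 + Y ^ 2)) := by
    have a1 : (1 + cuspDen i ^ 2 * z.im) / (1 + ‖cuspVar z i‖ ^ 2) ≤
        4 * Y / ((u ^ 2 + Y ^ 2) / 16) := by gcongr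
    calc _ ≤ Q⁻¹ * (95 * (4 * Y / ((u ^ 2 + Y ^ 2) / 16))) := by gcongr
      _ = _ := by
        have : u ^ 2 + Y ^ 2 ≠ 0 := by positivity
        field_simp
        norm_num
  refine (poissonTerm_le_of_norm_ge hz i hv).trans ((ENNReal.ofReal_le_ofReal hb).trans ?_)
  rw [ENNReal.ofReal_mul (by positivity)]
  refine (mul_le_mul_right (inv_add_sq_le_lintegral hY1) _).trans ?_
  rw [← mul_assoc, ← ENNReal.ofReal_mul (by positivity)]
  refine mul_le_mul_left (ENNReal.ofReal_le_ofReal ?_) _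
  rw [div_mul_eq_mul_div]
  gcongr
  nlinarith [Real.pi_lt_d2]

theorem tsum_poissonTerm_far_le {z : ℂ} (hz : 0 < z.im) {Q : ℝ} (hQ : 0 < Q) :
    ∑' i : {i // Q ≤ cuspDen i ∧ 1 / 16 ≤ ‖cuspVar z i‖}, poissonTerm z i ≤
      ENNReal.ofReal (800000 / Q) := by
  choose! J hJ1 hJ2 using fun x (hx : Q ≤ x) => exists_dyadic hQ hx
  set P : ℕ → ℝ := fun j => 2 ^ j * Q with hP
  have hPpos : ∀ j, 0 < P j := fun j => by positivity
  set F : (Bool × ℕ) × ℤ → ℝ≥0∞ := fun p => ENNReal.ofReal (100000 / P p.1.2) *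
    ∫⁻ t in Ico (p.2:ℝ) (p.2 + 1), ENNReal.ofReal (halfPlanePoisson ⟨0, 1 + P p.1.2 ^ 2 * z.im⟩ t)
    with hF
  set e : {i // Q ≤ cuspDen i ∧ 1 / 16 ≤ ‖cuspVar z i‖} → (Bool × ℕ) × ℤ := fun i =>
    ((cuspSign i.1, J (cuspDen i.1)), ⌊4 * P (J (cuspDen i.1)) ^ 2 * (cuspPt i.1 - z.re)⌋) with he
  have hinj : Function.Injective e := by
    rintro ⟨i, hi⟩ ⟨j, hj⟩ hij
    simp only [he, Prod.mk.injEq] at hij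
    obtain ⟨⟨hs, hJ⟩, hfl⟩ := hij
    have hj1 := hJ1 _ hj.1
    have hj2 := hJ2 _ hj.1
    rw [← hJ] at hj1 hj2 hfl
    refine Subtype.ext (cusp_ext_of_close (hJ2 _ hi.1) hj2 hs ?_)
    have := Int.abs_sub_lt_one_of_floor_eq_floor hfl
    rw [← mul_sub, abs_mul, abs_of_nonneg (by positivity), sub_sub_sub_cancel_right] at this
    exact this.le
  calc _ ≤ ∑' i, F (e i) := ENNReal.tsum_le_tsum fun i =>
        poissonTerm_le_lintegral hz i.1 i.2.2 (hPpos _) (hJ1 _ i.2.1) (hJ2 _ i.2.1)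
    _ ≤ ∑' p, F p := ENNReal.tsum_comp_le_tsum_of_injective hinj F
    _ = ∑' p : Bool × ℕ, ENNReal.ofReal (100000 / P p.2) := by
        rw [ENNReal.tsum_prod']
        congr 1
        ext p
        simp only [hF]
        rw [ENNReal.tsum_mul_left, tsum_lintegral_Ico_halfPlanePoisson, mul_one]
        have := hPpos p.2
        positivity
    _ ≤ _ := by
        rw [ENNReal.tsum_prod', tsum_bool]
        have h1 : ∀ j : ℕ, ENNReal.ofReal (100000 / P j) =
            ENNReal.ofReal ((1 / 2) ^ j * (100000 / Q)) := by
          intro j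
          congr 1
          rw [hP, one_div, inv_pow]
          field_simp
        simp only [h1]
        have := tsum_geometric_le (r := 1 / 2) (by positivity) (by norm_num)
          (c := 100000 / Q) (by positivity)
        refine (add_le_add this this).trans ?_
        rw [← ENNReal.ofReal_add (by positivity) (by positivity)]
        exact ENNReal.ofReal_le_ofReal (by rw [← two_mul, ← mul_assoc, ← mul_div_assoc]; norm_num)

/-- The translates far away contribute little near the real axis. -/
theorem tsum_poissonTerm_translate_le {z : ℂ} (hz : 0 < z.im) {R : ℝ} (hR : |z.re| ≤ R) {n : ℤ}
    (hn : 2 * (R + 1) ≤ |(n:ℝ)|) :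
    ∑' g : Mmon, poissonTerm z (n, g) ≤
      ENNReal.ofReal (16 * z.im / (1 + |(n:ℝ)|) ^ 2) * brjMeasure univ := by
  rw [tsum_poissonTerm_fiber, ← MeasureTheory.lintegral_const]
  refine MeasureTheory.lintegral_mono_ae ?_
  filter_upwards [ae_brjMeasure_mem] with x hx
  refine ENNReal.ofReal_le_ofReal ?_
  have hR0 : 0 ≤ R := (abs_nonneg _).trans hR
  have h1 : |(n:ℝ)| / 2 ≤ |x + n - z.re| := by
    have h2 : |(n:ℝ)| ≤ |x + n - z.re| + |x - z.re| := by
      calc |(n:ℝ)| = |(x + n - z.re) - (x - z.re)| := by congr 1; ring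
        _ ≤ _ := abs_sub _ _
    have h3 : |x - z.re| ≤ 1 + R := by
      refine (abs_sub _ _).trans (add_le_add ?_ hR)
      rw [abs_of_nonneg hx.1]; exact hx.2
    linarith
  have h4 : (1 + |(n:ℝ)|) / 4 ≤ |x + n - z.re| := by linarith
  have h5 : ((1 + |(n:ℝ)|) / 4) ^ 2 ≤ (x + n - z.re) ^ 2 := by
    rw [← sq_abs (x + n - z.re)]
    gcongr
  have hpi : Real.pi⁻¹ ≤ 1 := inv_le_one_of_one_le₀ (by linarith [Real.pi_gt_three])
  rw [halfPlanePoisson]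
  calc _ ≤ 1 * (z.im / (((1 + |(n:ℝ)|) / 4) ^ 2)) := by
        gcongr
        linarith [sq_nonneg z.im]
    _ = _ := by field_simp; norm_num

theorem tsum_le_of_eventually_le {ι β : Type*} {l : Filter β} [l.NeBot] {F : β → ι → ℝ≥0∞}
    {V : ι → ℝ≥0∞} (hF : ∀ i, Tendsto (fun w => F w i) l (𝓝 (V i))) {C : ℝ≥0∞}
    (hC : ∀ᶠ w in l, ∑' i, F w i ≤ C) : ∑' i, V i ≤ C := by
  rw [ENNReal.tsum_eq_iSup_sum]
  refine iSup_le fun s => le_of_tendsto (tendsto_finsetSum s fun i _ => hF i) ?_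
  filter_upwards [hC] with w hw using (ENNReal.sum_le_tsum s).trans hw

/-- Tannery's theorem for series in `ℝ≥0∞` with uniformly small tails. -/
theorem tendsto_tsum_of_tail {ι β : Type*} {l : Filter β} [l.NeBot] {F : β → ι → ℝ≥0∞}
    {V : ι → ℝ≥0∞} (hF : ∀ i, Tendsto (fun w => F w i) l (𝓝 (V i))) (hV : ∀ i, V i ≠ ∞)
    (htail : ∀ ε : ℝ≥0∞, ε ≠ 0 → ∃ S : Finset ι, ∀ᶠ w in l, ∑' i : {i // i ∉ S}, F w i ≤ ε) :
    Tendsto (fun w => ∑' i, F w i) l (𝓝 (∑' i, V i)) ∧ ∑' i, V i ≠ ∞ := by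
  classical
  have split : ∀ (S : Finset ι) (f : ι → ℝ≥0∞),
      ∑' i, f i = ∑ i ∈ S, f i + ∑' i : {i // i ∉ S}, f i := fun S f =>
    (ENNReal.sum_add_tsum_compl S f).symm
  have hVtail : ∀ (S : Finset ι) (ε : ℝ≥0∞), (∀ᶠ w in l, ∑' i : {i // i ∉ S}, F w i ≤ ε) →
      ∑' i : {i // i ∉ S}, V i ≤ ε := fun S ε h =>
    tsum_le_of_eventually_le (F := fun w (i : {i // i ∉ S}) => F w i) (fun i => hF i) h
  have hfin : ∑' i, V i ≠ ∞ := by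
    obtain ⟨S, hS⟩ := htail 1 one_ne_zero
    rw [split S]
    exact ENNReal.add_ne_top.2 ⟨ENNReal.sum_ne_top.2 fun i _ => hV i,
      ne_top_of_le_ne_top ENNReal.one_ne_top (hVtail S 1 hS)⟩
  refine ⟨(ENNReal.tendsto_nhds hfin).2 fun ε hε => ?_, hfin⟩
  have hε2 : ε / 2 ≠ 0 := by simpa using hε.ne'
  obtain ⟨S, hS⟩ := htail (ε / 2) hε2
  have hsum : Tendsto (fun w => ∑ i ∈ S, F w i) l (𝓝 (∑ i ∈ S, V i)) :=
    tendsto_finsetSum S fun i _ => hF i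
  have hSfin : ∑ i ∈ S, V i ≠ ∞ := ENNReal.sum_ne_top.2 fun i _ => hV i
  filter_upwards [hS, (ENNReal.tendsto_nhds hSfin).1 hsum (ε / 2) (pos_iff_ne_zero.2 hε2)]
    with w hw1 hw2
  constructor
  · rw [tsub_le_iff_right, split S V, split S (F w)]
    calc _ ≤ (∑ i ∈ S, F w i + ε / 2) + ε / 2 :=
          add_le_add (tsub_le_iff_right.1 hw2.1) (hVtail S _ hS)
      _ = ∑ i ∈ S, F w i + ε := by rw [add_assoc, ENNReal.add_halves]
      _ ≤ _ := by gcongr; exact le_self_add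
  · rw [split S V, split S (F w)]
    calc _ ≤ (∑ i ∈ S, V i + ε / 2) + ε / 2 := add_le_add hw2.2 hw1
      _ = ∑ i ∈ S, V i + ε := by rw [add_assoc, ENNReal.add_halves]
      _ ≤ _ := by gcongr; exact le_self_add

theorem finite_setOf_cuspDen_lt (Q N : ℝ) :
    {i : ℤ × Mmon | cuspDen i < Q ∧ |(i.1 : ℝ)| < N}.Finite := by
  set q := ⌈Q⌉ with hq
  set m := ⌈N⌉ with hm
  have hfin : (Icc (-m) m ×ˢ Icc 0 q ×ˢ Icc 0 q ×ˢ Icc (-1 : ℤ) 1).Finite :=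
    (finite_Icc _ _).prod ((finite_Icc _ _).prod ((finite_Icc _ _).prod (finite_Icc _ _)))
  refine Set.Finite.of_finite_image (f := fun i : ℤ × Mmon =>
    (i.1, i.2.1 1 1, i.2.1 0 1, det2 i.2.1)) (hfin.subset ?_) ?_
  · rintro _ ⟨i, ⟨h1, h2⟩, rfl⟩
    have he := Mmon_entries i.2.2
    have h3 : i.2.1 1 1 < q := by
      rw [hq]; exact Int.lt_ceil.2 h1
    have h4 : |i.1| < m := by
      rw [hm]; exact Int.lt_ceil.2 (by simpa using h2)
    rw [abs_lt] at h4
    simp only [mem_prod, mem_Icc]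
    omega
  · intro i _ j _ hij
    simp only [Prod.mk.injEq] at hij
    exact Prod.ext hij.1 (Subtype.ext (Mmon_ext i.2.2 j.2.2 hij.2.2.1 hij.2.1 hij.2.2.2))

theorem tsum_poissonTerm_translates_le {z : ℂ} (hz : 0 < z.im) {R : ℝ} (hR : |z.re| ≤ R) :
    ∑' i : {i : ℤ × Mmon // 2 * (R + 1) ≤ |(i.1 : ℝ)|}, poissonTerm z i ≤
      ENNReal.ofReal (16 * z.im * ∑' n : ℤ, 1 / (1 + |(n:ℝ)|) ^ 2) * brjMeasure univ := by
  have h0 : ∑' i : {i : ℤ × Mmon // 2 * (R + 1) ≤ |(i.1 : ℝ)|}, poissonTerm z i =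
      ∑' i : ℤ × Mmon, {i : ℤ × Mmon | 2 * (R + 1) ≤ |(i.1 : ℝ)|}.indicator (poissonTerm z) i :=
    tsum_subtype {i : ℤ × Mmon | 2 * (R + 1) ≤ |(i.1 : ℝ)|} (poissonTerm z)
  have hy := hz.le
  rw [h0, ENNReal.tsum_prod', ← tsum_mul_left, ENNReal.ofReal_tsum_of_nonneg
    (fun n => by positivity) (summable_inv_one_add_abs_sq.mul_left _), ← ENNReal.tsum_mul_right]
  refine ENNReal.tsum_le_tsum fun n => ?_
  by_cases hn : 2 * (R + 1) ≤ |(n:ℝ)|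
  · refine le_trans (le_of_eq ?_) ((tsum_poissonTerm_translate_le hz hR hn).trans_eq ?_)
    · refine tsum_congr fun g => indicator_of_mem ?_ _
      exact hn
    · rw [mul_one_div]
  · have : ∀ g : Mmon, {i : ℤ × Mmon | 2 * (R + 1) ≤ |(i.1 : ℝ)|}.indicator
        (poissonTerm z) (n, g) = 0 := fun g => indicator_of_notMem (by exact hn) _
    simp only [this, tsum_zero, zero_le]

/-- Convergence of `Im 𝓑` follows from smallness of the contributions of the large
denominators. -/
theorem tendsto_tsum_poissonTerm {α : ℝ} (hα : Irrational α) {l : Filter ℂ} [l.NeBot]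
    (hl : l ≤ 𝓝[{w : ℂ | 0 < w.im}] 0)
    (htail : ∀ ε : ℝ, 0 < ε → ∃ Q : ℝ, ∀ᶠ w in l,
      ∑' i : {i : ℤ × Mmon // Q ≤ cuspDen i}, poissonTerm (α + w) i ≤ ENNReal.ofReal ε) :
    Tendsto (fun w : ℂ => ∑' i, poissonTerm (α + w) i) l
      (𝓝 (∑' i, ENNReal.ofReal (boundaryTerm α i))) ∧
    ∑' i, ENNReal.ofReal (boundaryTerm α i) ≠ ∞ := by
  refine tendsto_tsum_of_tail (fun i => (tendsto_poissonTerm hα i).mono_left hl)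
    (fun i => ENNReal.ofReal_ne_top) fun ε hε => ?_
  obtain ⟨δ, hδ, hδε⟩ : ∃ δ : ℝ, 0 < δ ∧ ENNReal.ofReal δ ≤ ε / 2 := by
    by_cases h : ε = ∞
    · exact ⟨1, one_pos, by rw [h, ENNReal.top_div_of_ne_top (by simp)]; exact le_top⟩
    · refine ⟨(ε / 2).toReal, ENNReal.toReal_pos (by simpa using hε)
        (ENNReal.div_ne_top h (by simp)), ENNReal.ofReal_toReal_le⟩
  obtain ⟨Q, hQ⟩ := htail δ hδ
  set R := |α| + 1 with hR
  set S := finite_setOf_cuspDen_lt Q (2 * (R + 1)) with hS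
  refine ⟨S.toFinset, ?_⟩
  have him : ∀ᶠ w in l, 0 < w.im := hl eventually_mem_nhdsWithin
  have hre : ∀ᶠ w : ℂ in l, |((α : ℂ) + w).re| ≤ R := by
    have hc : Continuous fun w : ℂ => |((α : ℂ) + w).re| := by fun_prop
    have : ∀ᶠ w : ℂ in 𝓝 0, |((α : ℂ) + w).re| < R :=
      (hc.tendsto 0).eventually (gt_mem_nhds (by simp [hR]))
    exact (hl.trans nhdsWithin_le_nhds) (this.mono fun w hw => hw.le)
  have hsmall : ∀ᶠ w : ℂ in l, ENNReal.ofReal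
      (16 * w.im * ∑' n : ℤ, 1 / (1 + |(n:ℝ)|) ^ 2) * brjMeasure univ ≤ ε / 2 := by
    have hc : Tendsto (fun w : ℂ => ENNReal.ofReal
        (16 * w.im * ∑' n : ℤ, 1 / (1 + |(n:ℝ)|) ^ 2) * brjMeasure univ) (𝓝 0) (𝓝 0) := by
      have h1 : Continuous fun w : ℂ => 16 * w.im * ∑' n : ℤ, 1 / (1 + |(n:ℝ)|) ^ 2 := by fun_prop
      have h2 := ENNReal.Tendsto.mul_const (b := brjMeasure univ)
        (ENNReal.tendsto_ofReal (h1.tendsto 0)) (Or.inr (MeasureTheory.measure_ne_top _ _))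
      simpa using h2
    exact (hl.trans nhdsWithin_le_nhds) (hc.eventually_le_const
      (pos_iff_ne_zero.2 (by simpa using hε)))
  filter_upwards [hQ, him, hre, hsmall] with w h1 h2 h3 h4
  set f := poissonTerm (α + w) with hf
  have hsub : {i | i ∉ S.toFinset} ⊆ {i : ℤ × Mmon | Q ≤ cuspDen i} ∪
      {i : ℤ × Mmon | 2 * (R + 1) ≤ |(i.1 : ℝ)|} := by
    intro i hi
    by_contra hcon
    rw [mem_union, not_or] at hcon
    exact hi (S.mem_toFinset.2 ⟨not_le.1 hcon.1, not_le.1 hcon.2⟩)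
  have h5 := tsum_poissonTerm_translates_le (z := α + w) (by simpa using h2) h3
  calc ∑' i : {i // i ∉ S.toFinset}, f i
      ≤ ∑' i : ↥({i : ℤ × Mmon | Q ≤ cuspDen i} ∪
          {i : ℤ × Mmon | 2 * (R + 1) ≤ |(i.1 : ℝ)|}), f i := ENNReal.tsum_mono_subtype f hsub
    _ ≤ _ := ENNReal.tsum_union_le f _ _
    _ ≤ ε / 2 + ε / 2 := by
        refine add_le_add (h1.trans hδε) (h5.trans ?_)
        simpa using h4
    _ = ε := ENNReal.add_halves ε

/-- The majorant of `poissonTerm` near the boundary point `α`, for a good approximation of `α`. -/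
def approxTerm (α : ℝ) (i : ℤ × Mmon) : ℝ :=
  (cuspDen i)⁻¹ * Real.log (1 + 2 / (cuspDen i ^ 2 * |α - cuspPt i|))

theorem approxTerm_nonneg (α : ℝ) (i : ℤ × Mmon) : 0 ≤ approxTerm α i := by
  have := cuspDen_pos i
  refine mul_nonneg (by positivity) (Real.log_nonneg ?_)
  have : 0 ≤ 2 / (cuspDen i ^ 2 * |α - cuspPt i|) := by positivity
  linarith

/-- The indices of the cusps so close to `α` that `poissonTerm` at `α + w` may exceed
`approxTerm`. -/
def closeSet (α ρ : ℝ) : Set (ℤ × Mmon) :=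
  {i | |α - cuspPt i| < 2 * ρ ∧ cuspDen i ^ 2 * ρ < 1 / 64}

theorem norm_ofReal_sub_cuspPt (α : ℝ) (i : ℤ × Mmon) : ‖(α : ℂ) - cuspPt i‖ = |α - cuspPt i| := by
  rw [← Complex.ofReal_sub, Complex.norm_real, Real.norm_eq_abs]

theorem cusp_ext_of_mem_closeSet {α ρ : ℝ} {i j : ℤ × Mmon} (hi : i ∈ closeSet α ρ)
    (hj : j ∈ closeSet α ρ) (hs : cuspSign i = cuspSign j) : i = j := by
  refine cusp_ext ?_ (det2_eq_of_cuspSign_eq hs)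
  by_contra hne
  have h1 := one_le_abs_cuspPt_sub hne
  have hρ : 0 < ρ := by linarith [hi.1, abs_nonneg (α - cuspPt i)]
  have hci := cuspDen_pos i
  have hcj := cuspDen_pos j
  have h2 : |cuspPt i - cuspPt j| ≤ 4 * ρ := by
    have := abs_sub_le (cuspPt i) α (cuspPt j)
    rw [abs_sub_comm (cuspPt i) α] at this
    linarith [hi.1, hj.1]
  have h3 : cuspDen i * cuspDen j * ρ ≤ 1 / 64 := by
    nlinarith [hi.2, hj.2, mul_nonneg (sq_nonneg (cuspDen i - cuspDen j)) hρ.le]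
  have h4 : cuspDen i * cuspDen j * |cuspPt i - cuspPt j| ≤ cuspDen i * cuspDen j * (4 * ρ) := by
    gcongr
  linarith

theorem tsum_closeSet_le {α ρ c : ℝ} (hc : 0 ≤ c) (s : Set (ℤ × Mmon)) (hs : s ⊆ closeSet α ρ) :
    ∑' _i : s, ENNReal.ofReal c ≤ ENNReal.ofReal (2 * c) := by
  have hinj : Function.Injective fun i : s => cuspSign i.1 := fun i j hij =>
    Subtype.ext (cusp_ext_of_mem_closeSet (hs i.2) (hs j.2) hij)
  refine (ENNReal.tsum_comp_le_tsum_of_injective hinj fun _ : Bool => ENNReal.ofReal c).trans ?_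
  rw [tsum_bool, ← ENNReal.ofReal_add hc hc, two_mul]

theorem Irrational.abs_sub_cuspPt_pos {α : ℝ} (hα : Irrational α) (i : ℤ × Mmon) :
    0 < |α - cuspPt i| := by
  refine abs_pos.2 (sub_ne_zero.2 fun h => ?_)
  rw [cuspPt_eq_div, cuspDen] at h
  refine hα ⟨((i.1 * i.2.1 1 1 + i.2.1 0 1 : ℤ) : ℚ) / i.2.1 1 1, ?_⟩
  rw [h]
  push_cast
  rfl

theorem poissonTerm_le_of_near {α : ℝ} (hα : Irrational α) {w : ℂ} (hw : 0 < w.im) (i : ℤ × Mmon)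
    (hv : ‖cuspVar (α + w) i‖ < 1 / 16) :
    (i ∈ nearSet (α + w) ∧ 1 / 64 ≤ cuspDen i ^ 2 * ‖w‖ ∧
      poissonTerm (α + w) i ≤ ENNReal.ofReal (4 * ((cuspDen i)⁻¹ * Real.log (1 + 1 / w.im)))) ∨
    (i ∈ nearSet α ∧ poissonTerm (α + w) i ≤ ENNReal.ofReal (4 * approxTerm α i)) ∨
    (i ∈ nearSet α ∧ i ∈ closeSet α ‖w‖ ∧
      poissonTerm (α + w) i ≤ ENNReal.ofReal (4 * ((cuspDen i)⁻¹ * Real.log (1 + 1 / w.im)))) := by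
  have hz : 0 < ((α : ℂ) + w).im := by simpa using hw
  have hd := cuspDen_pos i
  have hd1 := one_le_cuspDen i
  have hvpos := norm_cuspVar_pos hz i
  have hle := poissonTerm_le_of_norm_lt hz i hv
  have hnorm := norm_cuspVar (α + w) i
  have hwy : w.im ≤ ‖cuspVar (α + w) i‖ := by
    have h1 : w.im ≤ ‖(α : ℂ) + w - cuspPt i‖ := by
      refine le_trans (le_of_eq ?_) ((le_abs_self _).trans (Complex.abs_im_le_norm _))
      simp
    rw [hnorm]
    have h2 : (1:ℝ) ≤ cuspDen i ^ 2 := one_le_pow₀ hd1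
    nlinarith [norm_nonneg ((α : ℂ) + w - cuspPt i)]
  have hle2 : poissonTerm (α + w) i ≤
      ENNReal.ofReal (4 * ((cuspDen i)⁻¹ * Real.log (1 + 1 / w.im))) := by
    refine hle.trans (ENNReal.ofReal_le_ofReal ?_)
    gcongr
  by_cases h64 : 1 / 64 ≤ cuspDen i ^ 2 * ‖w‖
  · refine Or.inl ⟨?_, h64, hle2⟩
    rw [nearSet, mem_ofPred_eq, ← hnorm]
    linarith
  refine Or.inr ?_
  rw [not_le] at h64
  have htri : |α - cuspPt i| ≤ ‖(α : ℂ) + w - cuspPt i‖ + ‖w‖ := by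
    rw [← norm_ofReal_sub_cuspPt]
    calc ‖(α : ℂ) - cuspPt i‖ = ‖((α : ℂ) + w - cuspPt i) - w‖ := by congr 1; ring
      _ ≤ _ := norm_sub_le _ _
  have hnear : i ∈ nearSet (α : ℂ) := by
    rw [nearSet, mem_ofPred_eq, norm_ofReal_sub_cuspPt]
    have : cuspDen i ^ 2 * |α - cuspPt i| ≤
        cuspDen i ^ 2 * (‖(α : ℂ) + w - cuspPt i‖ + ‖w‖) := by gcongr
    rw [mul_add, ← hnorm] at this
    linarith
  by_cases hcl : |α - cuspPt i| < 2 * ‖w‖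
  · exact Or.inr ⟨hnear, ⟨hcl, h64⟩, hle2⟩
  refine Or.inl ⟨hnear, hle.trans (ENNReal.ofReal_le_ofReal ?_)⟩
  rw [not_lt] at hcl
  have hpos := hα.abs_sub_cuspPt_pos i
  rw [approxTerm]
  have h2 : 1 / ‖cuspVar (α + w) i‖ ≤ 2 / (cuspDen i ^ 2 * |α - cuspPt i|) := by
    rw [hnorm, div_le_div_iff₀ (by rw [← hnorm]; exact hvpos) (by positivity)]
    have : cuspDen i ^ 2 * |α - cuspPt i| ≤
        cuspDen i ^ 2 * (2 * ‖(α : ℂ) + w - cuspPt i‖) := by gcongr; linarith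
    linarith
  gcongr

theorem exists_tsum_approxTerm_le {α : ℝ}
    (hG : ∑' i : nearSet (α : ℂ), ENNReal.ofReal (approxTerm α i) ≠ ∞) {ε : ℝ} (hε : 0 < ε) :
    ∃ Q : ℝ, ∀ Q' ≥ Q, ∑' i : {i | Q' ≤ cuspDen i ∧ i ∈ nearSet (α : ℂ)},
      ENNReal.ofReal (4 * approxTerm α i) ≤ ENNReal.ofReal ε := by
  classical
  set f := (nearSet (α : ℂ)).indicator fun i => ENNReal.ofReal (approxTerm α i) with hf
  have hsum : ∑' i, f i ≠ ∞ := by rwa [hf, ← tsum_subtype]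
  have h1 := (ENNReal.tendsto_tsum_compl_atTop_zero hsum).eventually_le_const
    (ENNReal.ofReal_pos.2 (by positivity : 0 < ε / 4))
  obtain ⟨T, hT⟩ := h1.exists
  refine ⟨1 + ∑ i ∈ T, cuspDen i, fun Q hQ => ?_⟩
  have hsub : {i | Q ≤ cuspDen i ∧ i ∈ nearSet (α : ℂ)} ⊆ {i | i ∉ T} := by
    intro i hi hiT
    have := Finset.single_le_sum (fun j _ => (cuspDen_pos j).le) hiT
    linarith [hi.1]
  calc ∑' i : {i | Q ≤ cuspDen i ∧ i ∈ nearSet (α : ℂ)}, ENNReal.ofReal (4 * approxTerm α i)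
      = ∑' i : {i | Q ≤ cuspDen i ∧ i ∈ nearSet (α : ℂ)}, ENNReal.ofReal 4 * f i := by
        refine tsum_congr fun i => ?_
        rw [hf, indicator_of_mem i.2.2, ENNReal.ofReal_mul (by norm_num)]
    _ ≤ ∑' i : {i | i ∉ T}, ENNReal.ofReal 4 * f i :=
        ENNReal.tsum_mono_subtype (fun i => ENNReal.ofReal 4 * f i) hsub
    _ ≤ ENNReal.ofReal 4 * ENNReal.ofReal (ε / 4) := by
        rw [ENNReal.tsum_mul_left]
        exact mul_le_mul_right hT _
    _ = ENNReal.ofReal ε := by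
        rw [← ENNReal.ofReal_mul (by norm_num)]
        congr 1
        ring

theorem tsum_intermediate_le {z : ℂ} {ρ L : ℝ} (hρ : 0 < ρ) (hL : 0 ≤ L) (s : Set (ℤ × Mmon))
    (hs : ∀ i ∈ s, i ∈ nearSet z ∧ 1 / 64 ≤ cuspDen i ^ 2 * ρ) :
    ∑' i : s, ENNReal.ofReal (4 * ((cuspDen i)⁻¹ * L)) ≤
      ENNReal.ofReal (256 * (Real.sqrt ρ * L)) := by
  set D := (8 * Real.sqrt ρ)⁻¹ with hD
  have hsρ : 0 < Real.sqrt ρ := Real.sqrt_pos.2 hρ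
  have hDpos : 0 < D := by positivity
  have hDd : ∀ i ∈ s, D ≤ cuspDen i := by
    intro i hi
    have h1 := (hs i hi).2
    rw [hD, inv_le_iff_one_le_mul₀ (by positivity)]
    have h2 : 1 ≤ (cuspDen i * (8 * Real.sqrt ρ)) ^ 2 := by
      rw [mul_pow, mul_pow, Real.sq_sqrt hρ.le]
      linarith
    have h3 : 0 ≤ cuspDen i * (8 * Real.sqrt ρ) := by
      have := cuspDen_pos i
      positivity
    nlinarith
  have hsub : s ⊆ {i | D ≤ cuspDen i ∧ i ∈ nearSet z} := fun i hi => ⟨hDd i hi, (hs i hi).1⟩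
  set c := 4 * (L * (Real.sqrt D)⁻¹) with hc
  calc ∑' i : s, ENNReal.ofReal (4 * ((cuspDen i)⁻¹ * L))
      ≤ ∑' i : s, ENNReal.ofReal c * ENNReal.ofReal (Real.sqrt (cuspDen i))⁻¹ := by
        refine ENNReal.tsum_le_tsum fun i => ?_
        have hd := cuspDen_pos i.1
        rw [← ENNReal.ofReal_mul (by positivity)]
        refine ENNReal.ofReal_le_ofReal ?_
        have h1 : (cuspDen i)⁻¹ = (Real.sqrt (cuspDen i))⁻¹ * (Real.sqrt (cuspDen i))⁻¹ := by
          rw [← mul_inv, Real.mul_self_sqrt hd.le]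
        have h2 : (Real.sqrt (cuspDen i))⁻¹ ≤ (Real.sqrt D)⁻¹ :=
          inv_anti₀ (Real.sqrt_pos.2 hDpos) (Real.sqrt_le_sqrt (hDd i.1 i.2))
        rw [h1, hc]
        have h3 := mul_le_mul_of_nonneg_right h2
          (mul_nonneg hL (inv_nonneg.2 (Real.sqrt_nonneg (cuspDen i))))
        linarith
    _ ≤ ∑' i : {i | D ≤ cuspDen i ∧ i ∈ nearSet z},
          ENNReal.ofReal c * ENNReal.ofReal (Real.sqrt (cuspDen i))⁻¹ :=
        ENNReal.tsum_mono_subtype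
          (fun i => ENNReal.ofReal c * ENNReal.ofReal (Real.sqrt (cuspDen i))⁻¹) hsub
    _ ≤ ENNReal.ofReal c * ENNReal.ofReal (8 * (Real.sqrt D)⁻¹) := by
        rw [ENNReal.tsum_mul_left]
        exact mul_le_mul_right (tsum_near_le z hDpos) _
    _ = _ := by
        rw [← ENNReal.ofReal_mul (by positivity)]
        congr 1
        have h1 : (Real.sqrt D)⁻¹ * (Real.sqrt D)⁻¹ = 8 * Real.sqrt ρ := by
          rw [← mul_inv, Real.mul_self_sqrt hDpos.le, hD, inv_inv]
        calc c * (8 * (Real.sqrt D)⁻¹)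
            = 32 * L * ((Real.sqrt D)⁻¹ * (Real.sqrt D)⁻¹) := by rw [hc]; ring
          _ = _ := by rw [h1]; ring

/-- The series over the large denominators is uniformly small. -/
theorem tail_of_approximation {α : ℝ} (hα : Irrational α) {l : Filter ℂ}
    (hl : l ≤ 𝓝[{w : ℂ | 0 < w.im}] 0)
    (ha : Tendsto (fun w : ℂ => Real.sqrt ‖w‖ * Real.log (1 + 1 / w.im)) l (𝓝 0))
    (hG : ∑' i : nearSet (α : ℂ), ENNReal.ofReal (approxTerm α i) ≠ ∞)
    (hb : ∀ ε : ℝ, 0 < ε → ∃ Q : ℝ, ∀ᶠ w in l, ∀ i ∈ nearSet (α : ℂ), Q ≤ cuspDen i →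
      i ∈ closeSet α ‖w‖ → Real.log (1 + 1 / w.im) ≤ ε * cuspDen i) {ε : ℝ} (hε : 0 < ε) :
    ∃ Q : ℝ, ∀ᶠ w in l,
      ∑' i : {i : ℤ × Mmon // Q ≤ cuspDen i}, poissonTerm (α + w) i ≤ ENNReal.ofReal ε := by
  obtain ⟨Q1, hQ1⟩ := exists_tsum_approxTerm_le hG (show 0 < ε / 4 by positivity)
  obtain ⟨Q2, hQ2⟩ := hb (ε / 32) (by positivity)
  set Q := max (max Q1 Q2) (3200000 / ε) with hQdef
  have hQ1' : Q1 ≤ Q := (le_max_left _ _).trans (le_max_left _ _)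
  have hQ2' : Q2 ≤ Q := (le_max_right _ _).trans (le_max_left _ _)
  have hQ3 : 3200000 / ε ≤ Q := le_max_right _ _
  have hQ : 0 < Q := lt_of_lt_of_le (by positivity) hQ3
  refine ⟨Q, ?_⟩
  have ha' := ha.eventually_le_const (show (0:ℝ) < ε / 1024 by positivity)
  filter_upwards [hQ2, ha', hl eventually_mem_nhdsWithin] with w h2 h3 hw
  have hw : 0 < w.im := hw
  have hz : 0 < ((α : ℂ) + w).im := by simpa using hw
  have hρ : 0 < ‖w‖ := lt_of_lt_of_le hw ((le_abs_self _).trans (Complex.abs_im_le_norm w))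
  set L := Real.log (1 + 1 / w.im) with hL
  have hL0 : 0 ≤ L := Real.log_nonneg (by have := one_div_pos.2 hw; linarith)
  set f := poissonTerm (α + w) with hf
  set S1 : Set (ℤ × Mmon) := {i | Q ≤ cuspDen i ∧ 1 / 16 ≤ ‖cuspVar (α + w) i‖} with hS1
  set S2 : Set (ℤ × Mmon) := {i | i ∈ nearSet (α + w) ∧ 1 / 64 ≤ cuspDen i ^ 2 * ‖w‖ ∧
    f i ≤ ENNReal.ofReal (4 * ((cuspDen i)⁻¹ * L))} with hS2
  set S3 : Set (ℤ × Mmon) := {i | Q ≤ cuspDen i ∧ i ∈ nearSet (α : ℂ) ∧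
    f i ≤ ENNReal.ofReal (4 * approxTerm α i)} with hS3
  set S4 : Set (ℤ × Mmon) := {i | Q ≤ cuspDen i ∧ i ∈ nearSet (α : ℂ) ∧ i ∈ closeSet α ‖w‖ ∧
    f i ≤ ENNReal.ofReal (4 * ((cuspDen i)⁻¹ * L))} with hS4
  have hcover : {i : ℤ × Mmon | Q ≤ cuspDen i} ⊆ (S1 ∪ S2) ∪ (S3 ∪ S4) := by
    intro i hi
    by_cases hv : 1 / 16 ≤ ‖cuspVar (α + w) i‖
    · exact Or.inl (Or.inl ⟨hi, hv⟩)
    · rcases poissonTerm_le_of_near hα hw i (not_le.1 hv) with h | h | h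
      · exact Or.inl (Or.inr h)
      · exact Or.inr (Or.inl ⟨hi, h⟩)
      · exact Or.inr (Or.inr ⟨hi, h⟩)
  have hε4 : 0 ≤ ε / 4 := by positivity
  have b1 : ∑' i : S1, f i ≤ ENNReal.ofReal (ε / 4) := by
    refine (tsum_poissonTerm_far_le hz hQ).trans (ENNReal.ofReal_le_ofReal ?_)
    rw [div_le_iff₀ hε] at hQ3
    rw [div_le_iff₀ hQ]
    linarith
  have b2 : ∑' i : S2, f i ≤ ENNReal.ofReal (ε / 4) := by
    refine (ENNReal.tsum_le_tsum fun i : S2 => i.2.2.2).trans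
      ((tsum_intermediate_le (z := α + w) hρ hL0 S2 fun i hi => ⟨hi.1, hi.2.1⟩).trans
        (ENNReal.ofReal_le_ofReal ?_))
    linarith
  have b3 : ∑' i : S3, f i ≤ ENNReal.ofReal (ε / 4) := by
    refine (ENNReal.tsum_le_tsum fun i : S3 => i.2.2.2).trans (le_trans ?_ (hQ1 Q hQ1'))
    exact ENNReal.tsum_mono_subtype (fun i => ENNReal.ofReal (4 * approxTerm α i))
      fun i hi => ⟨hi.1, hi.2.1⟩
  have b4 : ∑' i : S4, f i ≤ ENNReal.ofReal (ε / 4) := by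
    calc ∑' i : S4, f i ≤ ∑' _i : S4, ENNReal.ofReal (ε / 8) := by
          refine ENNReal.tsum_le_tsum fun i => i.2.2.2.2.trans (ENNReal.ofReal_le_ofReal ?_)
          have hd := cuspDen_pos i.1
          have := h2 i.1 i.2.2.1 (hQ2'.trans i.2.1) i.2.2.2.1
          have h5 : (cuspDen i)⁻¹ * L ≤ ε / 32 := by
            rw [inv_mul_le_iff₀ hd]
            linarith
          linarith
      _ ≤ ENNReal.ofReal (2 * (ε / 8)) :=
          tsum_closeSet_le (α := α) (ρ := ‖w‖) (by positivity) S4 fun i hi => hi.2.2.1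
      _ = _ := by congr 1; ring
  calc ∑' i : {i : ℤ × Mmon // Q ≤ cuspDen i}, f i
      ≤ ∑' i : ↥((S1 ∪ S2) ∪ (S3 ∪ S4)), f i := ENNReal.tsum_mono_subtype f hcover
    _ ≤ (∑' i : S1, f i + ∑' i : S2, f i) + (∑' i : S3, f i + ∑' i : S4, f i) :=
        (ENNReal.tsum_union_le f _ _).trans
          (add_le_add (ENNReal.tsum_union_le f _ _) (ENNReal.tsum_union_le f _ _))
    _ ≤ (ENNReal.ofReal (ε / 4) + ENNReal.ofReal (ε / 4)) +
        (ENNReal.ofReal (ε / 4) + ENNReal.ofReal (ε / 4)) := by gcongr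
    _ = ENNReal.ofReal ε := by
        rw [← ENNReal.ofReal_add hε4 hε4, ← ENNReal.ofReal_add (by positivity) (by positivity)]
        congr 1
        ring

theorem mul_gmat_apply (g : Matrix (Fin 2) (Fin 2) ℤ) (m : ℤ) :
    (g * gmat m) 0 0 = g 0 1 ∧ (g * gmat m) 0 1 = g 0 0 + g 0 1 * m ∧
      (g * gmat m) 1 0 = g 1 1 ∧ (g * gmat m) 1 1 = g 1 0 + g 1 1 * m := by
  simp [gmat, Matrix.mul_apply, Fin.sum_univ_two]

theorem mul_gmat_mem_Mmon {g : Matrix (Fin 2) (Fin 2) ℤ} (hg : g ∈ Mmon) {m : ℤ} (hm : 1 ≤ m) :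
    g * gmat m ∈ Mmon := by
  obtain ⟨hdet, h1, h2, h3, h4, h5, h6, h7⟩ := Mmon_entries hg
  obtain ⟨e1, e2, e3, e4⟩ := mul_gmat_apply g m
  rw [det2] at hdet
  refine Or.inr ?_
  rw [e1, e2, e3, e4]
  refine ⟨?_, ?_, ?_, h2, ?_, h5⟩
  · rw [show g 0 1 * (g 1 0 + g 1 1 * m) - (g 0 0 + g 0 1 * m) * g 1 1 =
      -(g 0 0 * g 1 1 - g 0 1 * g 1 0) by ring]
    omega
  · nlinarith
  · nlinarith
  · nlinarith

theorem exists_mul_gmat {g : Matrix (Fin 2) (Fin 2) ℤ} (hg : g ∈ Mmon) (hne : g ≠ 1) :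
    ∃ g' ∈ Mmon, ∃ m : ℤ, 1 ≤ m ∧ g = g' * gmat m := by
  obtain ⟨hdet, h1, h2, h3, h4, h5, h6, h7, h8⟩ := Mmon_entries_of_ne_one hg hne
  rw [det2] at hdet
  have hext : ∀ {g g' : Matrix (Fin 2) (Fin 2) ℤ}, g 0 0 = g' 0 0 → g 0 1 = g' 0 1 →
      g 1 0 = g' 1 0 → g 1 1 = g' 1 1 → g = g' := by
    intro g g' e1 e2 e3 e4
    ext i j
    fin_cases i <;> fin_cases j <;> assumption
  rcases (show g 1 0 = 1 ∨ 2 ≤ g 1 0 by omega) with hc | hc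
  · rcases (show g 0 0 = 0 ∨ g 0 0 = 1 by omega) with ha | ha
    · refine ⟨1, Or.inl rfl, g 1 1, h4, ?_⟩
      rw [ha, hc] at hdet
      rw [one_mul]
      refine hext ?_ ?_ ?_ ?_ <;> simp [gmat] <;> omega
    · rw [ha, hc] at hdet
      refine ⟨gmat 1, ?_, g 0 1, h2, ?_⟩
      · exact Or.inr (by simp [gmat])
      · obtain ⟨e1, e2, e3, e4⟩ := mul_gmat_apply (gmat 1) (g 0 1)
        refine hext ?_ ?_ ?_ ?_ <;> simp only [e1, e2, e3, e4] <;> simp [gmat] <;> omega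
  · set a := g 0 0
    set b := g 0 1
    set c := g 1 0
    set d := g 1 1
    set m := d / c with hm
    set r := d - c * m with hr
    set s := b - a * m with hs
    have hr' : r = d % c := by rw [hr, hm, Int.emod_def]
    have hr0 : 0 ≤ r := hr' ▸ Int.emod_nonneg _ (by omega)
    have hrc : r < c := hr' ▸ Int.emod_lt_of_pos _ (by omega)
    have hm1 : 1 ≤ m := by
      rw [hm, Int.le_ediv_iff_mul_le (by omega)]
      omega
    have hdet' : a * r - s * c = 1 ∨ a * r - s * c = -1 := by
      rw [show a * r - s * c = a * d - b * c by rw [hr, hs]; ring]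
      exact hdet
    have hs0 : 0 ≤ s := by
      by_contra hcon
      have : s ≤ -1 := by omega
      have : 0 ≤ a * r := mul_nonneg h1 hr0
      rcases hdet' with h | h <;> nlinarith
    have hsa : s ≤ a := by
      by_contra hcon
      have : a + 1 ≤ s := by omega
      have : a * r ≤ a * (c - 1) := mul_le_mul_of_nonneg_left (by omega) h1
      rcases hdet' with h | h <;> nlinarith
    have hsr : s ≤ r := by
      by_contra hcon
      have : r + 1 ≤ s := by omega
      have : a * r ≤ c * r := mul_le_mul_of_nonneg_right h8 hr0
      rcases hdet' with h | h <;> nlinarith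
    refine ⟨!![s, a; r, c], Or.inr ?_, m, hm1, ?_⟩
    · simp only [Matrix.of_apply, Matrix.cons_val', Matrix.cons_val_zero, Matrix.cons_val_one,
        Matrix.cons_val_fin_one]
      refine ⟨?_, h8, hsa, hs0, hrc.le, hsr⟩
      omega
    · obtain ⟨e1, e2, e3, e4⟩ := mul_gmat_apply !![s, a; r, c] m
      refine hext ?_ ?_ ?_ ?_
      · rw [e1]; simp [a]
      · rw [e2]; simp [hs, b]
      · rw [e3]; simp [c]
      · rw [e4]; simp [hr, d]

theorem irrational_xseq {α : ℝ} (hα : Irrational α) (k : ℕ) : Irrational (xseq α k) := by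
  induction k with
  | zero => exact hα.sub_intCast _
  | succ k ih => exact ih.inv.sub_intCast _

theorem xseq_mem_Ioo {α : ℝ} (hα : Irrational α) (k : ℕ) : xseq α k ∈ Ioo (0:ℝ) 1 := by
  have h := irrational_xseq hα k
  have h2 : xseq α k ∈ Ico (0:ℝ) 1 := by
    cases k <;> exact ⟨Int.fract_nonneg _, Int.fract_lt_one _⟩
  exact ⟨lt_of_le_of_ne h2.1 h.ne_zero.symm, h2.2⟩

theorem one_le_floor_inv_xseq {α : ℝ} (hα : Irrational α) (k : ℕ) : 1 ≤ ⌊(xseq α k)⁻¹⌋ := by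
  have h := xseq_mem_Ioo hα k
  rw [Int.le_floor]
  exact_mod_cast (one_le_inv₀ h.1).2 h.2.le

/-- The matrix of the `k`-th convergent of the continued fraction of `α`. -/
def cfMat (α : ℝ) : ℕ → Matrix (Fin 2) (Fin 2) ℤ
  | 0 => 1
  | k + 1 => cfMat α k * gmat ⌊(xseq α k)⁻¹⌋

theorem cfMat_mem_Mmon {α : ℝ} (hα : Irrational α) (k : ℕ) : cfMat α k ∈ Mmon := by
  induction k with
  | zero => exact Or.inl rfl
  | succ k ih => exact mul_gmat_mem_Mmon ih (one_le_floor_inv_xseq hα k)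

theorem cfMat_injective {α : ℝ} (hα : Irrational α) : Function.Injective (cfMat α) := by
  have h : StrictMono fun k => cfMat α k 1 0 + cfMat α k 1 1 := by
    refine strictMono_nat_of_lt_succ fun k => ?_
    obtain ⟨-, -, e3, e4⟩ := mul_gmat_apply (cfMat α k) ⌊(xseq α k)⁻¹⌋
    have h4 := (Mmon_entries (cfMat_mem_Mmon hα k)).2.2.2.2.1
    have h5 := one_le_floor_inv_xseq hα k
    simp only [cfMat, e3, e4]
    nlinarith
  intro k l hkl
  exact h.injective (by simp only [hkl])

/-- `g` sends `s` to `t`. -/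
def MobRel (g : Matrix (Fin 2) (Fin 2) ℤ) (s t : ℝ) : Prop :=
  (g 0 0 : ℝ) * s + g 0 1 = t * ((g 1 0 : ℝ) * s + g 1 1)

theorem mobRel_mul_gmat {g : Matrix (Fin 2) (Fin 2) ℤ} {m : ℤ} {s s' t : ℝ}
    (hs : s * (m + s') = 1) : MobRel (g * gmat m) s' t ↔ MobRel g s t := by
  obtain ⟨e1, e2, e3, e4⟩ := mul_gmat_apply g m
  have hs0 : s ≠ 0 := left_ne_zero_of_mul_eq_one hs
  unfold MobRel
  rw [e1, e2, e3, e4]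
  push_cast
  have h1 : (g 0 0 : ℝ) * s + g 0 1 = s * (g 0 1 * s' + (g 0 0 + g 0 1 * m)) := by
    linear_combination -(g 0 1 : ℝ) * hs
  have h2 : (g 1 0 : ℝ) * s + g 1 1 = s * (g 1 1 * s' + (g 1 0 + g 1 1 * m)) := by
    linear_combination -(g 1 1 : ℝ) * hs
  rw [h1, h2, mul_left_comm t s, mul_right_inj' hs0]

theorem xseq_mul_floor_add {α : ℝ} (hα : Irrational α) (k : ℕ) :
    xseq α k * (⌊(xseq α k)⁻¹⌋ + xseq α (k + 1)) = 1 := by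
  have : (⌊(xseq α k)⁻¹⌋ : ℝ) + xseq α (k + 1) = (xseq α k)⁻¹ := Int.floor_add_fract _
  rw [this, mul_inv_cancel₀ (xseq_mem_Ioo hα k).1.ne']

theorem mobRel_cfMat {α : ℝ} (hα : Irrational α) (k : ℕ) :
    MobRel (cfMat α k) (xseq α k) (xseq α 0) := by
  induction k with
  | zero => simp [MobRel, cfMat]
  | succ k ih => exact (mobRel_mul_gmat (xseq_mul_floor_add hα k)).2 ih

theorem cfMat_denom {α : ℝ} (hα : Irrational α) (k : ℕ) :
    ((cfMat α k 1 0 : ℝ) * xseq α k + cfMat α k 1 1) * ∏ i ∈ Finset.range k, xseq α i = 1 := by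
  induction k with
  | zero => simp [cfMat]
  | succ k ih =>
    obtain ⟨-, -, e3, e4⟩ := mul_gmat_apply (cfMat α k) ⌊(xseq α k)⁻¹⌋
    rw [Finset.prod_range_succ, cfMat, e3, e4]
    push_cast
    linear_combination ih +
      (cfMat α k 1 1 : ℝ) * (∏ i ∈ Finset.range k, xseq α i) * xseq_mul_floor_add hα k

theorem exists_eq_cfMat (α : ℝ) (N : ℕ) :
    ∀ g ∈ Mmon, g 1 0 + g 1 1 ≤ N → ∀ s ∈ Ioo (0:ℝ) 1, MobRel g s (xseq α 0) →
      ∃ k, g = cfMat α k ∧ s = xseq α k := by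
  induction N with
  | zero =>
    intro g hg hN
    have := Mmon_entries hg
    exfalso
    push_cast at hN
    omega
  | succ N ih =>
    intro g hg hN s hs hrel
    by_cases h1 : g = 1
    · refine ⟨0, h1, ?_⟩
      simpa [MobRel, h1] using hrel
    · obtain ⟨g', hg', m, hm, rfl⟩ := exists_mul_gmat hg h1
      obtain ⟨-, -, e3, e4⟩ := mul_gmat_apply g' m
      have hm' : (1:ℝ) ≤ m := by exact_mod_cast hm
      have hpos : 0 < (m:ℝ) + s := by linarith [hs.1]
      have hmul : ((m:ℝ) + s)⁻¹ * (m + s) = 1 := inv_mul_cancel₀ hpos.ne'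
      have hd := (Mmon_entries hg').2.2.2.2.1
      obtain ⟨k, hk1, hk2⟩ := ih g' hg' (by rw [e3, e4] at hN; push_cast at hN; nlinarith)
        ((m:ℝ) + s)⁻¹ ⟨inv_pos.2 hpos, inv_lt_one_of_one_lt₀ (by linarith [hs.1])⟩
        ((mobRel_mul_gmat hmul).1 hrel)
      have hfl : ⌊(xseq α k)⁻¹⌋ = m := by
        rw [← hk2, inv_inv, Int.floor_intCast_add, Int.floor_eq_zero_iff.2 ⟨hs.1.le, hs.2⟩, add_zero]
      refine ⟨k + 1, ?_, ?_⟩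
      · rw [cfMat, hfl, hk1]
      · rw [xseq, ← hk2, inv_inv, Int.fract_intCast_add, Int.fract_eq_self.2 ⟨hs.1.le, hs.2⟩]

theorem mobRel_boundaryPt {α : ℝ} (hα : Irrational α) (i : ℤ × Mmon) (s : ℝ) :
    boundaryPt α i = s ↔ MobRel i.2.1 s (α - i.1) := by
  rw [boundaryPt, MobRel, div_eq_iff (boundaryDen_ne_zero hα i)]
  constructor <;> intro h <;> linarith

/-- The index of the `k`-th term of the Brjuno series. -/
def cfIndex {α : ℝ} (hα : Irrational α) (k : ℕ) : ℤ × Mmon := (⌊α⌋, ⟨cfMat α k, cfMat_mem_Mmon hα k⟩)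

theorem boundaryTerm_cfIndex {α : ℝ} (hα : Irrational α) (k : ℕ) :
    boundaryTerm α (cfIndex hα k) = brjTerm α k := by
  have h1 : boundaryPt α (cfIndex hα k) = xseq α k :=
    (mobRel_boundaryPt hα _ _).2 (mobRel_cfMat hα k)
  have hx := xseq_mem_Ioo hα k
  have hm : xseq α k ∈ Ioc (0:ℝ) 1 := ⟨hx.1, hx.2.le⟩
  rw [boundaryTerm, h1, boundaryDensity, indicator_of_mem hm, brjTerm, Real.log_inv,
    eq_inv_of_mul_eq_one_right (cfMat_denom hα k), mul_comm]
  rfl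

theorem exists_eq_cfIndex {α : ℝ} (hα : Irrational α) {i : ℤ × Mmon}
    (hi : boundaryPt α i ∈ Ioo (0:ℝ) 1) : ∃ k, cfIndex hα k = i := by
  have hrel := (mobRel_boundaryPt hα i _).1 rfl
  have hmob := mob_mem_Icc i.2.2 ⟨hi.1.le, hi.2.le⟩
  have hD := mob_denom_pos i.2.2 hi.1.le
  have hβ : mob i.2.1 (boundaryPt α i) = α - i.1 := by
    rw [mob, div_eq_iff (by linarith)]
    exact hrel
  rw [hβ] at hmob
  have h1 : α - i.1 ≠ 1 := fun h => (hα.sub_intCast i.1).ne_one h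
  have hfl : ⌊α⌋ = i.1 := by
    rw [Int.floor_eq_iff]
    constructor
    · linarith [hmob.1]
    · linarith [lt_of_le_of_ne hmob.2 h1]
  have hx : xseq α 0 = α - i.1 := by rw [xseq, ← hfl]; rfl
  rw [← hx] at hrel
  obtain ⟨k, hk, -⟩ := exists_eq_cfMat α (i.2.1 1 0 + i.2.1 1 1).toNat i.2.1 i.2.2
    (Int.self_le_toNat _) _ hi hrel
  exact ⟨k, Prod.ext hfl (Subtype.ext hk.symm)⟩

theorem brjTerm_nonneg {α : ℝ} (hα : Irrational α) (k : ℕ) : 0 ≤ brjTerm α k := by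
  rw [← boundaryTerm_cfIndex hα]
  exact boundaryTerm_nonneg _ _

theorem tsum_boundaryTerm {α : ℝ} (hα : Irrational α) :
    ∑' i, ENNReal.ofReal (boundaryTerm α i) = ∑' k, ENNReal.ofReal (brjTerm α k) := by
  have hinj : Function.Injective (cfIndex hα) := by
    intro k l hkl
    have : cfMat α k = cfMat α l := congrArg (fun i : ℤ × Mmon => i.2.1) hkl
    exact cfMat_injective hα this
  rw [← hinj.tsum_eq]
  · simp only [boundaryTerm_cfIndex]
  · intro i hi
    have h : boundaryPt α i ∈ Ioc (0:ℝ) 1 := by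
      by_contra hcon
      exact hi (by simp [boundaryTerm, boundaryDensity, hcon])
    exact exists_eq_cfIndex hα ⟨h.1, lt_of_le_of_ne h.2 (boundaryPt_ne_one hα i)⟩

theorem summable_of_tsum_ofReal_ne_top {ι : Type*} {f : ι → ℝ} (hf : ∀ i, 0 ≤ f i)
    (h : ∑' i, ENNReal.ofReal (f i) ≠ ∞) : Summable f := by
  have := ENNReal.summable_toReal h
  simpa [ENNReal.toReal_ofReal (hf _)] using this

/-- Boundary convergence of `Im 𝓑` along an approach filter on which the contribution of the
large denominators is uniformly small. -/
theorem tendsto_im_BrjunoC {α : ℝ} (hα : Irrational α) {l : Filter ℂ}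
    (hl : l ≤ 𝓝[{w : ℂ | 0 < w.im}] 0)
    (ha : Tendsto (fun w : ℂ => Real.sqrt ‖w‖ * Real.log (1 + 1 / w.im)) l (𝓝 0))
    (hG : ∑' i : nearSet (α : ℂ), ENNReal.ofReal (approxTerm α i) ≠ ∞)
    (hb : ∀ ε > 0, ∃ Q, ∀ᶠ w in l, ∀ i ∈ nearSet (α : ℂ), Q ≤ cuspDen i →
      i ∈ closeSet α ‖w‖ → Real.log (1 + 1 / w.im) ≤ ε * cuspDen i) :
    Tendsto (fun w : ℂ => (BrjunoC ((α : ℂ) + w)).im) l (𝓝 (∑' n : ℕ, brjTerm α n)) := by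
  rcases eq_or_neBot l with rfl | hne
  · exact tendsto_bot
  obtain ⟨hlim, hfin⟩ := tendsto_tsum_poissonTerm hα hl
    fun ε hε => tail_of_approximation hα hl ha hG hb hε
  rw [tsum_boundaryTerm hα] at hlim hfin
  have hsum := summable_of_tsum_ofReal_ne_top (brjTerm_nonneg hα) hfin
  have h1 := (ENNReal.tendsto_toReal hfin).comp hlim
  rw [← ENNReal.ofReal_tsum_of_nonneg (brjTerm_nonneg hα) hsum,
    ENNReal.toReal_ofReal (tsum_nonneg (brjTerm_nonneg hα))] at h1
  refine h1.congr' ?_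
  have hpos : ∀ᶠ w in l, w ∈ {w : ℂ | 0 < w.im} := hl self_mem_nhdsWithin
  filter_upwards [hpos] with w hw
  have hz : 0 < ((α : ℂ) + w).im := by simpa using hw
  rw [Function.comp_apply, ← ofReal_im_BrjunoC hz,
    ENNReal.toReal_ofReal (im_BrjunoC_nonneg hz)]

theorem exists_sibling (i : ℤ × Mmon) (hi : 2 ≤ i.2.1 1 1) :
    ∃ j : ℤ × Mmon, cuspPt j = cuspPt i ∧ cuspDen j = cuspDen i ∧ det2 j.2.1 = -det2 i.2.1 := by
  obtain ⟨n, g, hg⟩ := i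
  replace hi : 2 ≤ g 1 1 := hi
  have hne : g ≠ 1 := by
    rintro rfl
    simp at hi
  obtain ⟨hdet, ha, hb, hc, hd, hbd, hcd, hab, hac⟩ := Mmon_entries_of_ne_one hg hne
  have key : g 0 1 - g 0 0 ≤ g 1 1 - g 1 0 := by
    by_contra! hcon
    rw [det2] at hdet
    have h1 : g 0 0 * (g 1 1 - g 1 0) ≤ g 1 0 * (g 1 1 - g 1 0) :=
      mul_le_mul_of_nonneg_right hac (by omega)
    have h2 : g 1 0 * (g 1 1 - g 1 0 + 1) ≤ g 1 0 * (g 0 1 - g 0 0) :=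
      mul_le_mul_of_nonneg_left (by omega) (by omega)
    have h3 : g 0 0 * g 1 1 - g 0 1 * g 1 0 ≤ -g 1 0 := by linarith
    have hc1 : g 1 0 = 1 := by omega
    rw [hc1] at hac hdet
    have : g 0 0 = 0 ∨ g 0 0 = 1 := by omega
    rcases this with h | h <;> rw [h] at hdet hcon <;> omega
  refine ⟨(n, ⟨!![g 0 1 - g 0 0, g 0 1; g 1 1 - g 1 0, g 1 1], Or.inr ?_⟩), ?_, ?_, ?_⟩
  · rw [det2] at hdet
    simp
    refine ⟨?_, by omega, by omega, by omega, by omega, by omega⟩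
    rcases hdet with h | h
    · right; linarith
    · left; linarith
  · simp [cuspPt, cuspDen]
  · simp [cuspDen]
  · simp [det2]
    ring

theorem boundaryPt_eq {α : ℝ} (i : ℤ × Mmon)
    (hs : (det2 i.2.1 : ℝ) * (α - cuspPt i) = |α - cuspPt i|) :
    boundaryPt α i = cuspDen i ^ 2 * |α - cuspPt i| /
      (1 - (i.2.1 1 0 : ℝ) * (cuspDen i * |α - cuspPt i|)) := by
  have hd := cuspDen_pos i
  have hdet : (det2 i.2.1 : ℝ) * det2 i.2.1 = 1 := by
    rw [← abs_mul_abs_self, abs_det2, one_mul]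
  have hx : α - i.1 = (α - cuspPt i) + i.2.1 0 1 / cuspDen i := by
    rw [cuspPt]
    ring
  have hdet' : (det2 i.2.1 : ℝ) = i.2.1 0 0 * cuspDen i - i.2.1 0 1 * i.2.1 1 0 := by
    rw [det2, cuspDen]
    push_cast
    ring
  have h1 : (i.2.1 1 1 : ℝ) * (α - i.1) - i.2.1 0 1 = cuspDen i * (α - cuspPt i) := by
    rw [hx, ← cuspDen]
    field_simp
    ring
  have h2 : (i.2.1 0 0 : ℝ) - (i.2.1 1 0 : ℝ) * (α - i.1) =
      (det2 i.2.1 - i.2.1 1 0 * (cuspDen i * (α - cuspPt i))) / cuspDen i := by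
    rw [hx, hdet']
    field_simp
    ring
  have hne : (det2 i.2.1 : ℝ) ≠ 0 := by
    intro h
    rw [h] at hdet
    norm_num at hdet
  have h3 : 1 - (i.2.1 1 0 : ℝ) * (cuspDen i * (det2 i.2.1 * (α - cuspPt i))) =
      det2 i.2.1 * (det2 i.2.1 - i.2.1 1 0 * (cuspDen i * (α - cuspPt i))) := by
    linear_combination -hdet
  have h4 : cuspDen i ^ 2 * ((det2 i.2.1 : ℝ) * (α - cuspPt i)) =
      det2 i.2.1 * (cuspDen i ^ 2 * (α - cuspPt i)) := by ring
  rw [boundaryPt, h1, h2, ← hs, h3, h4, mul_div_mul_left _ _ hne, div_div_eq_mul_div]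
  congr 1
  ring

theorem log_one_add_two_mul_le {t : ℝ} (ht : 8 ≤ t) :
    Real.log (1 + 2 * t) ≤ 2 * Real.log (7 / 8 * t) := by
  rw [← Real.log_rpow (by positivity)]
  refine Real.log_le_log (by linarith) ?_
  norm_num
  nlinarith

theorem approxTerm_le_boundaryTerm {α : ℝ} (hα : Irrational α) {i : ℤ × Mmon}
    (hi : i ∈ nearSet (α : ℂ)) (hs : (det2 i.2.1 : ℝ) * (α - cuspPt i) = |α - cuspPt i|) :
    approxTerm α i ≤ 4 * boundaryTerm α i := by
  have hu := hα.abs_sub_cuspPt_pos i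
  rw [nearSet, mem_ofPred_eq, norm_ofReal_sub_cuspPt] at hi
  have hd := cuspDen_pos i
  obtain ⟨-, -, -, hc0, -, -, hcd', -⟩ := Mmon_entries i.2.2
  have hc : (0:ℝ) ≤ i.2.1 1 0 := by exact_mod_cast hc0
  have hcd : (i.2.1 1 0 : ℝ) ≤ cuspDen i := by
    rw [cuspDen]
    exact_mod_cast hcd'
  have hpt := boundaryPt_eq i hs
  rw [approxTerm, boundaryTerm, hpt]
  set u := |α - cuspPt i|
  have hcv : (i.2.1 1 0 : ℝ) * (cuspDen i * u) ≤ cuspDen i ^ 2 * u := by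
    rw [sq, mul_assoc]
    gcongr
  have hcv0 : 0 ≤ (i.2.1 1 0 : ℝ) * (cuspDen i * u) := by positivity
  have hv : 0 < cuspDen i ^ 2 * u := by positivity
  set v := cuspDen i ^ 2 * u with hvdef
  set σ := v / (1 - (i.2.1 1 0 : ℝ) * (cuspDen i * u)) with hσ
  have hden : 0 < 1 - (i.2.1 1 0 : ℝ) * (cuspDen i * u) := by linarith
  have hσ0 : 0 < σ := by positivity
  have hσ1 : σ ≤ 8 / 7 * v := by
    rw [hσ, div_le_iff₀ hden]
    nlinarith
  have hm : σ ∈ Ioc (0:ℝ) 1 := ⟨hσ0, by linarith⟩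
  rw [boundaryDensity, indicator_of_mem hm]
  have hlog : Real.log (1 + 2 / v) ≤ 2 * -Real.log σ := by
    have h8 : 8 ≤ 1 / v := by
      rw [le_div_iff₀ hv]
      linarith
    have h1 := log_one_add_two_mul_le h8
    rw [mul_one_div] at h1
    refine h1.trans ?_
    rw [← Real.log_inv]
    have : 7 / 8 * (1 / v) ≤ σ⁻¹ := by
      rw [← one_div, le_div_iff₀ hσ0]
      calc 7 / 8 * (1 / v) * σ ≤ 7 / 8 * (1 / v) * (8 / 7 * v) := by gcongr
        _ = 1 := by field_simp
    have := Real.log_le_log (by positivity) this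
    linarith
  have hσlog : 0 ≤ -Real.log σ := by
    have := Real.log_nonpos hσ0.le hm.2
    linarith
  have hD : (2 * cuspDen i)⁻¹ ≤ ((i.2.1 1 0 : ℝ) * σ + i.2.1 1 1)⁻¹ := by
    refine inv_anti₀ ?_ ?_
    · have := hd
      rw [cuspDen] at this
      positivity
    · have : (i.2.1 1 0 : ℝ) * σ ≤ cuspDen i * 1 := by
        have := hm.2
        gcongr
      rw [← cuspDen]
      linarith
  calc (cuspDen i)⁻¹ * Real.log (1 + 2 / v) ≤ (cuspDen i)⁻¹ * (2 * -Real.log σ) := by gcongr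
    _ = 4 * (-Real.log σ * (2 * cuspDen i)⁻¹) := by
        rw [mul_inv]
        ring
    _ ≤ _ := by gcongr

theorem exists_approxTerm_le_boundaryTerm {α : ℝ} (hα : Irrational α) {i : ℤ × Mmon}
    (hi : i ∈ nearSet (α : ℂ)) (h2 : 2 ≤ cuspDen i) :
    ∃ j, cuspPt j = cuspPt i ∧ approxTerm α i ≤ 4 * boundaryTerm α j := by
  have hcase : (det2 i.2.1 : ℝ) * (α - cuspPt i) = |α - cuspPt i| ∨
      -(det2 i.2.1 : ℝ) * (α - cuspPt i) = |α - cuspPt i| := by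
    have h : |(det2 i.2.1 : ℝ) * (α - cuspPt i)| = |α - cuspPt i| := by
      rw [abs_mul, abs_det2, one_mul]
    rcases abs_choice ((det2 i.2.1 : ℝ) * (α - cuspPt i)) with h' | h'
    · left; rw [← h', h]
    · right; rw [neg_mul, ← h', h]
  rcases hcase with h | h
  · exact ⟨i, rfl, approxTerm_le_boundaryTerm hα hi h⟩
  · obtain ⟨j, hj1, hj2, hj3⟩ := exists_sibling i (by rw [cuspDen] at h2; exact_mod_cast h2)
    refine ⟨j, hj1, ?_⟩
    have hj : j ∈ nearSet (α : ℂ) := by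
      rw [nearSet, mem_ofPred_eq, hj1, hj2]
      exact hi
    have hap : approxTerm α i = approxTerm α j := by rw [approxTerm, approxTerm, hj1, hj2]
    rw [hap]
    refine approxTerm_le_boundaryTerm hα hj ?_
    rw [hj1, hj3]
    push_cast
    exact h

theorem inv_cuspDen_le (i : ℤ × Mmon) : (cuspDen i)⁻¹ ≤ (Real.sqrt (cuspDen i))⁻¹ := by
  have h := one_le_cuspDen i
  refine inv_anti₀ (Real.sqrt_pos.2 (by linarith)) ?_
  rw [Real.sqrt_le_left (by linarith)]
  nlinarith

theorem abs_sub_round_le (α : ℝ) (i : ℤ × Mmon) :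
    |cuspDen i * α - round (cuspDen i * α)| ≤ cuspDen i * |α - cuspPt i| := by
  have hd := cuspDen_pos i
  refine (round_le _ (i.1 * i.2.1 1 1 + i.2.1 0 1)).trans (le_of_eq ?_)
  rw [← abs_of_pos hd, ← abs_mul, abs_of_pos hd, mul_sub, cuspPt_eq_div, mul_div_cancel₀ _ hd.ne']

theorem exists_approxTerm_le {α : ℝ} (hα : Irrational α) (N : ℝ) :
    ∃ C : ℝ, 0 ≤ C ∧
      ∀ i, cuspDen i ≤ N → approxTerm α i ≤ C * (Real.sqrt (cuspDen i))⁻¹ := by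
  obtain ⟨m, hm⟩ := exists_nat_ge N
  obtain ⟨q, hq, hmin⟩ := Finset.exists_min_image (Finset.Icc (1:ℤ) (m + 1))
    (fun q => |(q:ℝ) * α - round ((q:ℝ) * α)|) ⟨1, by simp⟩
  set δ := |(q:ℝ) * α - round ((q:ℝ) * α)| with hδ
  have hδ0 : 0 < δ := by
    have hq0 : q ≠ 0 := by
      have := (Finset.mem_Icc.1 hq).1
      omega
    exact abs_pos.2 (sub_ne_zero.2 ((hα.intCast_mul hq0).ne_int _))
  refine ⟨Real.log (1 + 2 / δ), Real.log_nonneg ?_, fun i hi => ?_⟩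
  · have : 0 < 2 / δ := by positivity
    linarith
  have hd := one_le_cuspDen i
  have hu := hα.abs_sub_cuspPt_pos i
  have h1 : δ ≤ cuspDen i * |α - cuspPt i| := by
    refine (hmin (i.2.1 1 1) ?_).trans (abs_sub_round_le α i)
    have h1 : (i.2.1 1 1 : ℝ) ≤ m := hi.trans hm
    have h2 : i.2.1 1 1 ≤ m := by exact_mod_cast h1
    have := (Mmon_entries i.2.2).2.2.2.2.1
    rw [Finset.mem_Icc]
    omega
  have h2 : δ ≤ cuspDen i ^ 2 * |α - cuspPt i| := by
    rw [sq, mul_assoc]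
    nlinarith
  rw [approxTerm, mul_comm]
  have hlog : Real.log (1 + 2 / (cuspDen i ^ 2 * |α - cuspPt i|)) ≤ Real.log (1 + 2 / δ) := by
    refine Real.log_le_log (by positivity) ?_
    gcongr
  have h0 : 0 ≤ Real.log (1 + 2 / δ) := Real.log_nonneg (by
    have : 0 < 2 / δ := by positivity
    linarith)
  exact mul_le_mul hlog (inv_cuspDen_le i) (by positivity) h0

theorem tsum_nearSet_inv_sqrt_ne_top (z : ℂ) {C : ℝ} (hC : 0 ≤ C) :
    ∑' i : nearSet z, ENNReal.ofReal (C * (Real.sqrt (cuspDen i))⁻¹) ≠ ∞ := by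
  simp_rw [ENNReal.ofReal_mul hC]
  rw [ENNReal.tsum_mul_left]
  refine ENNReal.mul_ne_top ENNReal.ofReal_ne_top (ne_top_of_le_ne_top ENNReal.ofReal_ne_top
    (le_trans ?_ (tsum_near_le z one_pos)))
  exact ENNReal.tsum_mono_subtype (fun i => ENNReal.ofReal (Real.sqrt (cuspDen i))⁻¹)
    fun i hi => ⟨one_le_cuspDen i, hi⟩

/-- The majorants are summable at a Brjuno number. -/
theorem tsum_approxTerm_ne_top_of_summable {α : ℝ} (hα : Irrational α)
    (hs : Summable (brjTerm α)) :
    ∑' i : nearSet (α : ℂ), ENNReal.ofReal (approxTerm α i) ≠ ∞ := by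
  have hV : ∑' i, ENNReal.ofReal (boundaryTerm α i) ≠ ∞ := by
    rw [tsum_boundaryTerm hα, ← ENNReal.ofReal_tsum_of_nonneg (brjTerm_nonneg hα) hs]
    exact ENNReal.ofReal_ne_top
  obtain ⟨C, hC0, hC⟩ := exists_approxTerm_le hα 2
  have hj : ∀ i : nearSet (α : ℂ), ∃ j, cuspPt j = cuspPt i ∧
      approxTerm α i ≤ C * (Real.sqrt (cuspDen i))⁻¹ + 4 * boundaryTerm α j := by
    intro i
    rcases le_total (cuspDen i) 2 with h | h
    · exact ⟨i, rfl, by linarith [hC i h, boundaryTerm_nonneg α i]⟩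
    · obtain ⟨j, hj1, hj2⟩ := exists_approxTerm_le_boundaryTerm hα i.2 h
      have : 0 ≤ C * (Real.sqrt (cuspDen i))⁻¹ := by positivity
      exact ⟨j, hj1, by linarith⟩
  choose j hj1 hj2 using hj
  have hinj : Function.Injective fun i : nearSet (α : ℂ) => (cuspSign i.1, j i) := by
    intro i i' h
    simp only [Prod.mk.injEq] at h
    refine Subtype.ext (cusp_ext ?_ (det2_eq_of_cuspSign_eq h.1))
    rw [← hj1, ← hj1, h.2]
  have hfin : ∑' i : nearSet (α : ℂ), ENNReal.ofReal (4 * boundaryTerm α (j i)) ≠ ∞ := by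
    refine ne_top_of_le_ne_top ?_ (ENNReal.tsum_comp_le_tsum_of_injective hinj
      fun p : Bool × (ℤ × Mmon) => ENNReal.ofReal (4 * boundaryTerm α p.2))
    simp_rw [ENNReal.ofReal_mul zero_le_four]
    rw [ENNReal.tsum_prod', tsum_bool, ENNReal.tsum_mul_left]
    have := ENNReal.mul_ne_top (ENNReal.ofReal_ne_top (r := 4)) hV
    exact ENNReal.add_ne_top.2 ⟨this, this⟩
  refine ne_top_of_le_ne_top (ENNReal.add_ne_top.2 ⟨tsum_nearSet_inv_sqrt_ne_top (α : ℂ) hC0, hfin⟩)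
    ?_
  rw [← ENNReal.tsum_add]
  refine ENNReal.tsum_le_tsum fun i => ?_
  refine (ENNReal.ofReal_le_ofReal (hj2 i)).trans ENNReal.ofReal_add_le

theorem tendsto_sqrt_mul_log {l : Filter ℂ} (hl : l ≤ 𝓝[{w : ℂ | 0 < w.im}] 0) {a C : ℝ}
    (ha : a < 1 / 2) (h : ∀ᶠ w in l, Real.log (1 + 1 / w.im) ≤ C * ‖w‖ ^ (-a)) :
    Tendsto (fun w : ℂ => Real.sqrt ‖w‖ * Real.log (1 + 1 / w.im)) l (𝓝 0) := by
  have hn : Tendsto (fun w : ℂ => ‖w‖) l (𝓝 0) := by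
    have := (continuous_norm (E := ℂ)).tendsto 0
    rw [norm_zero] at this
    exact this.mono_left (hl.trans nhdsWithin_le_nhds)
  have hlim : Tendsto (fun w : ℂ => C * ‖w‖ ^ (1 / 2 - a)) l (𝓝 0) := by
    have := (hn.rpow_const (Or.inr (by linarith : (0:ℝ) ≤ 1 / 2 - a))).const_mul C
    rwa [Real.zero_rpow (by linarith), mul_zero] at this
  have hpos : ∀ᶠ w in l, w ∈ {w : ℂ | 0 < w.im} := hl self_mem_nhdsWithin
  refine squeeze_zero' ?_ ?_ hlim
  · filter_upwards [hpos] with w hw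
    have : 0 < 1 / w.im := one_div_pos.2 hw
    exact mul_nonneg (Real.sqrt_nonneg _) (Real.log_nonneg (by linarith))
  · filter_upwards [h, hpos] with w hw hw'
    have hw0 : 0 < ‖w‖ := norm_pos_iff.2 fun h0 => by
      rw [h0] at hw'
      simp at hw'
    calc Real.sqrt ‖w‖ * Real.log (1 + 1 / w.im) ≤ Real.sqrt ‖w‖ * (C * ‖w‖ ^ (-a)) := by gcongr
      _ = C * ‖w‖ ^ (1 / 2 - a) := by
        rw [Real.sqrt_eq_rpow, sub_eq_add_neg, Real.rpow_add hw0]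
        ring

theorem log_le_two_mul_sqrt {x : ℝ} (hx : 0 ≤ x) : Real.log x ≤ 2 * Real.sqrt x := by
  have := Real.log_le_rpow_div hx (by norm_num : (0:ℝ) < 1 / 2)
  rw [← Real.sqrt_eq_rpow] at this
  linarith

theorem eventually_norm_lt_one (s : Set ℂ) : ∀ᶠ w in 𝓝[s] (0:ℂ), w ∈ s ∧ ‖w‖ < 1 := by
  refine eventually_nhdsWithin_iff.2 ?_
  filter_upwards [Metric.ball_mem_nhds (0:ℂ) one_pos] with w hw hws
  exact ⟨hws, by simpa using hw⟩

theorem log_one_add_inv_im_le {H : ℝ} {w : ℂ} (hw : 0 < w.im) (hw1 : ‖w‖ < 1)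
    (hH : |w.re| ^ H ≤ w.im) :
    Real.log (1 + 1 / w.im) ≤ 1 + max H 1 * Real.log (2 / ‖w‖) := by
  have hρ : 0 < ‖w‖ := norm_pos_iff.2 fun h => by simp [h] at hw
  have hre : |w.re| ≤ 1 := (abs_re_le_norm w).trans hw1.le
  have him : w.im ≤ 1 := ((le_abs_self _).trans (abs_im_le_norm w)).trans hw1.le
  have hM : 1 ≤ max H 1 := le_max_right _ _
  have h1 : |w.re| ^ max H 1 ≤ w.im := by
    rcases (abs_nonneg w.re).eq_or_lt with h0 | h0
    · rw [← h0, Real.zero_rpow (by linarith)]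
      exact hw.le
    · exact (Real.rpow_le_rpow_of_exponent_ge h0 hre (le_max_left _ _)).trans hH
  have h2 : w.im ^ max H 1 ≤ w.im := by
    simpa using Real.rpow_le_rpow_of_exponent_ge hw him hM
  have hsum : ‖w‖ ≤ |w.re| + |w.im| := norm_le_abs_re_add_abs_im w
  rw [abs_of_pos hw] at hsum
  have h3 : (‖w‖ / 2) ^ max H 1 ≤ w.im := by
    rcases le_total (‖w‖ / 2) w.im with h | h
    · exact (Real.rpow_le_rpow (by positivity) h (by linarith)).trans h2
    · exact (Real.rpow_le_rpow (by positivity) (by linarith) (by linarith)).trans h1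
  have h4 : 1 / w.im ≤ (2 / ‖w‖) ^ max H 1 := by
    rw [← inv_div ‖w‖ 2, Real.inv_rpow (by positivity), ← one_div]
    exact one_div_le_one_div_of_le (by positivity) h3
  have h5 : 1 ≤ (2 / ‖w‖) ^ max H 1 :=
    Real.one_le_rpow (by rw [le_div_iff₀ hρ]; linarith) (by linarith)
  calc Real.log (1 + 1 / w.im) ≤ Real.log (2 * (2 / ‖w‖) ^ max H 1) :=
        Real.log_le_log (by positivity) (by linarith)
    _ = Real.log 2 + max H 1 * Real.log (2 / ‖w‖) := by
        rw [Real.log_mul (by norm_num) (by positivity), Real.log_rpow (by positivity)]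
    _ ≤ _ := by linarith [Real.log_two_lt_d9]

theorem log_two_div_le {ρ : ℝ} (h0 : 0 < ρ) : Real.log (2 / ρ) ≤ 8 * ρ ^ (-(1 / 4) : ℝ) := by
  have h1 := Real.log_le_rpow_div (by positivity : 0 ≤ 2 / ρ) (by norm_num : (0:ℝ) < 1 / 4)
  have h2 : (2:ℝ) ^ (1 / 4 : ℝ) ≤ 2 := by
    simpa using Real.rpow_le_rpow_of_exponent_le (by norm_num : (1:ℝ) ≤ 2)
      (by norm_num : (1 / 4 : ℝ) ≤ 1)
  rw [Real.div_rpow (by norm_num) h0.le, div_eq_mul_inv _ (ρ ^ _), ← Real.rpow_neg h0.le] at h1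
  have h3 : 0 < ρ ^ (-(1 / 4) : ℝ) := by positivity
  nlinarith

theorem log_two_div_le_of_mem_closeSet {α ρ : ℝ} (hα : Irrational α) (hρ : 0 < ρ) {i : ℤ × Mmon}
    (hi : i ∈ closeSet α ρ) :
    Real.log (2 / ρ) ≤
      1 + cuspDen i * approxTerm α i + 4 * Real.sqrt (cuspDen i) := by
  have hu := hα.abs_sub_cuspPt_pos i
  have hd := cuspDen_pos i
  have h1 : 2 / ρ ≤ 2 * (1 + 2 / (cuspDen i ^ 2 * |α - cuspPt i|)) * cuspDen i ^ 2 := by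
    have : 2 * (1 + 2 / (cuspDen i ^ 2 * |α - cuspPt i|)) * cuspDen i ^ 2 =
        2 * cuspDen i ^ 2 + 4 / |α - cuspPt i| := by
      field_simp
      ring
    rw [this]
    have : 2 / ρ ≤ 4 / |α - cuspPt i| := by
      rw [div_le_div_iff₀ hρ hu]
      linarith [hi.1]
    linarith [sq_nonneg (cuspDen i)]
  have h2 := Real.log_le_log (by positivity) h1
  rw [Real.log_mul (by positivity) (by positivity), Real.log_mul (by norm_num) (by positivity),
    Real.log_pow] at h2
  have h3 : cuspDen i * approxTerm α i =
      Real.log (1 + 2 / (cuspDen i ^ 2 * |α - cuspPt i|)) := by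
    rw [approxTerm, mul_inv_cancel_left₀ hd.ne']
  rw [h3]
  have h4 := log_le_two_mul_sqrt hd.le
  push_cast at h2
  linarith [Real.log_two_lt_d9]

theorem exists_approxTerm_le_of_tsum {α : ℝ}
    (hG : ∑' i : nearSet (α : ℂ), ENNReal.ofReal (approxTerm α i) ≠ ∞) {ε : ℝ} (hε : 0 < ε) :
    ∃ Q : ℝ, ∀ i ∈ nearSet (α : ℂ), Q ≤ cuspDen i → approxTerm α i ≤ ε := by
  obtain ⟨Q, hQ⟩ := exists_tsum_approxTerm_le hG hε
  refine ⟨Q, fun i hi hiQ => ?_⟩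
  have h1 := (ENNReal.le_tsum (f := fun i : {i | Q ≤ cuspDen i ∧ i ∈ nearSet (α : ℂ)} =>
    ENNReal.ofReal (4 * approxTerm α i)) ⟨i, hiQ, hi⟩).trans (hQ Q le_rfl)
  rw [ENNReal.ofReal_le_ofReal_iff hε.le] at h1
  have := approxTerm_nonneg α i
  dsimp only at h1
  linarith

/-- Convergence in regions of polynomial tangency. -/
theorem tendsto_im_BrjunoC_of_summable {α : ℝ} (hα : Irrational α) (hs : Summable (brjTerm α))
    (H : ℝ) :
    Tendsto (fun w : ℂ => (BrjunoC ((α : ℂ) + w)).im)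
      (𝓝[{w : ℂ | 0 < w.im ∧ |w.re| ^ H ≤ w.im}] 0) (𝓝 (∑' n : ℕ, brjTerm α n)) := by
  have hG := tsum_approxTerm_ne_top_of_summable hα hs
  have hl : 𝓝[{w : ℂ | 0 < w.im ∧ |w.re| ^ H ≤ w.im}] 0 ≤ 𝓝[{w : ℂ | 0 < w.im}] (0:ℂ) :=
    nhdsWithin_mono _ fun w hw => hw.1
  have hM : 1 ≤ max H 1 := le_max_right _ _
  refine tendsto_im_BrjunoC hα hl (tendsto_sqrt_mul_log hl
    (a := 1 / 4) (C := 1 + max H 1 * 8) (by norm_num) ?_) hG ?_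
  · filter_upwards [eventually_norm_lt_one _] with w hw
    have hρ : 0 < ‖w‖ := norm_pos_iff.2 fun h => by
      have := hw.1.1
      simp [h] at this
    have h1 := log_one_add_inv_im_le hw.1.1 hw.2 hw.1.2
    have h2 : 1 ≤ ‖w‖ ^ (-(1 / 4) : ℝ) :=
      Real.one_le_rpow_of_pos_of_le_one_of_nonpos hρ hw.2.le (by norm_num)
    have h3 := mul_le_mul_of_nonneg_left (log_two_div_le hρ) (by linarith : 0 ≤ max H 1)
    linarith
  · intro ε hε
    set M := max H 1
    obtain ⟨Q, hQ⟩ := exists_approxTerm_le_of_tsum hG (by positivity : 0 < ε / (2 * M))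
    refine ⟨max Q ((2 * (1 + 5 * M) / ε) ^ 2), ?_⟩
    filter_upwards [eventually_norm_lt_one _] with w hw i hi hiQ hic
    have hρ : 0 < ‖w‖ := norm_pos_iff.2 fun h => by
      have := hw.1.1
      simp [h] at this
    have hd := one_le_cuspDen i
    have h1 := log_one_add_inv_im_le hw.1.1 hw.2 hw.1.2
    have h2 := log_two_div_le_of_mem_closeSet hα hρ hic
    have h3 := hQ i hi ((le_max_left _ _).trans hiQ)
    have h4 : 2 * (1 + 5 * M) / ε ≤ Real.sqrt (cuspDen i) :=
      Real.le_sqrt_of_sq_le ((le_max_right _ _).trans hiQ)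
    have h5 : 1 ≤ Real.sqrt (cuspDen i) := Real.one_le_sqrt.2 hd
    have h6 : Real.sqrt (cuspDen i) * Real.sqrt (cuspDen i) = cuspDen i :=
      Real.mul_self_sqrt (by linarith)
    rw [div_le_iff₀ hε] at h4
    have h7 : 2 * (1 + 5 * M) * Real.sqrt (cuspDen i) ≤ ε * cuspDen i := by
      calc _ ≤ Real.sqrt (cuspDen i) * ε * Real.sqrt (cuspDen i) := by gcongr
        _ = ε * cuspDen i := by rw [mul_right_comm, h6, mul_comm]
    have h8 : M * (cuspDen i * approxTerm α i) ≤ ε / 2 * cuspDen i := by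
      calc M * (cuspDen i * approxTerm α i) ≤ M * (cuspDen i * (ε / (2 * M))) := by gcongr
        _ = ε / 2 * cuspDen i := by
          field_simp
    have h9 := mul_le_mul_of_nonneg_left h2 (by linarith : 0 ≤ M)
    nlinarith

theorem exists_le_mul_rpow_cuspDen {α h : ℝ}
    (hd : Tendsto (fun q : ℕ => |(q : ℝ) * α - (round ((q : ℝ) * α) : ℝ)| * (q : ℝ) ^ (1 / h - 1))
      atTop atTop) (K : ℝ) :
    ∃ N : ℝ, ∀ i, N ≤ cuspDen i → K ≤ |α - cuspPt i| * cuspDen i ^ (1 / h) := by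
  obtain ⟨N, hN⟩ := eventually_atTop.1 (hd.eventually_ge_atTop K)
  refine ⟨N, fun i hi => ?_⟩
  have hpos := cuspDen_pos i
  have hcast : ((i.2.1 1 1).toNat : ℝ) = cuspDen i := by
    have h0 := (Mmon_entries i.2.2).2.2.2.2.1
    rw [cuspDen, ← Int.cast_natCast, Int.toNat_of_nonneg (by omega)]
  have h1 := hN (i.2.1 1 1).toNat (by rw [← hcast] at hi; exact_mod_cast hi)
  rw [hcast] at h1
  refine h1.trans ?_
  have h2 : cuspDen i ^ (1 / h) = cuspDen i * cuspDen i ^ (1 / h - 1) := by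
    rw [Real.rpow_sub_one hpos.ne', mul_div_cancel₀ _ hpos.ne']
  rw [h2, ← mul_assoc, mul_comm _ (cuspDen i)]
  gcongr
  exact abs_sub_round_le α i

theorem tsum_approxTerm_ne_top_of_diophantine {α h : ℝ} (hα : Irrational α) (h0 : 0 < h)
    (hd : Tendsto (fun q : ℕ => |(q : ℝ) * α - (round ((q : ℝ) * α) : ℝ)| * (q : ℝ) ^ (1 / h - 1))
      atTop atTop) :
    ∑' i : nearSet (α : ℂ), ENNReal.ofReal (approxTerm α i) ≠ ∞ := by
  obtain ⟨N, hN⟩ := exists_le_mul_rpow_cuspDen hd 1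
  obtain ⟨C, hC0, hC⟩ := exists_approxTerm_le hα N
  have hC' : 0 ≤ C + (2 + 2 / h) := by positivity
  refine ne_top_of_le_ne_top (tsum_nearSet_inv_sqrt_ne_top (α : ℂ) hC')
    (ENNReal.tsum_le_tsum fun i => ENNReal.ofReal_le_ofReal ?_)
  have h1 := one_le_cuspDen i.1
  have hs : 1 ≤ Real.sqrt (cuspDen i.1) := Real.one_le_sqrt.2 h1
  have hs2 : Real.sqrt (cuspDen i.1) * Real.sqrt (cuspDen i.1) = cuspDen i.1 :=
    Real.mul_self_sqrt (by linarith)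
  have hu := hα.abs_sub_cuspPt_pos i.1
  have hinv : 0 ≤ (Real.sqrt (cuspDen i.1))⁻¹ := by positivity
  rw [add_mul]
  rcases le_total (cuspDen i.1) N with hi | hi
  · have h2 : 0 ≤ (2 + 2 / h) * (Real.sqrt (cuspDen i.1))⁻¹ := by positivity
    linarith [hC i hi]
  · have h2 : 0 ≤ C * (Real.sqrt (cuspDen i.1))⁻¹ := by positivity
    have h3 := hN i hi
    set d := cuspDen i.1
    set u := |α - cuspPt i.1|
    have hd0 : 0 < d := by linarith
    have h4 : 2 / (d ^ 2 * u) ≤ 2 * d ^ (1 / h) := by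
      rw [div_le_iff₀ (by positivity)]
      have : 1 ≤ d ^ 2 := by nlinarith
      nlinarith
    have h5 : 1 ≤ d ^ (1 / h) := Real.one_le_rpow h1 (by positivity)
    have h6 : Real.log (1 + 2 / (d ^ 2 * u)) ≤ (2 + 2 / h) * Real.sqrt d := by
      calc Real.log (1 + 2 / (d ^ 2 * u)) ≤ Real.log (3 * d ^ (1 / h)) :=
            Real.log_le_log (by positivity) (by linarith)
        _ = Real.log 3 + 1 / h * Real.log d := by
            rw [Real.log_mul (by norm_num) (by positivity), Real.log_rpow hd0]
        _ ≤ 2 * Real.sqrt d + 1 / h * (2 * Real.sqrt d) := by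
            have := Real.log_le_sub_one_of_pos (by norm_num : (0:ℝ) < 3)
            have := log_le_two_mul_sqrt hd0.le
            gcongr
            linarith
        _ = _ := by ring
    have h7 : approxTerm α i ≤ (2 + 2 / h) * (Real.sqrt d)⁻¹ := by
      calc approxTerm α i ≤ d⁻¹ * ((2 + 2 / h) * Real.sqrt d) := by
            rw [approxTerm]
            gcongr
        _ = (2 + 2 / h) * (Real.sqrt d)⁻¹ := by
            rw [← hs2, mul_inv]
            have : Real.sqrt d ≠ 0 := by positivity
            rw [hs2]
            field_simp
    linarith

theorem log_one_add_inv_im_le_rpow {h : ℝ} (h0 : 0 < h) (h1 : h ≤ 1) {w : ℂ} (hw : 0 < w.im)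
    (hw1 : ‖w‖ < 1) (hH : Real.exp (-|w.re| ^ (-h)) ≤ w.im) :
    Real.log (1 + 1 / w.im) ≤ (4 + 1 / h) * ‖w‖ ^ (-h) := by
  have hρ : 0 < ‖w‖ := norm_pos_iff.2 fun h => by simp [h] at hw
  have hsum : ‖w‖ ≤ |w.re| + |w.im| := norm_le_abs_re_add_abs_im w
  rw [abs_of_pos hw] at hsum
  have him : w.im < 1 := ((le_abs_self _).trans (abs_im_le_norm w)).trans_lt hw1
  have hone : 1 ≤ ‖w‖ ^ (-h) :=
    Real.one_le_rpow_of_pos_of_le_one_of_nonpos hρ hw1.le (by linarith)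
  have hh : 0 < 1 / h := by positivity
  rcases le_total (‖w‖ / 2) w.im with hc | hc
  · have h2 : 1 / w.im ≤ 2 / ‖w‖ := by
      rw [div_le_div_iff₀ hw hρ]
      linarith
    have h3 : 1 ≤ 1 / ‖w‖ := by
      rw [le_div_iff₀ hρ]
      linarith
    have h4 := Real.log_le_rpow_div (by positivity : 0 ≤ ‖w‖⁻¹) h0
    rw [Real.inv_rpow hρ.le, ← Real.rpow_neg hρ.le] at h4
    calc Real.log (1 + 1 / w.im) ≤ Real.log (3 * ‖w‖⁻¹) := by
          refine Real.log_le_log (by positivity) ?_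
          rw [← one_div]
          linarith [mul_one_div 2 ‖w‖]
      _ = Real.log 3 + Real.log ‖w‖⁻¹ := Real.log_mul (by norm_num) (by positivity)
      _ ≤ 2 + ‖w‖ ^ (-h) / h := by
          have := Real.log_le_sub_one_of_pos (by norm_num : (0:ℝ) < 3)
          linarith
      _ ≤ _ := by
          rw [div_eq_mul_one_div]
          linarith
  · have hx : ‖w‖ / 2 ≤ |w.re| := by linarith
    have h2 : |w.re| ^ (-h) ≤ 2 * ‖w‖ ^ (-h) := by
      have h3 := Real.rpow_le_rpow_of_nonpos (by positivity : 0 < ‖w‖ / 2) hx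
        (by linarith : -h ≤ 0)
      rw [Real.div_rpow hρ.le (by norm_num), Real.rpow_neg (by norm_num : (0:ℝ) ≤ 2), div_inv_eq_mul]
        at h3
      have h4 : (2:ℝ) ^ h ≤ 2 := by
        simpa using Real.rpow_le_rpow_of_exponent_le (by norm_num : (1:ℝ) ≤ 2) h1
      nlinarith
    have h3 : 1 / w.im ≤ Real.exp (|w.re| ^ (-h)) := by
      rw [div_le_iff₀ hw]
      calc (1:ℝ) = Real.exp (|w.re| ^ (-h)) * Real.exp (-|w.re| ^ (-h)) := by
            rw [← Real.exp_add, add_neg_cancel, Real.exp_zero]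
        _ ≤ _ := by gcongr
    have h4 : 1 ≤ Real.exp (|w.re| ^ (-h)) := Real.one_le_exp (by positivity)
    calc Real.log (1 + 1 / w.im) ≤ Real.log (2 * Real.exp (|w.re| ^ (-h))) :=
          Real.log_le_log (by positivity) (by linarith)
      _ = Real.log 2 + |w.re| ^ (-h) := by
          rw [Real.log_mul (by norm_num) (by positivity), Real.log_exp]
      _ ≤ _ := by
          have : 0 ≤ 1 / h * ‖w‖ ^ (-h) := by positivity
          rw [add_mul]
          linarith [Real.log_two_lt_d9]

/-- Convergence in regions of exponential tangency, under a diophantine condition. -/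
theorem tendsto_im_BrjunoC_of_diophantine {α h : ℝ} (hα : Irrational α) (h0 : 0 < h)
    (h1 : h < 1 / 2)
    (hd : Tendsto (fun q : ℕ => |(q : ℝ) * α - (round ((q : ℝ) * α) : ℝ)| * (q : ℝ) ^ (1 / h - 1))
      atTop atTop) :
    Tendsto (fun w : ℂ => (BrjunoC ((α : ℂ) + w)).im)
      (𝓝[{w : ℂ | 0 < w.im ∧ Real.exp (-|w.re| ^ (-h)) ≤ w.im}] 0)
      (𝓝 (∑' n : ℕ, brjTerm α n)) := by
  have hl : 𝓝[{w : ℂ | 0 < w.im ∧ Real.exp (-|w.re| ^ (-h)) ≤ w.im}] 0 ≤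
      𝓝[{w : ℂ | 0 < w.im}] (0:ℂ) := nhdsWithin_mono _ fun w hw => hw.1
  refine tendsto_im_BrjunoC hα hl (tendsto_sqrt_mul_log hl
    (a := h) (C := 4 + 1 / h) h1 ?_) (tsum_approxTerm_ne_top_of_diophantine hα h0 hd) ?_
  · filter_upwards [eventually_norm_lt_one _] with w hw
    exact log_one_add_inv_im_le_rpow h0 (by linarith) hw.1.1 hw.2 hw.1.2
  · intro ε hε
    set C := 4 + 1 / h with hC
    have hC0 : 0 < C := by positivity
    obtain ⟨N, hN⟩ := exists_le_mul_rpow_cuspDen hd (2 * (C / ε) ^ (1 / h))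
    refine ⟨N, ?_⟩
    filter_upwards [eventually_norm_lt_one _] with w hw i _ hiN hic
    have hρ : 0 < ‖w‖ := norm_pos_iff.2 fun h => by
      have := hw.1.1
      simp [h] at this
    have hpos := cuspDen_pos i
    have h2 := log_one_add_inv_im_le_rpow h0 (by linarith) hw.1.1 hw.2 hw.1.2
    refine h2.trans ?_
    have h3 : (C / ε) ^ (1 / h) ≤ ‖w‖ * cuspDen i ^ (1 / h) := by
      have h4 := hN i hiN
      have h5 : |α - cuspPt i| * cuspDen i ^ (1 / h) ≤ 2 * ‖w‖ * cuspDen i ^ (1 / h) := by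
        gcongr
        exact hic.1.le
      linarith
    have h4 := Real.rpow_le_rpow (by positivity) h3 h0.le
    rw [Real.mul_rpow hρ.le (by positivity), one_div, Real.rpow_inv_rpow (by positivity) h0.ne',
      Real.rpow_inv_rpow hpos.le h0.ne', div_le_iff₀ hε] at h4
    rw [Real.rpow_neg hρ.le, ← div_eq_mul_inv, div_le_iff₀ (by positivity)]
    linarith

/-- non-tangential (and tangential, under a diophantine condition)
boundary convergence of `Im 𝓑` to the real Brjuno function `B` (Theorem 5.19). -/
theorem im_brjuno_boundary_limit :
    (∀ α : ℝ, Irrational α → Summable (brjTerm α) →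
      ∀ H : ℝ, 0 < H →
        Tendsto (fun w : ℂ => (BrjunoC ((α : ℂ) + w)).im)
          (nhdsWithin 0 {w : ℂ | 0 < w.im ∧ |w.re| ^ H ≤ w.im})
          (nhds (∑' n : ℕ, brjTerm α n))) ∧
      ∀ h : ℝ, 0 < h → h < 1 / 2 → ∀ α : ℝ, Irrational α →
        Tendsto
          (fun q : ℕ =>
            |(q : ℝ) * α - (round ((q : ℝ) * α) : ℝ)| * (q : ℝ) ^ (1 / h - 1))
          atTop atTop →
        Tendsto (fun w : ℂ => (BrjunoC ((α : ℂ) + w)).im)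
          (nhdsWithin 0 {w : ℂ | 0 < w.im ∧ Real.exp (-|w.re| ^ (-h)) ≤ w.im})
          (nhds (∑' n : ℕ, brjTerm α n)) := by
  refine ⟨fun α hα hs H _ => tendsto_im_BrjunoC_of_summable hα hs H,
    fun h h0 h1 α hα hd => tendsto_im_BrjunoC_of_diophantine hα h0 h1 hd⟩

end
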